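/- arXiv:2603.28739 — 4 statements merged into one kernel-verified Lean document; each statement's English description precedes it below -/
import Mathlib

section
/- Let K ≥ 1 auxiliary tasks be weighted by λ_1,…,λ_K ≥ 0 with Λ := Σ_{k=1}^K λ_k > 0, and set w*_aux := (1/Λ) Σ_{k=1}^K λ_k w*_k. Then the expected main-task generalization error of the weighted least-squares estimator satisfies the exact identity E_K = ((σ_m² + Σ_{k=1}^K λ_k² σ_k²)/(1+Λ)²)·d/(N−d−1) + (Λ/(1+Λ))²·||Σ_x^{1/2}(w*_aux − w*_m)||² + σ_m². In particular, when K = 0 or Λ = 0 (main task only, ordinary least squares), E_0 = σ_m²·d/(N−d−1) + σ_m². -/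
open MeasureTheory ProbabilityTheory Matrix

noncomputable section

namespace Stmt0

/-- The quadratic form `vᵀ Σ v`, which equals `‖Σ^{1/2} v‖²` for positive semidefinite `Σ`. -/
def quadForm {d : ℕ} (Sigx : Matrix (Fin d) (Fin d) ℝ) (v : Fin d → ℝ) : ℝ :=
  v ⬝ᵥ (Sigx *ᵥ v)

/-- `(XᵀX)⁻¹Xᵀ`, the OLS map (Moore–Penrose pseudoinverse for full-column-rank `X`). -/
def pinv {N d : ℕ} (X : Matrix (Fin N) (Fin d) ℝ) : Matrix (Fin d) (Fin N) ℝ :=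
  (Xᵀ * X)⁻¹ * Xᵀ

/-- Law of a vector of `n` i.i.d. centered Gaussians with variance `v`. -/
def gaussianVec (n : ℕ) (v : ℝ) : Measure (Fin n → ℝ) :=
  Measure.pi fun _ => gaussianReal 0 (Real.toNNReal v)

/-- Sample space: (standard-Gaussian feature source, auxiliary noises, main-task noise,
standard-Gaussian test-feature source, test label noise). -/
abbrev Sample (N d K : ℕ) : Type :=
  (Fin N → Fin d → ℝ) × (Fin K → Fin N → ℝ) × (Fin N → ℝ) × (Fin d → ℝ) × ℝ

/-- Joint law: everything independent; features are i.i.d. standard Gaussian sources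
(turned into `N(0, Σ_x)` rows via `x = A g` with `A Aᵀ = Σ_x`); noises are i.i.d. centered
Gaussians with the corresponding variances. -/
def P (N d K : ℕ) (σm : ℝ) (σa : Fin K → ℝ) : Measure (Sample N d K) :=
  (Measure.pi fun _ : Fin N => gaussianVec d 1).prod
    ((Measure.pi fun k : Fin K => gaussianVec N (σa k ^ 2)).prod
      ((gaussianVec N (σm ^ 2)).prod
        ((gaussianVec d 1).prod (gaussianReal 0 (Real.toNNReal (σm ^ 2))))))

/-- Design matrix `X` whose rows are i.i.d. `N(0, A Aᵀ)`. -/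
def Xmat {N d K : ℕ} (A : Matrix (Fin d) (Fin d) ℝ) (ω : Sample N d K) :
    Matrix (Fin N) (Fin d) ℝ :=
  Matrix.of ω.1 * Aᵀ

/-- Main-task labels `Y_m = X w*_m + ε_m`. -/
def Ym {N d K : ℕ} (A : Matrix (Fin d) (Fin d) ℝ) (wm : Fin d → ℝ) (ω : Sample N d K) :
    Fin N → ℝ :=
  Xmat A ω *ᵥ wm + ω.2.2.1

/-- Auxiliary labels `Y_k = X w*_k + ε_k`. -/
def Ya {N d K : ℕ} (A : Matrix (Fin d) (Fin d) ℝ) (wk : Fin K → Fin d → ℝ) (k : Fin K)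
    (ω : Sample N d K) : Fin N → ℝ :=
  Xmat A ω *ᵥ wk k + ω.2.1 k

/-- The weighted least-squares estimator
`ŵ_D = (1/(1+∑λ_k))((XᵀX)⁻¹XᵀY_m + ∑_k λ_k (XᵀX)⁻¹XᵀY_k)`. -/
def wHat {N d K : ℕ} (A : Matrix (Fin d) (Fin d) ℝ) (wm : Fin d → ℝ)
    (wk : Fin K → Fin d → ℝ) (lam : Fin K → ℝ) (ω : Sample N d K) : Fin d → ℝ :=
  (1 / (1 + ∑ k, lam k)) •
    (pinv (Xmat A ω) *ᵥ Ym A wm ω + ∑ k, lam k • (pinv (Xmat A ω) *ᵥ Ya A wk k ω))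

/-- The OLS estimator on the main task alone (the `K = 0` / `Λ = 0` case). -/
def wOLS {N d K : ℕ} (A : Matrix (Fin d) (Fin d) ℝ) (wm : Fin d → ℝ) (ω : Sample N d K) :
    Fin d → ℝ :=
  pinv (Xmat A ω) *ᵥ Ym A wm ω

/-- Fresh test feature `x ~ N(0, A Aᵀ)`. -/
def xTest {N d K : ℕ} (A : Matrix (Fin d) (Fin d) ℝ) (ω : Sample N d K) : Fin d → ℝ :=
  A *ᵥ ω.2.2.2.1

/-- Fresh test label `y_m = xᵀw*_m + ε`. -/
def yTest {N d K : ℕ} (A : Matrix (Fin d) (Fin d) ℝ) (wm : Fin d → ℝ) (ω : Sample N d K) : ℝ :=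
  xTest A ω ⬝ᵥ wm + ω.2.2.2.2


lemma inv_eq_lint (a : ℝ) (ha : 0 ≤ a) :
    (ENNReal.ofReal a)⁻¹ = ∫⁻ t in Set.Ioi (0:ℝ), ENNReal.ofReal (Real.exp (-t * a)) := by
  rcases ha.eq_or_lt with rfl | ha
  · simp
  · have h1 := integral_exp_mul_Ioi (a := -a) (by linarith) 0
    have h2 := integrableOn_exp_mul_Ioi (a := -a) (by linarith) 0
    have h3 : ∀ t : ℝ, -t * a = -a * t := fun t => by ring
    simp_rw [h3]
    rw [← ofReal_integral_eq_lintegral_ofReal h2 (ae_of_all _ fun t => (Real.exp_pos _).le), h1]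
    rw [← ENNReal.ofReal_inv_of_pos ha]
    congr 1
    simp

lemma gauss_one (t : ℝ) (ht : 0 < t) :
    ∫ x, Real.exp (-t * x ^ 2) ∂(gaussianReal 0 1) = (1 + 2 * t) ^ (-(1/2 : ℝ)) := by
  rw [integral_gaussianReal_eq_integral_smul (by norm_num)]
  simp only [gaussianPDFReal, smul_eq_mul]
  have h : ∀ x : ℝ, (√(2 * Real.pi * ((1 : NNReal) : ℝ)))⁻¹ *
      Real.exp (-(x - 0) ^ 2 / (2 * ((1 : NNReal) : ℝ))) * Real.exp (-t * x ^ 2) =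
      (√(2 * Real.pi))⁻¹ * Real.exp (-(1/2 + t) * x ^ 2) := by
    intro x
    rw [mul_assoc, ← Real.exp_add]
    congr 2
    · simp
    · simp; ring
  simp_rw [h]
  rw [integral_const_mul, integral_gaussian, ← Real.sqrt_inv, ← Real.sqrt_mul (by positivity),
    Real.rpow_neg (by positivity), ← Real.sqrt_eq_rpow, ← Real.sqrt_inv]
  congr 1
  field_simp

lemma gauss_exp {E : Type*} [NormedAddCommGroup E] [InnerProductSpace ℝ E]
    [FiniteDimensional ℝ E] [MeasurableSpace E] [BorelSpace E] (t : ℝ) (ht : 0 < t) :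
    ∫⁻ x, ENNReal.ofReal (Real.exp (-t * ‖x‖ ^ 2)) ∂(stdGaussian E) =
      ENNReal.ofReal ((1 + 2 * t) ^ (-(Module.finrank ℝ E / 2 : ℝ))) := by
  rw [← ofReal_integral_eq_lintegral_ofReal]
  rotate_left
  · refine Integrable.of_bound (C := 1) (by fun_prop) (ae_of_all _ fun x => ?_)
    rw [Real.norm_eq_abs, abs_of_pos (Real.exp_pos _), Real.exp_le_one_iff]
    nlinarith [sq_nonneg ‖x‖]
  · exact ae_of_all _ fun x => (Real.exp_pos _).le
  congr 1
  rw [stdGaussian, integral_map (Measurable.aemeasurable (by fun_prop))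
    (Measurable.aestronglyMeasurable (by fun_prop))]
  have h : ∀ x : Fin (Module.finrank ℝ E) → ℝ,
      Real.exp (-t * ‖∑ i, x i • stdOrthonormalBasis ℝ E i‖ ^ 2) = ∏ i, Real.exp (-t * x i ^ 2) := by
    intro x
    rw [← Real.exp_sum, ← Finset.mul_sum]
    congr 2
    rw [← (stdOrthonormalBasis ℝ E).sum_sq_norm_inner_right]
    congr 1; ext i
    rw [(stdOrthonormalBasis ℝ E).orthonormal.inner_right_fintype]
    simp
  simp_rw [h]
  rw [integral_fintype_prod_eq_prod (f := fun i x => Real.exp (-t * x ^ 2))]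
  simp only [gauss_one t ht, Finset.prod_const, Finset.card_univ, Fintype.card_fin]
  rw [← Real.rpow_natCast, ← Real.rpow_mul (by positivity)]
  congr 1; ring

lemma rpow_lint (n : ℕ) (hn : 3 ≤ n) :
    ∫⁻ t in Set.Ioi (0:ℝ), ENNReal.ofReal ((1 + 2 * t) ^ (-(n / 2 : ℝ))) =
      ENNReal.ofReal (1 / ((n:ℝ) - 2)) := by
  have hn' : (3:ℝ) ≤ n := by exact_mod_cast hn
  have hd : ∀ x ∈ Set.Ici (0:ℝ), HasDerivAt
      (fun t : ℝ => -(1 / ((n:ℝ) - 2)) * (1 + 2 * t) ^ (-(n / 2 : ℝ) + 1))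
      ((1 + 2 * x) ^ (-(n / 2 : ℝ))) x := by
    intro x hx
    have hx : 0 ≤ x := hx
    have h1 : HasDerivAt (fun t : ℝ => 1 + 2 * t) 2 x := by
      simpa using ((hasDerivAt_id x).const_mul 2).const_add 1
    have h2 := (h1.rpow_const (p := -(n / 2 : ℝ) + 1) (Or.inl (by positivity))).const_mul
      (-(1 / ((n:ℝ) - 2)))
    have : (n:ℝ) - 2 ≠ 0 := by linarith
    have h4 : -(1 / ((n:ℝ) - 2)) * (2 * (-(n / 2 : ℝ) + 1) * (1 + 2 * x) ^ (-(n / 2 : ℝ) + 1 - 1))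
        = (1 + 2 * x) ^ (-(n / 2 : ℝ)) := by
      rw [add_sub_cancel_right]
      field_simp
      ring
    rw [h4] at h2
    exact h2
  have hp : ∀ x ∈ Set.Ioi (0:ℝ), 0 ≤ (1 + 2 * x) ^ (-(n / 2 : ℝ)) := by
    intro x hx
    have hx : 0 < x := hx
    positivity
  have hl : Filter.Tendsto (fun t : ℝ => -(1 / ((n:ℝ) - 2)) * (1 + 2 * t) ^ (-(n / 2 : ℝ) + 1))
      Filter.atTop (nhds 0) := by
    have h1 : Filter.Tendsto (fun t : ℝ => 1 + 2 * t) Filter.atTop Filter.atTop :=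
      Filter.tendsto_atTop_add_const_left _ _
        (Filter.tendsto_id.const_mul_atTop (by norm_num))
    have h2 := (tendsto_rpow_neg_atTop (y := (n / 2 : ℝ) - 1) (by linarith)).comp h1
    have h3 := h2.const_mul (-(1 / ((n:ℝ) - 2)))
    rw [mul_zero] at h3
    refine h3.congr fun t => ?_
    simp only [Function.comp]
    congr 2; ring
  have hI := integrableOn_Ioi_deriv_of_nonneg' hd hp hl
  have hv := integral_Ioi_of_hasDerivAt_of_nonneg' hd hp hl
  rw [← ofReal_integral_eq_lintegral_ofReal hI
    ((ae_restrict_iff' measurableSet_Ioi).2 (ae_of_all _ hp)), hv]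
  congr 1
  simp

lemma gauss_inv {E : Type*} [NormedAddCommGroup E] [InnerProductSpace ℝ E]
    [FiniteDimensional ℝ E] [MeasurableSpace E] [BorelSpace E] (n : ℕ) (hn : 3 ≤ n)
    (hE : Module.finrank ℝ E = n) :
    ∫⁻ x, (ENNReal.ofReal (‖x‖ ^ 2))⁻¹ ∂(stdGaussian E) = ENNReal.ofReal (1 / ((n:ℝ) - 2)) := by
  simp_rw [fun x : E => inv_eq_lint (‖x‖ ^ 2) (by positivity)]
  rw [lintegral_lintegral_swap]
  · rw [← rpow_lint n hn]
    refine setLIntegral_congr_fun measurableSet_Ioi fun t ht => ?_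
    rw [gauss_exp t ht, hE]
  · exact Measurable.aemeasurable (by fun_prop)

lemma gauss_proj {E : Type*} [NormedAddCommGroup E] [InnerProductSpace ℝ E]
    [FiniteDimensional ℝ E] [MeasurableSpace E] [BorelSpace E] (V : Submodule ℝ E) :
    (stdGaussian E).map V.orthogonalProjectionOnto = stdGaussian V := by
  apply Measure.ext_of_charFun
  ext t
  rw [charFun_stdGaussian, charFun_apply, integral_map (by fun_prop) (by fun_prop)]
  have := charFun_stdGaussian (E := E) (t : E)
  rw [charFun_apply] at this
  simpa using this

lemma gauss_proj_inv {E : Type*} [NormedAddCommGroup E] [InnerProductSpace ℝ E]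
    [FiniteDimensional ℝ E] [MeasurableSpace E] [BorelSpace E] (V : Submodule ℝ E) (n : ℕ)
    (hn : 3 ≤ n) (hE : Module.finrank ℝ V = n) :
    ∫⁻ x, (ENNReal.ofReal (‖V.orthogonalProjectionOnto x‖ ^ 2))⁻¹ ∂(stdGaussian E) =
      ENNReal.ofReal (1 / ((n:ℝ) - 2)) := by
  rw [← gauss_inv (E := V) n hn hE, ← gauss_proj V, lintegral_map]
  · fun_prop
  · fun_prop

lemma swap_pi (N d : ℕ) (μ : Measure ℝ) [IsProbabilityMeasure μ] :
    (Measure.pi fun _ : Fin N => Measure.pi fun _ : Fin d => μ).map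
      (fun x (j : Fin d) (i : Fin N) => x i j) =
    Measure.pi fun _ : Fin d => Measure.pi fun _ : Fin N => μ := by
  simp_rw [← Measure.infinitePi_eq_pi]
  rw [← Measure.infinitePi_map_curry (fun (_ : Fin d) (_ : Fin N) => μ),
    ← Measure.infinitePi_map_curry (fun (_ : Fin N) (_ : Fin d) => μ),
    Measure.map_map (by fun_prop) (by fun_prop)]
  have h := Measure.infinitePi_map_piCongrLeft (fun (_ : Fin d × Fin N) => μ) (Equiv.prodComm (Fin N) (Fin d))
  rw [← h, Measure.map_map (by fun_prop) (by fun_prop)]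
  congr 1

lemma null_sub {E : Type*} [NormedAddCommGroup E] [InnerProductSpace ℝ E]
    [FiniteDimensional ℝ E] [MeasurableSpace E] [BorelSpace E] (V : Submodule ℝ E)
    (hn : 3 ≤ Module.finrank ℝ Vᗮ) :
    ∀ᵐ x ∂(stdGaussian E), x ∉ V := by
  have h := gauss_proj_inv Vᗮ _ hn rfl
  have h2 := ae_lt_top (μ := stdGaussian E)
    (f := fun x => (ENNReal.ofReal (‖Vᗮ.orthogonalProjectionOnto x‖ ^ 2))⁻¹)
    (by fun_prop) (by rw [h]; exact ENNReal.ofReal_ne_top)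
  filter_upwards [h2] with x hx hxV
  rw [Submodule.orthogonalProjectionOnto_orthogonal_apply_eq_zero hxV] at hx
  simp at hx

lemma finrank_orth_span {N k : ℕ} {w : Fin k → EuclideanSpace ℝ (Fin N)}
    (hw : LinearIndependent ℝ w) :
    Module.finrank ℝ (Submodule.span ℝ (Set.range w))ᗮ = N - k := by
  have h1 := Submodule.finrank_add_finrank_orthogonal (Submodule.span ℝ (Set.range w))
  rw [finrank_span_eq_card hw, Fintype.card_fin, finrank_euclideanSpace_fin] at h1
  omega

lemma meas_li (N k : ℕ) :
    MeasurableSet {v : Fin k → EuclideanSpace ℝ (Fin N) | LinearIndependent ℝ v} :=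
  (isOpen_setOfPred_linearIndependent).measurableSet

lemma ae_li (N k : ℕ) (hN : k + 1 < N) :
    ∀ᵐ v ∂(Measure.pi fun _ : Fin k => stdGaussian (EuclideanSpace ℝ (Fin N))),
      LinearIndependent ℝ v := by
  induction k with
  | zero => exact ae_of_all _ fun v => linearIndependent_empty_type
  | succ k ih =>
    have ih := ih (by omega)
    have hmp := measurePreserving_piFinSuccAbove
      (fun _ : Fin (k+1) => stdGaussian (EuclideanSpace ℝ (Fin N))) 0
    have hmp2 := hmp.symm
    rw [← hmp2.map_eq, ae_map_iff hmp2.measurable.aemeasurable (meas_li N (k+1))]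
    have hms : MeasurableSet {z : EuclideanSpace ℝ (Fin N) × (Fin k → EuclideanSpace ℝ (Fin N)) |
        LinearIndependent ℝ ((MeasurableEquiv.piFinSuccAbove
          (fun _ => EuclideanSpace ℝ (Fin N)) 0).symm z)} := hmp2.measurable (meas_li N (k+1))
    rw [Measure.ae_prod_iff_ae_ae hms, Measure.ae_ae_comm hms]
    filter_upwards [ih] with w hw
    filter_upwards [null_sub (Submodule.span ℝ (Set.range w))
      (by rw [finrank_orth_span hw]; omega)] with x hx
    have := (linearIndependent_finCons (x := x) (v := w)).2 ⟨hw, hx⟩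
    have h3 : (MeasurableEquiv.piFinSuccAbove
        (fun _ => EuclideanSpace ℝ (Fin N)) 0).symm (x, w) = Fin.cons x w :=
      Fin.insertNth_zero (α := fun _ => EuclideanSpace ℝ (Fin N)) x w
    rw [h3]
    exact this

lemma gram_inv_diag {N k : ℕ} (v : Fin (k+1) → EuclideanSpace ℝ (Fin N))
    (hv : LinearIndependent ℝ v) (j : Fin (k+1)) :
    ENNReal.ofReal ((gram ℝ v)⁻¹ j j) = (ENNReal.ofReal
      (‖(Submodule.span ℝ (Set.range fun i => v (j.succAbove i)))ᗮ.orthogonalProjectionOnto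
        (v j)‖ ^ 2))⁻¹ := by
  set V := Submodule.span ℝ (Set.range fun i => v (j.succAbove i)) with hV
  have hpd : (gram ℝ v).PosDef := (posDef_gram_iff_linearIndependent).2 hv
  have hdet : IsUnit (gram ℝ v).det := hpd.det_pos.ne'.isUnit
  set a : Fin (k+1) → ℝ := fun i => (gram ℝ v)⁻¹ i j with ha
  set c := ∑ i, a i • v i with hc
  have hin : ∀ i, inner ℝ (v i) c = (1 : Matrix (Fin (k+1)) (Fin (k+1)) ℝ) i j := by
    intro i
    rw [← Matrix.mul_nonsing_inv _ hdet, Matrix.mul_apply, hc, inner_sum]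
    simp only [inner_smul_right, gram_apply, ha]
    exact Finset.sum_congr rfl fun _ _ => mul_comm _ _
  have hcV : c ∈ Vᗮ := by
    rw [hV, Submodule.mem_orthogonal]
    intro u hu
    induction hu using Submodule.span_induction with
    | mem x hx =>
      obtain ⟨i, rfl⟩ := hx
      rw [hin, Matrix.one_apply_ne (Fin.succAbove_ne j i)]
    | zero => simp
    | add x y _ _ hx hy => rw [inner_add_left, hx, hy, add_zero]
    | smul r x _ hx => rw [inner_smul_left, hx, mul_zero]
  have hPc : Vᗮ.orthogonalProjectionOnto c = a j • Vᗮ.orthogonalProjectionOnto (v j) := by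
    rw [hc, map_sum, Fin.sum_univ_succAbove _ j, Finset.sum_eq_zero, add_zero, map_smul]
    intro i _
    rw [map_smul, Submodule.orthogonalProjectionOnto_orthogonal_apply_eq_zero, smul_zero]
    exact Submodule.subset_span ⟨i, rfl⟩
  have h1 : a j * ‖Vᗮ.orthogonalProjectionOnto (v j)‖ ^ 2 = 1 := by
    have h2 := hin j
    rw [Matrix.one_apply_eq] at h2
    have h3 : inner ℝ (Vᗮ.orthogonalProjectionOnto (v j)) (⟨c, hcV⟩ : Vᗮ) = (1:ℝ) := by
      rw [Submodule.inner_orthogonalProjectionOnto_eq_of_mem_right]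
      exact h2
    have h4 : Vᗮ.orthogonalProjectionOnto c = (⟨c, hcV⟩ : Vᗮ) :=
      Submodule.orthogonalProjectionOnto_mem_subspace_eq_self (⟨c, hcV⟩ : Vᗮ)
    rw [← h4, hPc, inner_smul_right, real_inner_self_eq_norm_sq] at h3
    exact h3
  have hpos : 0 < ‖Vᗮ.orthogonalProjectionOnto (v j)‖ ^ 2 := by
    rcases (sq_nonneg ‖Vᗮ.orthogonalProjectionOnto (v j)‖).eq_or_lt with h | h
    · rw [← h] at h1; simp at h1
    · exact h
  rw [← ENNReal.ofReal_inv_of_pos hpos]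
  congr 1
  exact eq_inv_of_mul_eq_one_left h1

lemma meas_gram_inv (N k : ℕ) (i j : Fin k) :
    Measurable fun v : Fin k → EuclideanSpace ℝ (Fin N) => (gram ℝ v)⁻¹ i j := by
  simp only [Matrix.inv_def, Ring.inverse_eq_inv', Matrix.smul_apply, smul_eq_mul]
  have hc : Continuous fun v : Fin k → EuclideanSpace ℝ (Fin N) => gram ℝ v := by
    refine continuous_matrix fun i j => ?_
    simp only [gram_apply]
    fun_prop
  exact (hc.matrix_det.measurable.inv).mul (hc.matrix_adjugate.matrix_elem i j).measurable

lemma lint_diag (N k : ℕ) (hN : k + 2 < N) (j : Fin (k+1)) :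
    ∫⁻ v, ENNReal.ofReal ((gram ℝ v)⁻¹ j j)
      ∂(Measure.pi fun _ : Fin (k+1) => stdGaussian (EuclideanSpace ℝ (Fin N))) =
      ENNReal.ofReal (1 / ((N:ℝ) - k - 2)) := by
  have hmp := (measurePreserving_piFinSuccAbove
      (fun _ : Fin (k+1) => stdGaussian (EuclideanSpace ℝ (Fin N))) j).symm
  have hm : Measurable fun v : Fin (k+1) → EuclideanSpace ℝ (Fin N) =>
      ENNReal.ofReal ((gram ℝ v)⁻¹ j j) := (meas_gram_inv N (k+1) j j).ennreal_ofReal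
  rw [← hmp.lintegral_comp hm, lintegral_prod_symm]
  swap
  · exact (hm.comp hmp.measurable).aemeasurable
  have key : ∀ᵐ w ∂(Measure.pi fun _ : Fin k => stdGaussian (EuclideanSpace ℝ (Fin N))),
      ∫⁻ x, ENNReal.ofReal ((gram ℝ ((MeasurableEquiv.piFinSuccAbove
        (fun _ => EuclideanSpace ℝ (Fin N)) j).symm (x, w)))⁻¹ j j)
        ∂(stdGaussian (EuclideanSpace ℝ (Fin N))) = ENNReal.ofReal (1 / ((N:ℝ) - k - 2)) := by
    filter_upwards [ae_li N k (by omega)] with w hw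
    have hf := finrank_orth_span hw
    have h1 := gauss_proj_inv (Submodule.span ℝ (Set.range w))ᗮ (N - k) (by omega) hf
    rw [Nat.cast_sub (by omega)] at h1
    rw [← h1]
    refine lintegral_congr_ae ?_
    filter_upwards [null_sub (Submodule.span ℝ (Set.range w)) (by omega)] with x hx
    have hli : LinearIndependent ℝ ((MeasurableEquiv.piFinSuccAbove
        (fun _ => EuclideanSpace ℝ (Fin N)) j).symm (x, w)) := by
      have := (linearIndependent_finCons (x := x) (v := w)).2 ⟨hw, hx⟩
      have h2 := this.comp (j.cycleRange) (Equiv.injective _)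
      have h3 : (MeasurableEquiv.piFinSuccAbove
        (fun _ => EuclideanSpace ℝ (Fin N)) j).symm (x, w) = Fin.cons x w ∘ j.cycleRange := by
        change Fin.insertNth j x w = Fin.cons x w ∘ j.cycleRange
        funext i
        refine Fin.succAboveCases j ?_ ?_ i <;> simp
      rw [h3]
      exact h2
    rw [gram_inv_diag _ hli j]
    have e1 : (MeasurableEquiv.piFinSuccAbove
        (fun _ => EuclideanSpace ℝ (Fin N)) j).symm (x, w) j = x :=
      Fin.insertNth_apply_same (α := fun _ => EuclideanSpace ℝ (Fin N)) j x w
    have e2 : (fun i => (MeasurableEquiv.piFinSuccAbove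
        (fun _ => EuclideanSpace ℝ (Fin N)) j).symm (x, w) (j.succAbove i)) = w :=
      funext fun i => Fin.insertNth_apply_succAbove (α := fun _ => EuclideanSpace ℝ (Fin N)) j x w i
    rw [e1, e2]
  refine (lintegral_congr_ae key).trans ?_
  simp

instance (n : ℕ) (v : ℝ) : IsProbabilityMeasure (gaussianVec n v) := by
  unfold gaussianVec; infer_instance

lemma mp_cols (N d : ℕ) : MeasurePreserving
    (fun (G : Fin N → Fin d → ℝ) (j : Fin d) =>
      (WithLp.toLp 2 (fun i => G i j) : EuclideanSpace ℝ (Fin N)))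
    (Measure.pi fun _ : Fin N => gaussianVec d 1)
    (Measure.pi fun _ : Fin d => stdGaussian (EuclideanSpace ℝ (Fin N))) := by
  refine ⟨by fun_prop, ?_⟩
  have h1 := swap_pi N d (gaussianReal 0 1)
  have h2 : (Measure.pi fun _ : Fin d => Measure.pi fun _ : Fin N => gaussianReal 0 1).map
      (fun x j => (WithLp.toLp 2 (x j) : EuclideanSpace ℝ (Fin N))) =
      Measure.pi fun _ : Fin d => stdGaussian (EuclideanSpace ℝ (Fin N)) := by
    simp_rw [← map_pi_eq_stdGaussian]
    rw [Measure.pi_map_pi (fun _ => by fun_prop)]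
  rw [← h2, ← h1, Measure.map_map (by fun_prop) (by fun_prop)]
  simp only [gaussianVec, Real.toNNReal_one]
  rfl

lemma gram_cols (N d : ℕ) (G : Fin N → Fin d → ℝ) :
    gram ℝ (fun (j : Fin d) => (WithLp.toLp 2 (fun i => G i j) : EuclideanSpace ℝ (Fin N))) =
      (Matrix.of G)ᵀ * Matrix.of G := by
  ext i j
  simp [gram_apply, PiLp.inner_apply, Matrix.mul_apply, mul_comm]

lemma ae_unit (N d : ℕ) (hN : d + 1 < N) :
    ∀ᵐ G ∂(Measure.pi fun _ : Fin N => gaussianVec d 1),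
      ((Matrix.of G)ᵀ * Matrix.of G).PosDef := by
  have h := (mp_cols N d).quasiMeasurePreserving.ae (ae_li N d hN)
  filter_upwards [h] with G hG
  rw [← gram_cols]
  exact (posDef_gram_iff_linearIndependent).2 hG

lemma meas_trace (N d : ℕ) : Measurable fun G : Fin N → Fin d → ℝ =>
    (((Matrix.of G)ᵀ * Matrix.of G)⁻¹).trace := by
  simp_rw [← gram_cols]
  unfold Matrix.trace
  refine Finset.measurable_sum _ fun i _ => ?_
  exact (meas_gram_inv N d i i).comp (mp_cols N d).measurable

lemma lint_trace (N d : ℕ) (hN : d + 1 < N) :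
    ∫⁻ G, ENNReal.ofReal (((Matrix.of G)ᵀ * Matrix.of G)⁻¹).trace
      ∂(Measure.pi fun _ : Fin N => gaussianVec d 1) =
      ENNReal.ofReal ((d:ℝ) / ((N:ℝ) - d - 1)) := by
  have h : ∀ᵐ G ∂(Measure.pi fun _ : Fin N => gaussianVec d 1),
      ENNReal.ofReal (((Matrix.of G)ᵀ * Matrix.of G)⁻¹).trace =
      ∑ j, ENNReal.ofReal ((gram ℝ (fun (j : Fin d) =>
        (WithLp.toLp 2 (fun i => G i j) : EuclideanSpace ℝ (Fin N))))⁻¹ j j) := by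
    filter_upwards [ae_unit N d hN] with G hG
    rw [gram_cols, Matrix.trace, ENNReal.ofReal_sum_of_nonneg]
    · rfl
    · intro i _
      exact hG.inv.diag_pos.le
  rw [lintegral_congr_ae h, lintegral_finsetSum]
  swap
  · exact fun j _ => ((meas_gram_inv N d j j).comp (mp_cols N d).measurable).ennreal_ofReal
  have h2 : ∀ j : Fin d, ∫⁻ G, ENNReal.ofReal ((gram ℝ (fun (j : Fin d) =>
        (WithLp.toLp 2 (fun i => G i j) : EuclideanSpace ℝ (Fin N))))⁻¹ j j)
      ∂(Measure.pi fun _ : Fin N => gaussianVec d 1) = ENNReal.ofReal (1 / ((N:ℝ) - d - 1)) := by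
    intro j
    rw [(mp_cols N d).lintegral_comp (meas_gram_inv N d j j).ennreal_ofReal]
    cases d with
    | zero => exact j.elim0
    | succ k =>
      rw [lint_diag N k (by omega) j]
      congr 2
      push_cast; ring
  simp_rw [h2]
  have : (0:ℝ) ≤ (N:ℝ) - d - 1 := by
    have : ((d + 1 : ℕ) : ℝ) ≤ N := by exact_mod_cast hN.le
    push_cast at this; linarith
  rw [Finset.sum_const, Finset.card_univ, Fintype.card_fin, nsmul_eq_mul,
    div_eq_mul_one_div (d:ℝ), ENNReal.ofReal_mul (Nat.cast_nonneg d), ENNReal.ofReal_natCast]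

/-- centered, square integrable, with variance `s` -/
def Cent {Ω : Type*} [MeasurableSpace Ω] (μ : Measure Ω) (Y : Ω → ℝ) (s : ℝ) : Prop :=
  MemLp Y 2 μ ∧ ∫ x, Y x ∂μ = 0 ∧ Var[Y; μ] = s

lemma cent_gauss (v : ℝ) (hv : 0 ≤ v) :
    Cent (gaussianReal 0 (Real.toNNReal v)) (fun x => x) v := by
  refine ⟨memLp_id_gaussianReal 2, integral_id_gaussianReal, ?_⟩
  rw [variance_fun_id_gaussianReal]
  exact Real.coe_toNNReal v hv

lemma Cent.const_mul {Ω : Type*} [MeasurableSpace Ω] {μ : Measure Ω} {Y : Ω → ℝ} {s : ℝ}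
    (h : Cent μ Y s) (b : ℝ) : Cent μ (fun x => b * Y x) (b ^ 2 * s) := by
  obtain ⟨h1, h2, h3⟩ := h
  refine ⟨h1.const_mul b, by rw [integral_const_mul, h2, mul_zero], ?_⟩
  rw [variance_const_mul, h3]

lemma Cent.pi {ι : Type*} [Fintype ι] {Ω : ι → Type*} [∀ i, MeasurableSpace (Ω i)]
    {μ : ∀ i, Measure (Ω i)} [∀ i, IsProbabilityMeasure (μ i)] {Y : ∀ i, Ω i → ℝ} {s : ι → ℝ}
    (h : ∀ i, Cent (μ i) (Y i) (s i)) :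
    Cent (Measure.pi μ) (fun x => ∑ i, Y i (x i)) (∑ i, s i) := by
  have hm : ∀ i, MemLp (fun x : ∀ i, Ω i => Y i (x i)) 2 (Measure.pi μ) :=
    fun i => (h i).1.comp_measurePreserving (measurePreserving_eval _ i)
  refine ⟨memLp_finsetSum _ fun i _ => hm i, ?_, ?_⟩
  · rw [integral_finsetSum _ fun i _ => (hm i).integrable (by norm_num)]
    refine Finset.sum_eq_zero fun i _ => ?_
    have := integral_comp_eval (μ := μ) (i := i) (f := Y i) (h i).1.aestronglyMeasurable
    rw [this, (h i).2.1]
  · have h1 := variance_sum_pi (μ := μ) (X := Y) (fun i => (h i).1)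
    have h2 : (∑ i, fun ω : (∀ i, Ω i) => Y i (ω i)) = fun x => ∑ i, Y i (x i) := by
      ext x; simp
    rw [h2] at h1
    rw [h1]
    exact Finset.sum_congr rfl fun i _ => (h i).2.2

lemma cent_vec (n : ℕ) (v : ℝ) (hv : 0 ≤ v) (b : Fin n → ℝ) :
    Cent (gaussianVec n v) (fun x => ∑ i, b i * x i) (∑ i, b i ^ 2 * v) :=
  Cent.pi fun i => (cent_gauss v hv).const_mul (b i)

lemma layer {Ω : Type*} [MeasurableSpace Ω] {μ : Measure Ω} [IsProbabilityMeasure μ]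
    {ι : Type*} [Fintype ι] (a : ι → ℝ) (Y : ι → Ω → ℝ) (s : ι → ℝ)
    (h : ∀ r, Cent μ (Y r) (s r)) (c : ℝ) (hc : 0 ≤ c) :
    ∫⁻ x, ENNReal.ofReal (∑ r, (a r + Y r x) ^ 2 + c) ∂μ =
      ENNReal.ofReal (∑ r, (a r ^ 2 + s r) + c) := by
  have h1 : ∀ r, Integrable (fun x => (a r + Y r x) ^ 2) μ := fun r =>
    ((memLp_const (a r)).add (h r).1).integrable_sq
  have h2 : ∀ r, ∫ x, (a r + Y r x) ^ 2 ∂μ = a r ^ 2 + s r := by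
    intro r
    obtain ⟨m, z, v⟩ := h r
    have hi := m.integrable (q := 2) (by norm_num)
    have hs := m.integrable_sq
    rw [variance_eq_sub m, z] at v
    have e : ∀ x, (a r + Y r x) ^ 2 = a r ^ 2 + (2 * a r) * Y r x + Y r x ^ 2 := fun x => by ring
    simp_rw [e]
    have i1 : Integrable (fun x => a r ^ 2 + (2 * a r) * Y r x) μ :=
      (integrable_const _).add (hi.const_mul _)
    rw [integral_add i1 hs,
      integral_add (integrable_const _) (hi.const_mul _), integral_const_mul, z]
    simp only [Pi.pow_apply] at v
    simp
    linarith
  rw [← ofReal_integral_eq_lintegral_ofReal]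
  · rw [integral_add (integrable_finsetSum _ fun r _ => h1 r) (integrable_const _),
      integral_finsetSum _ fun r _ => h1 r]
    simp [h2]
  · exact (integrable_finsetSum _ fun r _ => h1 r).add (integrable_const _)
  · exact ae_of_all _ fun x => by positivity

lemma inner_int {N d K : ℕ} (σm : ℝ) (σa : Fin K → ℝ) (lam : Fin K → ℝ) (s : ℝ)
    (u : Fin d → ℝ) (M : Fin d → Fin N → ℝ) :
    ∫⁻ ea : Fin K → Fin N → ℝ, ∫⁻ em : Fin N → ℝ, ∫⁻ g : Fin d → ℝ, ∫⁻ e : ℝ, ENNReal.ofReal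
      ((∑ r, ((u r + ∑ k, (s * lam k) * ∑ i, M r i * ea k i) + ∑ i, (s * M r i) * em i) * g r - e) ^ 2)
      ∂(gaussianReal 0 (Real.toNNReal (σm ^ 2))) ∂(gaussianVec d 1) ∂(gaussianVec N (σm ^ 2))
      ∂(Measure.pi fun k : Fin K => gaussianVec N (σa k ^ 2)) =
    ENNReal.ofReal (∑ r, u r ^ 2 +
      s ^ 2 * (σm ^ 2 + ∑ k, lam k ^ 2 * σa k ^ 2) * (∑ r, ∑ i, M r i ^ 2) + σm ^ 2) := by
  have l1 : ∀ x : ℝ, ∫⁻ e, ENNReal.ofReal ((x - e) ^ 2)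
      ∂(gaussianReal 0 (Real.toNNReal (σm ^ 2))) = ENNReal.ofReal (x ^ 2 + σm ^ 2) := by
    intro x
    have := layer (ι := Unit) (fun _ => x) (fun _ e => (-1) * e) _
      (fun _ => (cent_gauss (σm ^ 2) (by positivity)).const_mul (-1)) 0 le_rfl
    simpa [sub_eq_add_neg] using this
  have l2 : ∀ w : Fin d → ℝ, ∫⁻ g : Fin d → ℝ, ENNReal.ofReal ((∑ r, w r * g r) ^ 2 + σm ^ 2)
      ∂(gaussianVec d 1) = ENNReal.ofReal (∑ r, w r ^ 2 + σm ^ 2) := by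
    intro w
    have := layer (ι := Unit) (fun _ => 0) (fun _ (g : Fin d → ℝ) => ∑ r, w r * g r) _
      (fun _ => cent_vec d 1 zero_le_one w) (σm ^ 2) (by positivity)
    simpa using this
  have l3 : ∀ w : Fin d → ℝ, ∫⁻ em : Fin N → ℝ, ENNReal.ofReal
      (∑ r, (w r + ∑ i, (s * M r i) * em i) ^ 2 + σm ^ 2) ∂(gaussianVec N (σm ^ 2)) =
      ENNReal.ofReal (∑ r, w r ^ 2 + (∑ r, ∑ i, (s * M r i) ^ 2 * σm ^ 2 + σm ^ 2)) := by
    intro w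
    rw [layer w (fun r (em : Fin N → ℝ) => ∑ i, (s * M r i) * em i) _
      (fun r => cent_vec N (σm ^ 2) (by positivity) (fun i => s * M r i)) (σm ^ 2) (by positivity),
      Finset.sum_add_distrib, add_assoc]
  simp_rw [l1, l2, l3]
  rw [layer u (fun r (ea : Fin K → Fin N → ℝ) => ∑ k, (s * lam k) * ∑ i, M r i * ea k i) _
    (fun r => Cent.pi fun k => (cent_vec N (σa k ^ 2) (by positivity) (M r)).const_mul (s * lam k))
    _ (by positivity)]
  congr 1
  have e1 : ∑ r, ∑ i, (s * M r i) ^ 2 * σm ^ 2 = s ^ 2 * σm ^ 2 * ∑ r, ∑ i, M r i ^ 2 := by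
    simp_rw [Finset.mul_sum]
    exact Finset.sum_congr rfl fun r _ => Finset.sum_congr rfl fun i _ => by ring
  have e2 : ∑ r, ∑ k, (s * lam k) ^ 2 * ∑ i, M r i ^ 2 * σa k ^ 2 =
      s ^ 2 * (∑ k, lam k ^ 2 * σa k ^ 2) * ∑ r, ∑ i, M r i ^ 2 := by
    rw [Finset.mul_sum]
    refine Finset.sum_congr rfl fun r _ => ?_
    rw [mul_assoc, Finset.sum_mul, Finset.mul_sum]
    refine Finset.sum_congr rfl fun k _ => ?_
    rw [← Finset.sum_mul]; ring
  rw [Finset.sum_add_distrib, e1, e2]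
  ring

lemma A_unit {d : ℕ} {A Sigx : Matrix (Fin d) (Fin d) ℝ} (hSig : Sigx.PosDef)
    (hA : A * Aᵀ = Sigx) : IsUnit (Aᵀ).det := by
  have h := hSig.det_pos
  rw [← hA, Matrix.det_mul] at h
  exact (right_ne_zero_of_mul h.ne').isUnit

lemma pinv_mul_A {N d : ℕ} {A : Matrix (Fin d) (Fin d) ℝ} (hA : IsUnit (Aᵀ).det)
    (G : Matrix (Fin N) (Fin d) ℝ) : Aᵀ * pinv (G * Aᵀ) = pinv G := by
  have hA' : IsUnit A.det := by rwa [Matrix.det_transpose] at hA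
  unfold pinv
  have h1 : (G * Aᵀ)ᵀ * (G * Aᵀ) = A * ((Gᵀ * G) * Aᵀ) := by
    rw [Matrix.transpose_mul, Matrix.transpose_transpose]
    simp only [Matrix.mul_assoc]
  rw [h1, Matrix.mul_inv_rev, Matrix.mul_inv_rev, Matrix.transpose_mul, Matrix.transpose_transpose]
  have h2 : Aᵀ * ((Aᵀ)⁻¹ * (Gᵀ * G)⁻¹ * A⁻¹ * (A * Gᵀ)) =
      (Aᵀ * (Aᵀ)⁻¹) * (Gᵀ * G)⁻¹ * (A⁻¹ * A) * Gᵀ := by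
    simp only [Matrix.mul_assoc]
  rw [h2, Matrix.mul_nonsing_inv _ hA, Matrix.nonsing_inv_mul _ hA', Matrix.one_mul, Matrix.mul_one]

lemma pinv_mul {N d : ℕ} (G : Matrix (Fin N) (Fin d) ℝ) (hG : (Gᵀ * G).PosDef) :
    pinv G * G = 1 := by
  unfold pinv
  rw [Matrix.mul_assoc, Matrix.nonsing_inv_mul _ hG.det_pos.ne'.isUnit]

lemma pinv_frob {N d : ℕ} (G : Matrix (Fin N) (Fin d) ℝ) (hG : (Gᵀ * G).PosDef) :
    ∑ r, ∑ i, pinv G r i ^ 2 = ((Gᵀ * G)⁻¹).trace := by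
  have h1 : pinv G * (pinv G)ᵀ = (Gᵀ * G)⁻¹ := by
    have h2 : (pinv G)ᵀ = G * (Gᵀ * G)⁻¹ := by
      unfold pinv
      rw [Matrix.transpose_mul, Matrix.transpose_transpose, Matrix.transpose_nonsing_inv,
        Matrix.transpose_mul, Matrix.transpose_transpose]
    rw [h2, ← Matrix.mul_assoc, pinv_mul G hG, Matrix.one_mul]
  rw [← h1]
  simp [Matrix.trace, Matrix.mul_apply, sq]

/-- the bias vector -/
def bias {d K : ℕ} (wm : Fin d → ℝ) (wk : Fin K → Fin d → ℝ) (lam : Fin K → ℝ) : Fin d → ℝ :=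
  (1 / (1 + ∑ k, lam k)) • ∑ k, lam k • (wk k - wm)

lemma err_eq {N d K : ℕ} (A : Matrix (Fin d) (Fin d) ℝ) (hA : IsUnit (Aᵀ).det)
    (wm : Fin d → ℝ) (wk : Fin K → Fin d → ℝ) (lam : Fin K → ℝ) (hl : 1 + ∑ k, lam k ≠ 0)
    (G : Fin N → Fin d → ℝ) (hG : ((Matrix.of G)ᵀ * Matrix.of G).PosDef)
    (ea : Fin K → Fin N → ℝ) (em : Fin N → ℝ) (g : Fin d → ℝ) (e : ℝ) :
    xTest A ((G, ea, em, g, e) : Sample N d K) ⬝ᵥ wHat A wm wk lam (G, ea, em, g, e) -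
      yTest A wm ((G, ea, em, g, e) : Sample N d K) =
    ∑ r, (((Aᵀ *ᵥ bias wm wk lam) r +
      ∑ k, (1 / (1 + ∑ k, lam k) * lam k) * ∑ i, pinv (Matrix.of G) r i * ea k i) +
      ∑ i, (1 / (1 + ∑ k, lam k) * pinv (Matrix.of G) r i) * em i) * g r - e := by
  set s := 1 / (1 + ∑ k, lam k) with hs
  set M := pinv (Matrix.of G) with hM
  set w := wHat A wm wk lam ((G, ea, em, g, e) : Sample N d K) with hw
  have h0 : ∀ (y : Fin d → ℝ) (z : Fin N → ℝ),
      Aᵀ *ᵥ (pinv (Matrix.of G * Aᵀ) *ᵥ ((Matrix.of G * Aᵀ) *ᵥ y + z)) = Aᵀ *ᵥ y + M *ᵥ z := by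
    intro y z
    rw [Matrix.mulVec_mulVec, pinv_mul_A hA, Matrix.mulVec_add, Matrix.mulVec_mulVec,
      ← Matrix.mul_assoc, pinv_mul _ hG, Matrix.one_mul]
  have h1 : Aᵀ *ᵥ w = s • ((Aᵀ *ᵥ wm + M *ᵥ em) + ∑ k, lam k • (Aᵀ *ᵥ wk k + M *ᵥ ea k)) := by
    rw [hw]
    simp only [wHat, Ym, Ya, Xmat]
    rw [Matrix.mulVec_smul, Matrix.mulVec_add, h0, Matrix.mulVec_sum]
    simp only [Matrix.mulVec_smul, h0]
    rfl
  have h2 : Aᵀ *ᵥ w - Aᵀ *ᵥ wm = Aᵀ *ᵥ bias wm wk lam + s • (M *ᵥ em) +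
      s • ∑ k, lam k • (M *ᵥ ea k) := by
    have hsum : s * (1 + ∑ k, lam k) = 1 := by rw [hs]; field_simp
    have h3 : Aᵀ *ᵥ wm = s • (Aᵀ *ᵥ wm + (∑ k, lam k) • (Aᵀ *ᵥ wm)) := by
      rw [smul_add, smul_smul, ← add_smul, ← mul_one_add, hsum, one_smul]
    have h5 : Aᵀ *ᵥ w - Aᵀ *ᵥ wm =
        s • ((Aᵀ *ᵥ wm + M *ᵥ em) + ∑ k, lam k • (Aᵀ *ᵥ wk k + M *ᵥ ea k)) -
        s • (Aᵀ *ᵥ wm + (∑ k, lam k) • (Aᵀ *ᵥ wm)) := by rw [← h3, h1]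
    rw [h5]
    unfold bias
    rw [← hs, Matrix.mulVec_smul, Matrix.mulVec_sum]
    simp only [Matrix.mulVec_smul, Matrix.mulVec_sub, smul_sub, smul_add, Finset.sum_add_distrib,
      Finset.sum_sub_distrib, Finset.sum_smul]
    abel
  have h4 : xTest A ((G, ea, em, g, e) : Sample N d K) ⬝ᵥ w -
      yTest A wm ((G, ea, em, g, e) : Sample N d K) = (Aᵀ *ᵥ w - Aᵀ *ᵥ wm) ⬝ᵥ g - e := by
    simp only [yTest, xTest]
    have : ∀ y : Fin d → ℝ, (A *ᵥ g) ⬝ᵥ y = (Aᵀ *ᵥ y) ⬝ᵥ g := by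
      intro y
      rw [Matrix.mulVec_transpose, ← Matrix.dotProduct_mulVec, dotProduct_comm]
    rw [this, this, sub_dotProduct]; ring
  rw [h4, h2]
  simp only [dotProduct]
  congr 1
  refine Finset.sum_congr rfl fun r _ => ?_
  congr 1
  simp only [Pi.add_apply, Pi.smul_apply, Finset.sum_apply, smul_eq_mul, Matrix.mulVec, dotProduct,
    Finset.mul_sum, mul_assoc]
  ring

lemma meas_err {N d K : ℕ} (A : Matrix (Fin d) (Fin d) ℝ)
    (wm : Fin d → ℝ) (wk : Fin K → Fin d → ℝ) (lam : Fin K → ℝ) :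
    Measurable fun ω : Sample N d K => xTest A ω ⬝ᵥ wHat A wm wk lam ω - yTest A wm ω := by
  have hX : Continuous fun ω : Sample N d K => Xmat A ω := by
    unfold Xmat
    refine Continuous.matrix_mul ?_ continuous_const
    exact continuous_fst
  have hXe : ∀ i j, Measurable fun ω : Sample N d K => Xmat A ω i j :=
    fun i j => (hX.matrix_elem i j).measurable
  have hp : ∀ i j, Measurable fun ω : Sample N d K => pinv (Xmat A ω) i j := by
    intro i j
    have hc : Continuous fun ω : Sample N d K => (Xmat A ω)ᵀ * Xmat A ω :=
      hX.matrix_transpose.matrix_mul hX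
    simp only [pinv, Matrix.mul_apply, Matrix.inv_def, Ring.inverse_eq_inv', Matrix.smul_apply,
      smul_eq_mul, Matrix.transpose_apply]
    refine Finset.measurable_sum _ fun l _ => ?_
    exact ((hc.matrix_det.measurable.inv).mul (hc.matrix_adjugate.matrix_elem i l).measurable).mul
      (hXe j l)
  simp only [xTest, yTest, wHat, Ym, Ya, dotProduct, Matrix.mulVec, Pi.add_apply, Pi.smul_apply,
    Finset.sum_apply, smul_eq_mul]
  fun_prop

lemma main_int {N d K : ℕ} (hN : d + 1 < N) (A : Matrix (Fin d) (Fin d) ℝ) (hA : IsUnit (Aᵀ).det)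
    (wm : Fin d → ℝ) (wk : Fin K → Fin d → ℝ) (σm : ℝ) (σa : Fin K → ℝ)
    (lam : Fin K → ℝ) (hl : 1 + ∑ k, lam k ≠ 0) :
    ∫ ω, (xTest A ω ⬝ᵥ wHat A wm wk lam ω - yTest A wm ω) ^ 2 ∂(P N d K σm σa) =
      ((σm ^ 2 + ∑ k, lam k ^ 2 * σa k ^ 2) / (1 + ∑ k, lam k) ^ 2) *
            ((d : ℝ) / ((N : ℝ) - (d : ℝ) - 1)) + quadForm (A * Aᵀ) (bias wm wk lam) + σm ^ 2 := by
  have hm := (meas_err (N := N) A wm wk lam).pow_const 2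
  have hpos : (0:ℝ) ≤ (N:ℝ) - d - 1 := by
    have : ((d + 1 : ℕ) : ℝ) ≤ N := by exact_mod_cast hN.le
    push_cast at this; linarith
  set s := 1 / (1 + ∑ k, lam k) with hs
  set u := Aᵀ *ᵥ bias wm wk lam with hu
  have hq : quadForm (A * Aᵀ) (bias wm wk lam) = ∑ r, u r ^ 2 := by
    rw [quadForm, ← Matrix.mulVec_mulVec, Matrix.dotProduct_mulVec, ← Matrix.mulVec_transpose, ← hu]
    simp [dotProduct, sq]
  rw [integral_eq_lintegral_of_nonneg_ae (ae_of_all _ fun ω => sq_nonneg _)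
    hm.aestronglyMeasurable]
  have hm' := hm.ennreal_ofReal
  have key : ∫⁻ ω, ENNReal.ofReal ((xTest A ω ⬝ᵥ wHat A wm wk lam ω - yTest A wm ω) ^ 2)
      ∂(P N d K σm σa) = ENNReal.ofReal (∑ r, u r ^ 2 +
      s ^ 2 * (σm ^ 2 + ∑ k, lam k ^ 2 * σa k ^ 2) * ((d : ℝ) / ((N : ℝ) - (d : ℝ) - 1)) +
        σm ^ 2) := by
    unfold P
    rw [lintegral_prod _ hm'.aemeasurable]
    have h1 : ∀ᵐ G ∂(Measure.pi fun _ : Fin N => gaussianVec d 1),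
        ∫⁻ y, ENNReal.ofReal ((xTest A ((G, y) : Sample N d K) ⬝ᵥ wHat A wm wk lam (G, y) -
          yTest A wm ((G, y) : Sample N d K)) ^ 2)
        ∂((Measure.pi fun k : Fin K => gaussianVec N (σa k ^ 2)).prod
          ((gaussianVec N (σm ^ 2)).prod
            ((gaussianVec d 1).prod (gaussianReal 0 (Real.toNNReal (σm ^ 2)))))) =
        ENNReal.ofReal (∑ r, u r ^ 2 + σm ^ 2) +
          ENNReal.ofReal (s ^ 2 * (σm ^ 2 + ∑ k, lam k ^ 2 * σa k ^ 2)) *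
            ENNReal.ofReal (((Matrix.of G)ᵀ * Matrix.of G)⁻¹).trace := by
      filter_upwards [ae_unit N d hN] with G hG
      have h2 := inner_int σm σa lam s u (pinv (Matrix.of G))
      rw [pinv_frob _ hG] at h2
      have ht : 0 ≤ (((Matrix.of G)ᵀ * Matrix.of G)⁻¹).trace :=
        Finset.sum_nonneg fun i _ => hG.inv.diag_pos.le
      rw [← ENNReal.ofReal_mul (by positivity), ← ENNReal.ofReal_add (by positivity) (by positivity)]
      have h3 : ∑ r, u r ^ 2 + σm ^ 2 + s ^ 2 * (σm ^ 2 + ∑ k, lam k ^ 2 * σa k ^ 2) *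
          (((Matrix.of G)ᵀ * Matrix.of G)⁻¹).trace = ∑ r, u r ^ 2 + s ^ 2 * (σm ^ 2 +
            ∑ k, lam k ^ 2 * σa k ^ 2) * (((Matrix.of G)ᵀ * Matrix.of G)⁻¹).trace + σm ^ 2 := by
        ring
      rw [h3, ← h2]
      have m1 := hm'.comp (measurable_prodMk_left (x := G))
      refine (lintegral_prod _ m1.aemeasurable).trans ?_
      refine lintegral_congr fun ea => ?_
      have m2 := m1.comp (measurable_prodMk_left (x := ea))
      refine (lintegral_prod _ m2.aemeasurable).trans ?_
      refine lintegral_congr fun em => ?_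
      have m3 := m2.comp (measurable_prodMk_left (x := em))
      refine (lintegral_prod _ m3.aemeasurable).trans ?_
      refine lintegral_congr fun g => ?_
      refine lintegral_congr fun e => ?_
      have := err_eq A hA wm wk lam hl G hG ea em g e
      exact congrArg (fun x => ENNReal.ofReal (x ^ 2)) this
    rw [lintegral_congr_ae h1, lintegral_add_left measurable_const, lintegral_const,
      lintegral_const_mul _ (meas_trace N d).ennreal_ofReal, lint_trace N d hN, measure_univ, mul_one,
      ← ENNReal.ofReal_mul (by positivity), ← ENNReal.ofReal_add (by positivity) (by positivity)]
    congr 1; ring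
  rw [key, ENNReal.toReal_ofReal (by positivity), hq, hs, one_div, inv_pow]
  rw [div_eq_mul_inv (σm ^ 2 + _)]
  ring


/-- Theorem 3.1: exact expected generalization error of the weighted
least-squares estimator, with bias–variance decomposition, together with the
main-task-only (`Λ = 0`, OLS) error `E_0 = σ_m²·d/(N−d−1) + σ_m²`. -/
theorem expected_generalization_error
    (N d K : ℕ) (hN : d + 1 < N) (hK : 1 ≤ K)
    (Sigx : Matrix (Fin d) (Fin d) ℝ) (hSig : Sigx.PosDef)
    (A : Matrix (Fin d) (Fin d) ℝ) (hA : A * Aᵀ = Sigx)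
    (wm : Fin d → ℝ) (wk : Fin K → Fin d → ℝ)
    (σm : ℝ) (hσm : 0 < σm) (σa : Fin K → ℝ) (hσa : ∀ k, 0 < σa k)
    (lam : Fin K → ℝ) (hlam : ∀ k, 0 ≤ lam k) (hΛ : 0 < ∑ k, lam k) :
    (∫ ω, (xTest A ω ⬝ᵥ wHat A wm wk lam ω - yTest A wm ω) ^ 2 ∂(P N d K σm σa)) =
        ((σm ^ 2 + ∑ k, lam k ^ 2 * σa k ^ 2) / (1 + ∑ k, lam k) ^ 2) *
            ((d : ℝ) / ((N : ℝ) - (d : ℝ) - 1)) +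
          ((∑ k, lam k) / (1 + ∑ k, lam k)) ^ 2 *
            quadForm Sigx ((1 / ∑ k, lam k) • (∑ k, lam k • wk k) - wm) +
          σm ^ 2 ∧
      (∫ ω, (xTest A ω ⬝ᵥ wOLS A wm ω - yTest A wm ω) ^ 2 ∂(P N d K σm σa)) =
        σm ^ 2 * ((d : ℝ) / ((N : ℝ) - (d : ℝ) - 1)) + σm ^ 2 := by
  have hU := A_unit hSig hA
  constructor
  · rw [main_int hN A hU wm wk σm σa lam (by positivity), hA]
    congr 2
    have hb : bias wm wk lam = ((∑ k, lam k) / (1 + ∑ k, lam k)) •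
        ((1 / ∑ k, lam k) • (∑ k, lam k • wk k) - wm) := by
      have h1 : (1 + ∑ k, lam k) ≠ 0 := by positivity
      unfold bias
      rw [smul_sub, smul_smul]
      simp only [smul_sub, Finset.sum_sub_distrib]
      rw [← Finset.sum_smul, smul_smul]
      congr 2 <;> field_simp
    rw [hb]
    simp only [quadForm, Matrix.mulVec_smul, smul_dotProduct, dotProduct_smul, smul_eq_mul]
    ring
  · have h := main_int (K := K) hN A hU wm wk σm σa (fun _ => 0) (by simp)
    have h1 : ∀ ω : Sample N d K, wHat A wm wk (fun _ => 0) ω = wOLS A wm ω := by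
      intro ω
      simp [wHat, wOLS]
    simp only [h1] at h
    rw [h]
    simp [bias, quadForm]

end Stmt0
end
end

section
/- Let S, Z ∈ R^{m×n} and M = S + Z. Suppose (σ_q(S) − σ_{q+1}(S))/||Z|| ≥ r for some r > 1, where σ_j(·) is the j-th largest singular value and ||·|| is the spectral norm. Then for any q ∈ {1,…,rank(S)}, any j ∈ {1,…,n}, and any best rank-q approximations [M]_q and [S]_q, ||([M]_q − [S]_q)e_j|| ≤ (1/(r−1))·(||S e_j|| + ||Z e_j||) + ||P_U Z e_j||, where e_j is the j-th standard basis vector and P_U = U_{:,q} U_{:,q}^T is the orthogonal projection onto the span of the top q left singular vectors of S (from an SVD S = UΣV^T). -/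
open Matrix

noncomputable section

namespace Stmt5

/-- Euclidean norm of a vector in `ℝ^n`. -/
def norm2 {n : ℕ} (v : Fin n → ℝ) : ℝ := Real.sqrt (∑ i, v i ^ 2)

/-- Spectral norm (`ℓ₂` operator norm) of a real matrix. -/
def spec {m n : ℕ} (A : Matrix (Fin m) (Fin n) ℝ) : ℝ :=
  sSup {c : ℝ | ∃ x : Fin n → ℝ, norm2 x = 1 ∧ c = norm2 (A *ᵥ x)}

/-- `i`-th largest singular value (1-indexed), via the Eckart–Young–Mirsky
characterization `σ_i(A) = inf { ‖A − B‖ : rank B ≤ i − 1 }`. -/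
def singVal {m n : ℕ} (A : Matrix (Fin m) (Fin n) ℝ) (i : ℕ) : ℝ :=
  sInf {c : ℝ | ∃ B : Matrix (Fin m) (Fin n) ℝ, B.rank < i ∧ c = spec (A - B)}

/-- Rectangular diagonal matrix with diagonal entries `σs 0 ≥ σs 1 ≥ …`. -/
def diagMat (m n : ℕ) (σs : ℕ → ℝ) : Matrix (Fin m) (Fin n) ℝ :=
  Matrix.of fun i j => if (i : ℕ) = (j : ℕ) then σs (i : ℕ) else 0

/-- Rectangular diagonal matrix keeping only the first `q` diagonal entries. -/
def diagTrunc (m n q : ℕ) (σs : ℕ → ℝ) : Matrix (Fin m) (Fin n) ℝ :=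
  Matrix.of fun i j => if (i : ℕ) = (j : ℕ) ∧ (i : ℕ) < q then σs (i : ℕ) else 0

/-- Orthogonal projection `U_{:,q} U_{:,q}ᵀ` onto the span of the first `q` columns of `U`. -/
def projTop (m q : ℕ) (U : Matrix (Fin m) (Fin m) ℝ) : Matrix (Fin m) (Fin m) ℝ :=
  Matrix.of fun i i' => ∑ jj : Fin m, if (jj : ℕ) < q then U i jj * U i' jj else 0

/-- The `j`-th column of a matrix. -/
def col {m n : ℕ} (A : Matrix (Fin m) (Fin n) ℝ) (j : Fin n) : Fin m → ℝ := fun i => A i j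

section Helpers

open scoped Matrix.Norms.L2Operator

lemma norm2_eq {n : ℕ} (v : Fin n → ℝ) : norm2 v = ‖WithLp.toLp 2 v‖ := by
  simp [norm2, EuclideanSpace.norm_eq]

lemma norm2_nonneg {n : ℕ} (v : Fin n → ℝ) : 0 ≤ norm2 v := Real.sqrt_nonneg _

lemma norm2_sq {n : ℕ} (v : Fin n → ℝ) : norm2 v ^ 2 = v ⬝ᵥ v := by
  rw [norm2, Real.sq_sqrt (Finset.sum_nonneg fun i _ => sq_nonneg _)]
  simp [dotProduct, sq]

lemma norm2_add_le {n : ℕ} (v w : Fin n → ℝ) : norm2 (v + w) ≤ norm2 v + norm2 w := by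
  simp only [norm2_eq, WithLp.toLp_add]
  exact norm_add_le _ _

lemma norm2_smul {n : ℕ} (c : ℝ) (v : Fin n → ℝ) : norm2 (c • v) = |c| * norm2 v := by
  simp only [norm2_eq, WithLp.toLp_smul, norm_smul, Real.norm_eq_abs]

lemma norm2_pos {n : ℕ} {v : Fin n → ℝ} (h : v ≠ 0) : 0 < norm2 v := by
  rw [norm2_eq, norm_pos_iff]
  simpa using h

lemma norm2_mulVec_le {m n : ℕ} (A : Matrix (Fin m) (Fin n) ℝ) (v : Fin n → ℝ) :
    norm2 (A *ᵥ v) ≤ ‖A‖ * norm2 v := by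
  have := l2_opNorm_mulVec A (WithLp.toLp 2 v)
  simpa [norm2_eq] using this

lemma opNorm_le {m n : ℕ} (A : Matrix (Fin m) (Fin n) ℝ) (c : ℝ) (hc : 0 ≤ c)
    (h : ∀ v, norm2 (A *ᵥ v) ≤ c * norm2 v) : ‖A‖ ≤ c := by
  rw [l2_opNorm_def]
  refine ContinuousLinearMap.opNorm_le_bound _ hc fun x => ?_
  have := h x.ofLp
  rw [norm2_eq, norm2_eq] at this
  exact this

lemma spec_eq {m n : ℕ} (A : Matrix (Fin m) (Fin n) ℝ) : spec A = ‖A‖ := by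
  have hbd : ∀ c ∈ {c : ℝ | ∃ x : Fin n → ℝ, norm2 x = 1 ∧ c = norm2 (A *ᵥ x)}, c ≤ ‖A‖ := by
    rintro c ⟨x, hx, rfl⟩
    simpa [hx] using norm2_mulVec_le A x
  have h0 : 0 ≤ spec A := by
    apply Real.sSup_nonneg
    rintro c ⟨x, hx, rfl⟩
    exact norm2_nonneg _
  apply le_antisymm
  · exact Real.sSup_le hbd (norm_nonneg _)
  · refine opNorm_le A _ h0 fun v => ?_
    by_cases hv : v = 0
    · subst hv
      simp [norm2]
    have hp := norm2_pos hv
    have : norm2 (A *ᵥ ((norm2 v)⁻¹ • v)) ≤ spec A := by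
      refine le_csSup ⟨_, hbd⟩ ⟨_, ?_, rfl⟩
      rw [norm2_smul, abs_of_pos (inv_pos.2 hp), inv_mul_cancel₀ hp.ne']
    rw [mulVec_smul, norm2_smul, abs_of_pos (inv_pos.2 hp), inv_mul_le_iff₀ hp] at this
    linarith

lemma diagMat_mul (m n k : ℕ) (f g : ℕ → ℝ) :
    diagMat m n f * diagMat n k g = diagMat m k (fun i => if i < n then f i * g i else 0) := by
  ext i j
  simp only [diagMat, mul_apply, of_apply]
  by_cases h : (i : ℕ) < n
  · rw [Finset.sum_eq_single (⟨i, h⟩ : Fin n)]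
    · simp [h]
    · intro b _ hb
      have : (i : ℕ) ≠ b := fun h' => hb (Fin.ext h'.symm)
      simp [this]
    · simp
  · rw [Finset.sum_eq_zero]
    · simp [h]
    · intro b _
      have : (i : ℕ) ≠ b := by have := b.2; omega
      simp [this]

lemma diagMat_transpose (m n : ℕ) (f : ℕ → ℝ) : (diagMat m n f)ᵀ = diagMat n m f := by
  ext i j
  simp only [diagMat, transpose_apply, of_apply]
  by_cases h : (i : ℕ) = j
  · simp [h]
  · simp [h, Ne.symm h]

lemma diagMat_congr (m n : ℕ) (f g : ℕ → ℝ) (h : ∀ i, i < m → i < n → f i = g i) :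
    diagMat m n f = diagMat m n g := by
  ext i j
  simp only [diagMat, of_apply]
  split_ifs with hij
  · exact h _ i.2 (hij ▸ j.2)
  · rfl

lemma diagMat_sub (m n : ℕ) (f g : ℕ → ℝ) :
    diagMat m n f - diagMat m n g = diagMat m n (fun i => f i - g i) := by
  ext i j
  simp only [diagMat, of_apply, Matrix.sub_apply]
  split_ifs <;> simp

lemma diagMat_one (m : ℕ) : diagMat m m (fun _ => 1) = 1 := by
  ext i j
  simp [diagMat, one_apply, Fin.ext_iff]

lemma norm_T {m n : ℕ} (A : Matrix (Fin m) (Fin n) ℝ) : ‖Aᵀ‖ = ‖A‖ := by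
  rw [← l2_opNorm_conjTranspose A, conjTranspose_eq_transpose_of_trivial]

lemma norm_T_mul {m n : ℕ} (A : Matrix (Fin m) (Fin n) ℝ) : ‖Aᵀ * A‖ = ‖A‖ * ‖A‖ := by
  rw [← l2_opNorm_conjTranspose_mul_self A, conjTranspose_eq_transpose_of_trivial]

lemma norm_diagMat_le (m n : ℕ) (f : ℕ → ℝ) (c : ℝ) (hc : 0 ≤ c) (h : ∀ i, |f i| ≤ c) :
    ‖diagMat m n f‖ ≤ c := by
  have h1 := norm_T_mul (diagMat m n f)
  rw [diagMat_transpose, diagMat_mul] at h1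
  have h2 : diagMat n n (fun i => if i < m then f i * f i else 0)
      = diagonal (fun i : Fin n => if (i : ℕ) < m then f i * f i else 0) := by
    ext i j
    simp [diagMat, diagonal_apply, Fin.ext_iff]
  rw [h2, l2_opNorm_diagonal] at h1
  have h3 : ‖(fun i : Fin n => if (i : ℕ) < m then f i * f i else 0)‖ ≤ c * c := by
    rw [pi_norm_le_iff_of_nonneg (by positivity)]
    intro i
    split_ifs
    · rw [norm_mul]
      exact mul_le_mul (h _) (h _) (abs_nonneg _) hc
    · simp; positivity
  rw [h1] at h3
  exact abs_le_of_sq_le_sq' (by nlinarith) hc |>.2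

lemma norm_orth_le {m : ℕ} (U : Matrix (Fin m) (Fin m) ℝ) (hU : Uᵀ * U = 1) : ‖U‖ ≤ 1 := by
  have h := norm_T_mul U
  have h1 : ‖(1 : Matrix (Fin m) (Fin m) ℝ)‖ ≤ 1 := by
    rw [← diagMat_one]
    exact norm_diagMat_le _ _ _ _ zero_le_one (by simp)
  rw [hU] at h
  nlinarith [norm_nonneg U]

/-- norm of a triple product with contractions outside -/
lemma norm_mul3_le {a b c d : ℕ} (A : Matrix (Fin a) (Fin b) ℝ) (B : Matrix (Fin b) (Fin c) ℝ)
    (C : Matrix (Fin c) (Fin d) ℝ) (hA : ‖A‖ ≤ 1) (hC : ‖C‖ ≤ 1) : ‖A * B * C‖ ≤ ‖B‖ := by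
  have h1 := l2_opNorm_mul (A * B) C
  have h2 := l2_opNorm_mul A B
  have h3 : ‖A‖ * ‖B‖ ≤ ‖B‖ := mul_le_of_le_one_left (norm_nonneg _) hA
  have h4 : ‖A * B‖ * ‖C‖ ≤ ‖A * B‖ := mul_le_of_le_one_right (norm_nonneg _) hC
  linarith

lemma singVal_bdd {m n : ℕ} (A : Matrix (Fin m) (Fin n) ℝ) (i : ℕ) :
    BddBelow {c : ℝ | ∃ B : Matrix (Fin m) (Fin n) ℝ, B.rank < i ∧ c = spec (A - B)} := by
  refine ⟨0, ?_⟩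
  rintro c ⟨B, _, rfl⟩
  rw [spec_eq]
  exact norm_nonneg _

lemma singVal_le {m n : ℕ} (U : Matrix (Fin m) (Fin m) ℝ) (V : Matrix (Fin n) (Fin n) ℝ)
    (σ : ℕ → ℝ) (hU : Uᵀ * U = 1) (hV : Vᵀ * V = 1)
    (hmono : ∀ a b : ℕ, a ≤ b → σ b ≤ σ a) (hnn : ∀ a, 0 ≤ σ a) (k : ℕ) :
    singVal (U * diagMat m n σ * Vᵀ) (k + 1) ≤ σ k := by
  have : singVal (U * diagMat m n σ * Vᵀ) (k + 1) ≤
      spec (U * diagMat m n σ * Vᵀ - U * (diagMat m k σ * diagMat k n (fun _ => 1)) * Vᵀ) := by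
    refine csInf_le (singVal_bdd _ _) ⟨_, ?_, rfl⟩
    have h : (U * (diagMat m k σ * diagMat k n (fun _ => 1)) * Vᵀ)
        = (U * diagMat m k σ) * (diagMat k n (fun _ => 1) * Vᵀ) := by
      simp only [Matrix.mul_assoc]
    rw [h]
    have h1 := rank_mul_le_left (U * diagMat m k σ) (diagMat k n (fun _ => 1) * Vᵀ)
    have h2 := rank_le_width (U * diagMat m k σ)
    omega
  refine this.trans ?_
  rw [spec_eq, ← Matrix.sub_mul, ← Matrix.mul_sub, diagMat_mul, diagMat_sub]
  refine (norm_mul3_le _ _ _ (norm_orth_le U hU) (by rw [norm_T]; exact norm_orth_le V hV)).trans ?_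
  refine norm_diagMat_le _ _ _ _ (hnn _) fun i => ?_
  split_ifs with h
  · simpa using hnn k
  · simpa [abs_of_nonneg (hnn i)] using hmono k i (by omega)

lemma le_singVal {m n : ℕ} (U : Matrix (Fin m) (Fin m) ℝ) (V : Matrix (Fin n) (Fin n) ℝ)
    (σ : ℕ → ℝ) (hU : Uᵀ * U = 1) (hV : Vᵀ * V = 1)
    (hmono : ∀ a b : ℕ, a ≤ b → σ b ≤ σ a) (hnn : ∀ a, 0 ≤ σ a)
    (hz : ∀ a, m ≤ a ∨ n ≤ a → σ a = 0) (k : ℕ) :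
    σ k ≤ singVal (U * diagMat m n σ * Vᵀ) (k + 1) := by
  refine le_csInf ⟨_, 0, by simp, rfl⟩ ?_
  rintro c ⟨B, hB, rfl⟩
  rw [spec_eq]
  rcases (hnn k).eq_or_lt with h0 | hpos
  · rw [← h0]; exact norm_nonneg _
  have hkm : k < m := by
    by_contra h
    exact hpos.ne' (hz k (by omega))
  have hkn : k < n := by
    by_contra h
    exact hpos.ne' (hz k (by omega))
  -- kernel vector
  obtain ⟨c, hc0, hc⟩ : ∃ c : Fin (k+1) → ℝ, c ≠ 0 ∧
      (B * (V * diagMat n (k+1) (fun _ => 1))) *ᵥ c = 0 := by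
    set C := B * (V * diagMat n (k+1) (fun _ => 1)) with hC
    have h1 : C.rank ≤ B.rank := rank_mul_le_left _ _
    have h2 := LinearMap.finrank_range_add_finrank_ker C.mulVecLin
    have h3 : Module.finrank ℝ (LinearMap.range C.mulVecLin) = C.rank := rfl
    rw [h3, Module.finrank_fin_fun] at h2
    have h4 : LinearMap.ker C.mulVecLin ≠ ⊥ := by
      intro h
      rw [h, finrank_bot] at h2
      omega
    obtain ⟨c, hc, hc0⟩ := Submodule.exists_mem_ne_zero_of_ne_bot h4
    exact ⟨c, hc0, by simpa using hc⟩
  set x := (V * diagMat n (k+1) (fun _ => 1)) *ᵥ c with hx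
  have hBx : B *ᵥ x = 0 := by rw [hx, mulVec_mulVec, hc]
  have hι : ‖diagMat n (k+1) (fun _ => 1)‖ ≤ 1 := norm_diagMat_le _ _ _ _ zero_le_one (by simp)
  have hxc : norm2 x ≤ norm2 c := by
    refine (norm2_mulVec_le _ _).trans (mul_le_of_le_one_left (norm2_nonneg _) ?_)
    have := l2_opNorm_mul V (diagMat n (k+1) (fun _ => 1))
    have hV1 := norm_orth_le V hV
    nlinarith [norm_nonneg V, norm_nonneg (diagMat n (k+1) (fun _ => 1))]
  set D : Matrix (Fin (k+1)) (Fin m) ℝ := diagMat (k+1) m (fun i => if i ≤ k then (σ i)⁻¹ else 0)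
  have hD : ‖D‖ ≤ (σ k)⁻¹ := by
    refine norm_diagMat_le _ _ _ _ (inv_nonneg.2 hpos.le) fun i => ?_
    split_ifs with h
    · rw [abs_of_nonneg (inv_nonneg.2 (hnn i))]
      exact inv_anti₀ hpos (hmono _ _ h)
    · simpa using hpos.le
  have hcx : c = (D * Uᵀ) *ᵥ ((U * diagMat m n σ * Vᵀ - B) *ᵥ x) := by
    rw [Matrix.sub_mulVec, hBx, sub_zero, hx, mulVec_mulVec, mulVec_mulVec]
    have : D * Uᵀ * (U * diagMat m n σ * Vᵀ) * (V * diagMat n (k + 1) fun _ => 1)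
        = D * (Uᵀ * U) * diagMat m n σ * (Vᵀ * V) * diagMat n (k + 1) fun _ => 1 := by
      simp only [Matrix.mul_assoc]
    rw [this, hU, hV, Matrix.mul_one, Matrix.mul_one, diagMat_mul, diagMat_mul]
    have h1 : diagMat (k+1) (k+1) (fun i => if i < n then (if i < m then
        (if i ≤ k then (σ i)⁻¹ else 0) * σ i else 0) * 1 else 0) = 1 := by
      rw [← diagMat_one]
      refine diagMat_congr _ _ _ _ fun i hi _ => ?_
      have : σ i ≠ 0 := (hpos.trans_le (hmono i k (by omega))).ne'
      rw [if_pos (by omega), if_pos (by omega), if_pos (by omega), inv_mul_cancel₀ this, one_mul]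
    rw [h1, one_mulVec]
  have hDU : ‖D * Uᵀ‖ ≤ (σ k)⁻¹ := by
    have h1 := l2_opNorm_mul D Uᵀ
    rw [norm_T] at h1
    have := norm_orth_le U hU
    nlinarith [norm_nonneg D]
  set N := U * diagMat m n σ * Vᵀ - B
  have e1 : norm2 c ≤ (σ k)⁻¹ * (‖N‖ * norm2 c) := by
    calc norm2 c = norm2 ((D * Uᵀ) *ᵥ (N *ᵥ x)) := by rw [← hcx]
      _ ≤ ‖D * Uᵀ‖ * norm2 (N *ᵥ x) := norm2_mulVec_le _ _
      _ ≤ (σ k)⁻¹ * (‖N‖ * norm2 c) := by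
        refine mul_le_mul hDU ?_ (norm2_nonneg _) (inv_nonneg.2 hpos.le)
        exact (norm2_mulVec_le _ _).trans (mul_le_mul_of_nonneg_left hxc (norm_nonneg _))
  have hcp := norm2_pos hc0
  rw [le_inv_mul_iff₀ hpos] at e1
  exact le_of_mul_le_mul_right e1 hcp

lemma singVal_weyl {m n : ℕ} (A Z : Matrix (Fin m) (Fin n) ℝ) (k : ℕ) :
    singVal (A + Z) (k + 1) ≤ singVal A (k + 1) + ‖Z‖ := by
  rw [← sub_le_iff_le_add]
  refine le_csInf ⟨_, 0, by simp, rfl⟩ ?_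
  rintro c ⟨B, hB, rfl⟩
  rw [sub_le_iff_le_add]
  have h : singVal (A + Z) (k + 1) ≤ spec (A + Z - B) := csInf_le (singVal_bdd _ _) ⟨B, hB, rfl⟩
  refine h.trans ?_
  rw [spec_eq, spec_eq, add_sub_right_comm]
  exact norm_add_le _ _

/-- diagonal indicator of the first `q` coordinates -/
def EE (m q : ℕ) : Matrix (Fin m) (Fin m) ℝ := diagMat m m (fun i => if i < q then 1 else 0)

/-- diagonal indicator of the other coordinates -/
def FF (m q : ℕ) : Matrix (Fin m) (Fin m) ℝ := diagMat m m (fun i => if i < q then 0 else 1)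

lemma EE_norm (m q : ℕ) : ‖EE m q‖ ≤ 1 :=
  norm_diagMat_le _ _ _ _ zero_le_one fun i => by split_ifs <;> simp

lemma FF_norm (m q : ℕ) : ‖FF m q‖ ≤ 1 :=
  norm_diagMat_le _ _ _ _ zero_le_one fun i => by split_ifs <;> simp

lemma FF_eq (m q : ℕ) : FF m q = 1 - EE m q := by
  rw [FF, EE, ← diagMat_one, diagMat_sub]
  refine diagMat_congr _ _ _ _ fun i _ _ => ?_
  split_ifs <;> simp

lemma EE_mul (m q : ℕ) : EE m q * EE m q = EE m q := by
  rw [EE, diagMat_mul]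
  refine diagMat_congr _ _ _ _ fun i h _ => ?_
  simp [h]

lemma EE_T (m q : ℕ) : (EE m q)ᵀ = EE m q := diagMat_transpose _ _ _

lemma FF_T (m q : ℕ) : (FF m q)ᵀ = FF m q := diagMat_transpose _ _ _

/-- one-sided Wedin estimate -/
lemma wedin_one {m n : ℕ} (X : Matrix (Fin m) (Fin m) ℝ) (Y : Matrix (Fin n) (Fin n) ℝ)
    (σ τ : ℕ → ℝ) (hmono : ∀ a b : ℕ, a ≤ b → σ b ≤ σ a) (hnn : ∀ a, 0 ≤ σ a)
    (hz : ∀ a, m ≤ a ∨ n ≤ a → σ a = 0)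
    (hmonot : ∀ a b : ℕ, a ≤ b → τ b ≤ τ a) (hnnt : ∀ a, 0 ≤ τ a) (p : ℕ) (hpos : 0 < σ p) :
    σ p * ‖FF m (p+1) * X * EE m (p+1)‖ ≤ τ (p+1) * ‖FF n (p+1) * Y * EE n (p+1)‖
      + ‖diagMat m n τ * Y - X * diagMat m n σ‖ := by
  have hkm : p < m := by
    by_contra h
    exact hpos.ne' (hz p (by omega))
  have hkn : p < n := by
    by_contra h
    exact hpos.ne' (hz p (by omega))
  set D : Matrix (Fin n) (Fin m) ℝ := diagMat n m (fun i => if i ≤ p then (σ i)⁻¹ else 0) with hDdef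
  have hD : ‖D‖ ≤ (σ p)⁻¹ := by
    refine norm_diagMat_le _ _ _ _ (inv_nonneg.2 hpos.le) fun i => ?_
    split_ifs with h
    · rw [abs_of_nonneg (inv_nonneg.2 (hnn i))]
      exact inv_anti₀ hpos (hmono _ _ h)
    · simpa using hpos.le
  set T : Matrix (Fin m) (Fin n) ℝ := diagMat m n (fun i => if i < p + 1 then 0 else τ i)
  have hT : ‖T‖ ≤ τ (p+1) := by
    refine norm_diagMat_le _ _ _ _ (hnnt _) fun i => ?_
    split_ifs with h
    · simpa using hnnt _
    · rw [abs_of_nonneg (hnnt i)]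
      exact hmonot _ _ (by omega)
  have hFT : FF m (p+1) * diagMat m n τ = T * FF n (p+1) := by
    rw [FF, FF, diagMat_mul, diagMat_mul]
    refine diagMat_congr _ _ _ _ fun i h h' => ?_
    simp only [h, h', if_true]
    split_ifs <;> simp
  have hDE : diagMat m n σ * EE n (p+1) * D = EE m (p+1) := by
    rw [EE, EE, diagMat_mul, diagMat_mul]
    refine diagMat_congr _ _ _ _ fun i h h' => ?_
    by_cases hi : i < p + 1
    · have : σ i ≠ 0 := (hpos.trans_le (hmono i p (by omega))).ne'
      have h1 : i < n := by omega
      have h2 : i ≤ p := by omega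
      simp [hi, h1, h2, this]
    · simp [hi]
  set W := diagMat m n τ * Y - X * diagMat m n σ with hW
  have key : FF m (p+1) * X * EE m (p+1) =
      (T * (FF n (p+1) * Y * EE n (p+1)) - FF m (p+1) * W * EE n (p+1)) * D := by
    have h1 : FF m (p+1) * W * EE n (p+1) = T * (FF n (p+1) * Y * EE n (p+1))
        - FF m (p+1) * X * (diagMat m n σ * EE n (p+1)) := by
      rw [hW, Matrix.mul_sub, Matrix.sub_mul, ← Matrix.mul_assoc, hFT]
      simp only [Matrix.mul_assoc]
    rw [h1, sub_sub_cancel, Matrix.mul_assoc (FF m (p+1) * X) _ D, hDE]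
  have h2 := l2_opNorm_mul (T * (FF n (p+1) * Y * EE n (p+1)) - FF m (p+1) * W * EE n (p+1)) D
  rw [← key] at h2
  have h3 := norm_sub_le (T * (FF n (p+1) * Y * EE n (p+1))) (FF m (p+1) * W * EE n (p+1))
  have h4 := l2_opNorm_mul T (FF n (p+1) * Y * EE n (p+1))
  have h5 := norm_mul3_le (FF m (p+1)) W (EE n (p+1)) (FF_norm _ _) (EE_norm _ _)
  have h6 : ‖T‖ * ‖FF n (p+1) * Y * EE n (p+1)‖ ≤ τ (p+1) * ‖FF n (p+1) * Y * EE n (p+1)‖ :=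
    mul_le_mul_of_nonneg_right hT (norm_nonneg _)
  have h7 : ‖FF m (p+1) * X * EE m (p+1)‖ ≤ (τ (p+1) * ‖FF n (p+1) * Y * EE n (p+1)‖ + ‖W‖) * (σ p)⁻¹ := by
    refine h2.trans (mul_le_mul (by linarith) hD (norm_nonneg _) ?_)
    have := mul_nonneg (hnnt (p+1)) (norm_nonneg (FF n (p+1) * Y * EE n (p+1)))
    linarith [norm_nonneg W]
  rw [← div_eq_mul_inv, le_div_iff₀ hpos] at h7
  linarith

/-- projection matrix -/
def PP {m : ℕ} (q : ℕ) (U : Matrix (Fin m) (Fin m) ℝ) : Matrix (Fin m) (Fin m) ℝ :=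
  U * EE m q * Uᵀ

lemma PP_T {m : ℕ} (q : ℕ) (U : Matrix (Fin m) (Fin m) ℝ) : (PP q U)ᵀ = PP q U := by
  rw [PP, transpose_mul, transpose_mul, transpose_transpose, EE_T, Matrix.mul_assoc]

lemma PP_idem {m : ℕ} (q : ℕ) (U : Matrix (Fin m) (Fin m) ℝ) (hU : Uᵀ * U = 1) :
    PP q U * PP q U = PP q U := by
  have : PP q U * PP q U = U * (EE m q * (Uᵀ * U) * EE m q) * Uᵀ := by
    simp only [PP, Matrix.mul_assoc]
  rw [this, hU, Matrix.mul_one, EE_mul, PP]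

lemma one_sub_PP {m : ℕ} (q : ℕ) (U : Matrix (Fin m) (Fin m) ℝ) (hU : Uᵀ * U = 1) :
    1 - PP q U = U * FF m q * Uᵀ := by
  rw [FF_eq, Matrix.mul_sub, Matrix.sub_mul, Matrix.mul_one, mul_eq_one_comm.1 hU, PP]

lemma wedin {m n : ℕ} (U Uh : Matrix (Fin m) (Fin m) ℝ) (V Vh : Matrix (Fin n) (Fin n) ℝ)
    (σ τ : ℕ → ℝ) (hU : Uᵀ * U = 1) (hV : Vᵀ * V = 1) (hUh : Uhᵀ * Uh = 1) (hVh : Vhᵀ * Vh = 1)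
    (hmono : ∀ a b : ℕ, a ≤ b → σ b ≤ σ a) (hnn : ∀ a, 0 ≤ σ a)
    (hz : ∀ a, m ≤ a ∨ n ≤ a → σ a = 0)
    (hmonot : ∀ a b : ℕ, a ≤ b → τ b ≤ τ a) (hnnt : ∀ a, 0 ≤ τ a) (p : ℕ)
    (hgap : τ (p+1) < σ p) :
    (σ p - τ (p+1)) * ‖(1 - PP (p+1) Uh) * PP (p+1) U‖ ≤
      ‖Uh * diagMat m n τ * Vhᵀ - U * diagMat m n σ * Vᵀ‖ := by
  have hpos : 0 < σ p := (hnnt _).trans_lt hgap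
  set Z := Uh * diagMat m n τ * Vhᵀ - U * diagMat m n σ * Vᵀ with hZ
  set X := Uhᵀ * U with hX
  set Y := Vhᵀ * V with hY
  have hW : diagMat m n τ * Y - X * diagMat m n σ = Uhᵀ * Z * V := by
    have : Uhᵀ * Z * V = (Uhᵀ * Uh) * diagMat m n τ * (Vhᵀ * V)
        - (Uhᵀ * U) * diagMat m n σ * (Vᵀ * V) := by
      rw [hZ, Matrix.mul_sub, Matrix.sub_mul]
      simp only [Matrix.mul_assoc]
    rw [this, hUh, hV, Matrix.one_mul, Matrix.mul_one]
  have hW' : diagMat n m τ * X - Y * diagMat n m σ = Vhᵀ * Zᵀ * U := by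
    have : Vhᵀ * Zᵀ * U = (Vhᵀ * Vh) * diagMat n m τ * (Uhᵀ * U)
        - (Vhᵀ * V) * diagMat n m σ * (Uᵀ * U) := by
      rw [hZ, transpose_sub, Matrix.mul_sub, Matrix.sub_mul]
      simp only [transpose_mul, transpose_transpose, diagMat_transpose, Matrix.mul_assoc]
    rw [this, hVh, hU, Matrix.one_mul, Matrix.mul_one]
  have a1 := wedin_one X Y σ τ hmono hnn hz hmonot hnnt p hpos
  have a2 := wedin_one Y X σ τ hmono hnn (fun a h => hz a h.symm) hmonot hnnt p hpos
  rw [hW] at a1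
  rw [hW'] at a2
  have b1 := norm_mul3_le Uhᵀ Z V (by rw [norm_T]; exact norm_orth_le Uh hUh) (norm_orth_le V hV)
  have b2 := norm_mul3_le Vhᵀ Zᵀ U (by rw [norm_T]; exact norm_orth_le Vh hVh) (norm_orth_le U hU)
  rw [norm_T] at b2
  have c1 : ‖(1 - PP (p+1) Uh) * PP (p+1) U‖ ≤ ‖FF m (p+1) * X * EE m (p+1)‖ := by
    have : (1 - PP (p+1) Uh) * PP (p+1) U = Uh * (FF m (p+1) * X * EE m (p+1)) * Uᵀ := by
      rw [one_sub_PP _ _ hUh, PP, hX]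
      simp only [Matrix.mul_assoc]
    rw [this]
    exact norm_mul3_le _ _ _ (norm_orth_le Uh hUh) (by rw [norm_T]; exact norm_orth_le U hU)
  set x := ‖FF m (p+1) * X * EE m (p+1)‖
  set y := ‖FF n (p+1) * Y * EE n (p+1)‖
  have ht := hnnt (p+1)
  refine (mul_le_mul_of_nonneg_left c1 (by linarith)).trans ?_
  rcases le_total y x with h | h
  · nlinarith
  · nlinarith

lemma proj_pyth {m : ℕ} (P : Matrix (Fin m) (Fin m) ℝ) (hT : Pᵀ = P) (hP : P * P = P)
    (a b : Fin m → ℝ) : norm2 (P *ᵥ a - (1 - P) *ᵥ b) ^ 2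
      = norm2 (P *ᵥ a) ^ 2 + norm2 ((1 - P) *ᵥ b) ^ 2 := by
  have h : (P *ᵥ a) ⬝ᵥ ((1 - P) *ᵥ b) = 0 := by
    rw [dotProduct_mulVec, ← mulVec_transpose, mulVec_mulVec, transpose_sub, transpose_one, hT,
      Matrix.sub_mul, hP, Matrix.one_mul, sub_self, zero_mulVec, zero_dotProduct]
  rw [norm2_sq, norm2_sq, norm2_sq, sub_dotProduct, dotProduct_sub, dotProduct_sub, h,
    dotProduct_comm ((1 - P) *ᵥ b) (P *ᵥ a), h]
  ring

lemma proj_diff {m : ℕ} (P Q : Matrix (Fin m) (Fin m) ℝ) (hPT : Pᵀ = P) (hP : P * P = P)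
    (hQT : Qᵀ = Q) (hQ : Q * Q = Q) (t : ℝ) (h1 : ‖(1 - Q) * P‖ ≤ t)
    (h2 : ‖(1 - P) * Q‖ ≤ t) (y : Fin m → ℝ) :
    norm2 ((Q - P) *ᵥ y) ≤ t * norm2 y := by
  have ht : 0 ≤ t := (norm_nonneg _).trans h1
  have h2' : ‖Q * (1 - P)‖ ≤ t := by
    rw [← norm_T, transpose_mul, transpose_sub, transpose_one, hPT, hQT]
    exact h2
  have hP' : (1 - P) * (1 - P) = 1 - P := by
    rw [Matrix.mul_sub, Matrix.sub_mul _ _ P, hP, Matrix.one_mul, Matrix.mul_one, sub_self, sub_zero]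
  have e1 : (Q - P) *ᵥ y = Q *ᵥ ((1 - P) *ᵥ y) - (1 - Q) *ᵥ (P *ᵥ y) := by
    rw [mulVec_mulVec, mulVec_mulVec, ← Matrix.sub_mulVec]
    congr 1
    rw [Matrix.mul_sub, Matrix.sub_mul, Matrix.mul_one, Matrix.one_mul]
    abel
  have e2 := proj_pyth Q hQT hQ ((1 - P) *ᵥ y) (P *ᵥ y)
  rw [← e1] at e2
  have e3 := proj_pyth P hPT hP y (-y)
  rw [mulVec_neg, sub_neg_eq_add, ← Matrix.add_mulVec, add_sub_cancel, one_mulVec] at e3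
  have e3' : norm2 (-((1 - P) *ᵥ y)) = norm2 ((1 - P) *ᵥ y) := by
    simp [norm2]
  rw [e3'] at e3
  have f1 : norm2 (Q *ᵥ ((1 - P) *ᵥ y)) ≤ t * norm2 ((1 - P) *ᵥ y) := by
    have : Q *ᵥ ((1 - P) *ᵥ y) = (Q * (1 - P)) *ᵥ ((1 - P) *ᵥ y) := by
      rw [mulVec_mulVec, mulVec_mulVec, Matrix.mul_assoc, hP']
    rw [this]
    exact (norm2_mulVec_le _ _).trans (mul_le_mul_of_nonneg_right h2' (norm2_nonneg _))
  have f2 : norm2 ((1 - Q) *ᵥ (P *ᵥ y)) ≤ t * norm2 (P *ᵥ y) := by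
    have : (1 - Q) *ᵥ (P *ᵥ y) = ((1 - Q) * P) *ᵥ (P *ᵥ y) := by
      rw [mulVec_mulVec, mulVec_mulVec, Matrix.mul_assoc, hP]
    rw [this]
    exact (norm2_mulVec_le _ _).trans (mul_le_mul_of_nonneg_right h1 (norm2_nonneg _))
  refine abs_le_of_sq_le_sq' ?_ (mul_nonneg ht (norm2_nonneg _)) |>.2
  have g1 := pow_le_pow_left₀ (norm2_nonneg _) f1 2
  have g2 := pow_le_pow_left₀ (norm2_nonneg _) f2 2
  rw [e2, mul_pow, e3]
  rw [mul_pow] at g1 g2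
  linarith

lemma projTop_eq (m q : ℕ) (U : Matrix (Fin m) (Fin m) ℝ) : projTop m q U = PP q U := by
  have h : EE m q = diagonal (fun i : Fin m => if (i : ℕ) < q then 1 else 0) := by
    ext i j
    simp [EE, diagMat, diagonal_apply, Fin.ext_iff]
  rw [PP, h]
  ext i j
  rw [mul_apply]
  simp [projTop, mul_diagonal]

lemma trunc_eq {m n : ℕ} (q : ℕ) (U : Matrix (Fin m) (Fin m) ℝ) (V : Matrix (Fin n) (Fin n) ℝ)
    (σ : ℕ → ℝ) (hU : Uᵀ * U = 1) :
    U * diagTrunc m n q σ * Vᵀ = PP q U * (U * diagMat m n σ * Vᵀ) := by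
  have h : diagTrunc m n q σ = EE m q * diagMat m n σ := by
    rw [EE, diagMat_mul]
    ext i j
    simp only [diagTrunc, diagMat, of_apply]
    by_cases h1 : (i : ℕ) = j <;> by_cases h2 : (i : ℕ) < q <;> simp [h1, h2]
    · rw [← h1]; simp [h2]
    · rw [← h1]; simp [h2]
  have : PP q U * (U * diagMat m n σ * Vᵀ) = U * EE m q * (Uᵀ * U) * diagMat m n σ * Vᵀ := by
    simp only [PP, Matrix.mul_assoc]
  rw [this, hU, h, Matrix.mul_one]
  simp only [Matrix.mul_assoc]

/-- padded singular values -/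
def pad (m n : ℕ) (σ : ℕ → ℝ) : ℕ → ℝ := fun a => if a < m ∧ a < n then σ a else 0

lemma pad_mono (m n : ℕ) (σ : ℕ → ℝ) (hmono : ∀ a b : ℕ, a ≤ b → σ b ≤ σ a)
    (hnn : ∀ a, 0 ≤ σ a) : ∀ a b : ℕ, a ≤ b → pad m n σ b ≤ pad m n σ a := by
  intro a b h
  unfold pad
  split_ifs with h1 h2 h2
  · exact hmono _ _ h
  · omega
  · exact hnn _
  · exact le_rfl

lemma pad_nn (m n : ℕ) (σ : ℕ → ℝ) (hnn : ∀ a, 0 ≤ σ a) : ∀ a, 0 ≤ pad m n σ a := by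
  intro a
  unfold pad
  split_ifs
  · exact hnn _
  · exact le_rfl

lemma pad_z (m n : ℕ) (σ : ℕ → ℝ) : ∀ a, m ≤ a ∨ n ≤ a → pad m n σ a = 0 := by
  intro a h
  unfold pad
  rw [if_neg (by omega)]

lemma pad_diag (m n : ℕ) (σ : ℕ → ℝ) : diagMat m n (pad m n σ) = diagMat m n σ :=
  diagMat_congr _ _ _ _ fun i h h' => by simp [pad, h, h']

lemma singVal_eq {m n : ℕ} (U : Matrix (Fin m) (Fin m) ℝ) (V : Matrix (Fin n) (Fin n) ℝ)
    (σ : ℕ → ℝ) (hU : Uᵀ * U = 1) (hV : Vᵀ * V = 1)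
    (hmono : ∀ a b : ℕ, a ≤ b → σ b ≤ σ a) (hnn : ∀ a, 0 ≤ σ a) (k : ℕ) :
    singVal (U * diagMat m n σ * Vᵀ) (k + 1) = pad m n σ k := by
  rw [← pad_diag]
  exact le_antisymm
    (singVal_le U V _ hU hV (pad_mono m n σ hmono hnn) (pad_nn m n σ hnn) k)
    (le_singVal U V _ hU hV (pad_mono m n σ hmono hnn) (pad_nn m n σ hnn) (pad_z m n σ) k)

lemma main_aux {m n : ℕ} (S Z M : Matrix (Fin m) (Fin n) ℝ) (hM : M = S + Z)
    (p : ℕ) (r : ℝ) (hr : 1 < r)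
    (hgap : r ≤ (singVal S (p + 1) - singVal S (p + 1 + 1)) / spec Z)
    (U : Matrix (Fin m) (Fin m) ℝ) (V : Matrix (Fin n) (Fin n) ℝ) (σs : ℕ → ℝ)
    (hU : Uᵀ * U = 1) (hV : Vᵀ * V = 1)
    (hmono : ∀ a b : ℕ, a ≤ b → σs b ≤ σs a) (hnn : ∀ a, 0 ≤ σs a)
    (hSVD : S = U * diagMat m n σs * Vᵀ)
    (Uh : Matrix (Fin m) (Fin m) ℝ) (Vh : Matrix (Fin n) (Fin n) ℝ) (σsh : ℕ → ℝ)
    (hUh : Uhᵀ * Uh = 1) (hVh : Vhᵀ * Vh = 1)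
    (hmonoh : ∀ a b : ℕ, a ≤ b → σsh b ≤ σsh a) (hnnh : ∀ a, 0 ≤ σsh a)
    (hSVDh : M = Uh * diagMat m n σsh * Vhᵀ) (y : Fin m → ℝ) :
    norm2 ((PP (p+1) Uh - PP (p+1) U) *ᵥ y) ≤ (1 / (r - 1)) * norm2 y := by
  have hS : ∀ k, singVal S (k + 1) = pad m n σs k := fun k => by
    rw [hSVD]; exact singVal_eq U V σs hU hV hmono hnn k
  have hMs : ∀ k, singVal M (k + 1) = pad m n σsh k := fun k => by
    rw [hSVDh]; exact singVal_eq Uh Vh σsh hUh hVh hmonoh hnnh k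
  have w1 : ∀ k, pad m n σsh k ≤ pad m n σs k + ‖Z‖ := fun k => by
    rw [← hS, ← hMs, hM]; exact singVal_weyl S Z k
  have w2 : ∀ k, pad m n σs k ≤ pad m n σsh k + ‖Z‖ := fun k => by
    have := singVal_weyl M (-Z) k
    rw [norm_neg, hM, add_neg_cancel_right, ← hM, hS, hMs] at this
    exact this
  rw [hS, hS, spec_eq] at hgap
  have hZ : 0 < ‖Z‖ := by
    rcases (norm_nonneg Z).eq_or_lt with h | h
    · rw [← h, div_zero] at hgap
      linarith
    · exact h
  rw [le_div_iff₀ hZ] at hgap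
  have hrz : 0 < (r - 1) * ‖Z‖ := mul_pos (by linarith) hZ
  have v1 := w1 (p+1)
  have v2 := w2 p
  have hZ1 : Uh * diagMat m n (pad m n σsh) * Vhᵀ - U * diagMat m n (pad m n σs) * Vᵀ = Z := by
    rw [pad_diag, pad_diag, ← hSVD, ← hSVDh, hM, add_sub_cancel_left]
  have g1 := wedin U Uh V Vh (pad m n σs) (pad m n σsh) hU hV hUh hVh
    (pad_mono m n σs hmono hnn) (pad_nn m n σs hnn) (pad_z m n σs)
    (pad_mono m n σsh hmonoh hnnh) (pad_nn m n σsh hnnh) p (by linarith)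
  have g2 := wedin Uh U Vh V (pad m n σsh) (pad m n σs) hUh hVh hU hV
    (pad_mono m n σsh hmonoh hnnh) (pad_nn m n σsh hnnh) (pad_z m n σsh)
    (pad_mono m n σs hmono hnn) (pad_nn m n σs hnn) p (by linarith)
  rw [norm_sub_rev, hZ1] at g2
  rw [hZ1] at g1
  have fin : ∀ g x : ℝ, 0 ≤ x → (r - 1) * ‖Z‖ ≤ g → g * x ≤ ‖Z‖ → x ≤ 1 / (r - 1) := by
    intro g x hx hg h
    rw [le_div_iff₀ (by linarith)]
    have : (r - 1) * ‖Z‖ * x ≤ ‖Z‖ := (mul_le_mul_of_nonneg_right hg hx).trans h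
    have : (x * (r - 1)) * ‖Z‖ ≤ 1 * ‖Z‖ := by linarith
    exact le_of_mul_le_mul_right this hZ
  exact proj_diff _ _ (PP_T _ _) (PP_idem _ _ hU) (PP_T _ _) (PP_idem _ _ hUh) _
    (fin _ _ (norm_nonneg _) (by linarith) g1) (fin _ _ (norm_nonneg _) (by linarith) g2) y

end Helpers


/-- Theorem 4.2, column-wise low-rank perturbation bound:
if `(σ_q(S) − σ_{q+1}(S))/‖Z‖ ≥ r > 1` then, for `M = S + Z`, SVD-truncations
`[M]_q`, `[S]_q` built from any SVDs `M = Û Σ̂ V̂ᵀ`, `S = U Σ Vᵀ`, and any column `j`,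
`‖([M]_q − [S]_q) e_j‖ ≤ (1/(r−1))(‖S e_j‖ + ‖Z e_j‖) + ‖P_U Z e_j‖`. -/
theorem columnwise_lowrank_perturbation
    (m n : ℕ) (S Z M : Matrix (Fin m) (Fin n) ℝ) (hM : M = S + Z)
    (q : ℕ) (hq1 : 1 ≤ q) (hq2 : q ≤ S.rank) (j : Fin n)
    (r : ℝ) (hr : 1 < r)
    (hgap : r ≤ (singVal S q - singVal S (q + 1)) / spec Z)
    -- an SVD of the signal matrix `S`
    (U : Matrix (Fin m) (Fin m) ℝ) (V : Matrix (Fin n) (Fin n) ℝ) (σs : ℕ → ℝ)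
    (hU : Uᵀ * U = 1) (hV : Vᵀ * V = 1)
    (hmono : ∀ a b : ℕ, a ≤ b → σs b ≤ σs a) (hnn : ∀ a, 0 ≤ σs a)
    (hSVD : S = U * diagMat m n σs * Vᵀ)
    -- an SVD of the perturbed matrix `M`
    (Uh : Matrix (Fin m) (Fin m) ℝ) (Vh : Matrix (Fin n) (Fin n) ℝ) (σsh : ℕ → ℝ)
    (hUh : Uhᵀ * Uh = 1) (hVh : Vhᵀ * Vh = 1)
    (hmonoh : ∀ a b : ℕ, a ≤ b → σsh b ≤ σsh a) (hnnh : ∀ a, 0 ≤ σsh a)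
    (hSVDh : M = Uh * diagMat m n σsh * Vhᵀ) :
    norm2 (col (Uh * diagTrunc m n q σsh * Vhᵀ - U * diagTrunc m n q σs * Vᵀ) j) ≤
      (1 / (r - 1)) * (norm2 (col S j) + norm2 (col Z j)) +
        norm2 (projTop m q U *ᵥ col Z j) := by
  obtain ⟨p, rfl⟩ : ∃ p, q = p + 1 := ⟨q - 1, by omega⟩
  have h := main_aux S Z M hM p r hr hgap U V σs hU hV hmono hnn hSVD Uh Vh σsh hUh hVh
    hmonoh hnnh hSVDh (col M j)
  have hr' : 0 ≤ 1 / (r - 1) := by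
    apply div_nonneg <;> linarith
  have hcM : col M j = col S j + col Z j := by
    rw [hM]; rfl
  have e : col (Uh * diagTrunc m n (p+1) σsh * Vhᵀ - U * diagTrunc m n (p+1) σs * Vᵀ) j
      = (PP (p+1) Uh - PP (p+1) U) *ᵥ col M j + PP (p+1) U *ᵥ col Z j := by
    rw [trunc_eq _ _ _ _ hUh, trunc_eq _ _ _ _ hU, ← hSVD, ← hSVDh]
    have e1 : col (PP (p+1) Uh * M - PP (p+1) U * S) j
        = PP (p+1) Uh *ᵥ col M j - PP (p+1) U *ᵥ col S j := by
      ext i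
      rfl
    rw [e1, Matrix.sub_mulVec, hcM, mulVec_add (PP (p+1) U)]
    abel
  rw [e, projTop_eq]
  refine (norm2_add_le _ _).trans ?_
  have h2 : norm2 (col M j) ≤ norm2 (col S j) + norm2 (col Z j) := by
    rw [hcM]; exact norm2_add_le _ _
  have h3 := mul_le_mul_of_nonneg_left h2 hr'
  linarith


end Stmt5
end
end

section
/- Let S, Z ∈ R^{m×n} and M = S + Z. Suppose (σ_q(S) − σ_{q+1}(S))/||Z|| ≥ r for some r ≥ 4, where σ_j(·) denotes the j-th largest singular value. Then for any best rank-q approximations, ||[M]_q − [S]_q|| ≤ (6r/(r−2))·||Z||·(σ_q(S)/(σ_q(S) − σ_{q+1}(S)) + log(6σ_1(S)/(σ_q(S) − σ_{q+1}(S)))), where ||·|| is the spectral norm. -/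
open Matrix

noncomputable section

namespace Stmt6

/-- Euclidean norm of a vector in `ℝ^n`. -/
def norm2 {n : ℕ} (v : Fin n → ℝ) : ℝ := Real.sqrt (∑ i, v i ^ 2)

/-- Spectral norm (`ℓ₂` operator norm) of a real matrix. -/
def spec {m n : ℕ} (A : Matrix (Fin m) (Fin n) ℝ) : ℝ :=
  sSup {c : ℝ | ∃ x : Fin n → ℝ, norm2 x = 1 ∧ c = norm2 (A *ᵥ x)}

/-- `i`-th largest singular value (1-indexed), via the Eckart–Young–Mirsky
characterization `σ_i(A) = inf { ‖A − B‖ : rank B ≤ i − 1 }`. -/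
def singVal {m n : ℕ} (A : Matrix (Fin m) (Fin n) ℝ) (i : ℕ) : ℝ :=
  sInf {c : ℝ | ∃ B : Matrix (Fin m) (Fin n) ℝ, B.rank < i ∧ c = spec (A - B)}

/-- Rectangular diagonal matrix with diagonal entries `σs 0 ≥ σs 1 ≥ …`. -/
def diagMat (m n : ℕ) (σs : ℕ → ℝ) : Matrix (Fin m) (Fin n) ℝ :=
  Matrix.of fun i j => if (i : ℕ) = (j : ℕ) then σs (i : ℕ) else 0

/-- Rectangular diagonal matrix keeping only the first `q` diagonal entries. -/
def diagTrunc (m n q : ℕ) (σs : ℕ → ℝ) : Matrix (Fin m) (Fin n) ℝ :=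
  Matrix.of fun i j => if (i : ℕ) = (j : ℕ) ∧ (i : ℕ) < q then σs (i : ℕ) else 0


open scoped Matrix.Norms.L2Operator

lemma norm2_eq {n : ℕ} (v : Fin n → ℝ) : norm2 v = ‖WithLp.toLp 2 v‖ := by
  rw [EuclideanSpace.norm_eq]; simp [norm2]

lemma norm2_mulVec_le {m n : ℕ} (A : Matrix (Fin m) (Fin n) ℝ) (x : Fin n → ℝ) :
    norm2 (A *ᵥ x) ≤ ‖A‖ * norm2 x := by
  rw [norm2_eq, norm2_eq]
  exact Matrix.l2_opNorm_mulVec A (WithLp.toLp 2 x)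

lemma norm2_smul {n : ℕ} (c : ℝ) (v : Fin n → ℝ) : norm2 (c • v) = |c| * norm2 v := by
  rw [norm2_eq, norm2_eq, WithLp.toLp_smul, norm_smul, Real.norm_eq_abs]

lemma norm2_nonneg {n : ℕ} (v : Fin n → ℝ) : 0 ≤ norm2 v := Real.sqrt_nonneg _

lemma norm2_pos {n : ℕ} (v : Fin n → ℝ) (h : v ≠ 0) : 0 < norm2 v := by
  rw [norm2_eq, norm_pos_iff]
  intro h'
  apply h
  simpa using h'

lemma spec_eq {m n : ℕ} (A : Matrix (Fin m) (Fin n) ℝ) : spec A = ‖A‖ := by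
  have hub : ∀ c ∈ {c : ℝ | ∃ x : Fin n → ℝ, norm2 x = 1 ∧ c = norm2 (A *ᵥ x)}, c ≤ ‖A‖ := by
    rintro c ⟨x, hx, rfl⟩
    simpa [hx] using norm2_mulVec_le A x
  have h0 : 0 ≤ spec A := by
    apply Real.sSup_nonneg
    rintro c ⟨x, hx, rfl⟩
    exact norm2_nonneg _
  apply le_antisymm
  · exact Real.sSup_le hub (norm_nonneg _)
  · rw [Matrix.l2_opNorm_def]
    apply ContinuousLinearMap.opNorm_le_bound _ h0
    intro x
    have key : norm2 (A *ᵥ x.ofLp) ≤ spec A * norm2 x.ofLp := by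
      by_cases hx : x.ofLp = 0
      · rw [hx]; simp [norm2]
      · have hp := norm2_pos _ hx
        have h1 : norm2 (A *ᵥ ((norm2 x.ofLp)⁻¹ • x.ofLp)) ≤ spec A := by
          apply le_csSup ⟨_, hub⟩
          refine ⟨_, ?_, rfl⟩
          rw [norm2_smul, abs_of_pos (inv_pos.2 hp), inv_mul_cancel₀ hp.ne']
        rw [Matrix.mulVec_smul, norm2_smul, abs_of_pos (inv_pos.2 hp), inv_mul_le_iff₀ hp] at h1
        linarith
    rw [norm2_eq, norm2_eq] at key
    exact key

lemma diag_mul (m n p : ℕ) (f g : ℕ → ℝ) :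
    diagMat m n f * diagMat n p g = diagMat m p (fun i => if i < n then f i * g i else 0) := by
  ext i k
  simp only [diagMat, Matrix.mul_apply, Matrix.of_apply]
  by_cases hi : (i : ℕ) < n
  · rw [Finset.sum_eq_single (⟨i, hi⟩ : Fin n)]
    · simp [hi]
    · intro b _ hb
      have : (i : ℕ) ≠ b := fun h => hb (Fin.ext h.symm)
      simp [this]
    · simp
  · rw [Finset.sum_eq_zero]
    · simp [hi]
    · intro b _
      have : (i : ℕ) ≠ b := by have := b.2; omega
      simp [this]

lemma diag_congr (m n : ℕ) (f g : ℕ → ℝ) (h : ∀ i, i < m → i < n → f i = g i) :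
    diagMat m n f = diagMat m n g := by
  ext i j
  simp only [diagMat, Matrix.of_apply]
  split_ifs with hij
  · exact h _ i.2 (hij ▸ j.2)
  · rfl

lemma diag_T (m n : ℕ) (f : ℕ → ℝ) : (diagMat m n f)ᵀ = diagMat n m f := by
  ext i j
  simp only [diagMat, Matrix.of_apply, Matrix.transpose_apply]
  by_cases h : (i : ℕ) = j
  · simp [h]
  · simp [h, Ne.symm h]

lemma diag_one (n : ℕ) : diagMat n n (fun _ => 1) = 1 := by
  ext i j
  simp [diagMat, Matrix.one_apply, Fin.ext_iff]

lemma diag_sub (m n : ℕ) (f g : ℕ → ℝ) :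
    diagMat m n f - diagMat m n g = diagMat m n (fun i => f i - g i) := by
  ext i j
  simp only [diagMat, Matrix.of_apply, Matrix.sub_apply]
  split_ifs <;> simp

lemma trunc_eq (m n q : ℕ) (f : ℕ → ℝ) :
    diagTrunc m n q f = diagMat m n (fun i => if i < q then f i else 0) := by
  ext i j
  simp only [diagMat, diagTrunc, Matrix.of_apply]
  by_cases h1 : (i : ℕ) = j <;> by_cases h2 : (i : ℕ) < q <;> simp [h1, h2] <;> grind

lemma norm_T {m n : ℕ} (A : Matrix (Fin m) (Fin n) ℝ) : ‖Aᵀ‖ = ‖A‖ := by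
  have := Matrix.l2_opNorm_conjTranspose A
  rwa [Matrix.conjTranspose_eq_transpose_of_trivial] at this

lemma norm_TM {m n : ℕ} (A : Matrix (Fin m) (Fin n) ℝ) : ‖Aᵀ * A‖ = ‖A‖ * ‖A‖ := by
  have := Matrix.l2_opNorm_conjTranspose_mul_self A
  rwa [Matrix.conjTranspose_eq_transpose_of_trivial] at this

lemma diag_norm (m n : ℕ) (f : ℕ → ℝ) (c : ℝ) (hc : 0 ≤ c)
    (h : ∀ i, i < m → i < n → |f i| ≤ c) : ‖diagMat m n f‖ ≤ c := by
  have h1 : ‖(diagMat m n f)ᵀ * diagMat m n f‖ ≤ c * c := by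
    rw [diag_T, diag_mul]
    have : diagMat n n (fun i => if i < m then f i * f i else 0)
        = Matrix.diagonal (fun i : Fin n => if (i : ℕ) < m then f i * f i else 0) := by
      ext i j
      simp only [diagMat, Matrix.of_apply, Matrix.diagonal_apply, Fin.ext_iff]
    rw [this, Matrix.l2_opNorm_diagonal, pi_norm_le_iff_of_nonneg (by positivity)]
    intro i
    split_ifs with hi
    · rw [Real.norm_eq_abs, abs_mul]
      have := h i hi i.2
      gcongr
    · simp; positivity
  rw [norm_TM] at h1
  exact abs_le_of_sq_le_sq' (by nlinarith) hc |>.2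

lemma orth_norm {n : ℕ} (V : Matrix (Fin n) (Fin n) ℝ) (hV : Vᵀ * V = 1) : ‖V‖ ≤ 1 := by
  have h := norm_TM V
  have h1 : ‖(1 : Matrix (Fin n) (Fin n) ℝ)‖ ≤ 1 := by
    rw [← diag_one]; exact diag_norm _ _ _ _ zero_le_one (by simp)
  rw [hV] at h
  nlinarith [norm_nonneg V]

lemma sand_norm {m n : ℕ} (U : Matrix (Fin m) (Fin m) ℝ) (V : Matrix (Fin n) (Fin n) ℝ)
    (hU : Uᵀ * U = 1) (hV : Vᵀ * V = 1) (A : Matrix (Fin m) (Fin n) ℝ) (c : ℝ) (h : ‖A‖ ≤ c) :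
    ‖U * A * Vᵀ‖ ≤ c := by
  have h1 := Matrix.l2_opNorm_mul (U * A) Vᵀ
  have h2 := Matrix.l2_opNorm_mul U A
  have h3 := orth_norm U hU
  have h4 := orth_norm V hV
  rw [norm_T] at h1
  have := norm_nonneg (U * A)
  have := norm_nonneg A
  nlinarith

lemma sand_mul {m n p : ℕ} (U : Matrix (Fin m) (Fin m) ℝ) (V : Matrix (Fin n) (Fin n) ℝ)
    (W : Matrix (Fin p) (Fin p) ℝ)
    (hV : Vᵀ * V = 1) (A : Matrix (Fin m) (Fin n) ℝ) (B : Matrix (Fin n) (Fin p) ℝ) :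
    (U * A * Vᵀ) * (V * B * Wᵀ) = U * (A * B) * Wᵀ := by
  calc _ = U * A * (Vᵀ * V) * B * Wᵀ := by simp only [Matrix.mul_assoc]
    _ = _ := by rw [hV]; simp only [Matrix.mul_assoc, Matrix.mul_one, Matrix.one_mul]

lemma singVal_bdd {m n : ℕ} (A : Matrix (Fin m) (Fin n) ℝ) (i : ℕ) :
    BddBelow {c : ℝ | ∃ B : Matrix (Fin m) (Fin n) ℝ, B.rank < i ∧ c = spec (A - B)} :=
  ⟨0, by rintro c ⟨B, _, rfl⟩; rw [spec_eq]; exact norm_nonneg _⟩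

lemma singVal_le {m n : ℕ} (A B : Matrix (Fin m) (Fin n) ℝ) (i : ℕ) (h : B.rank < i) :
    singVal A i ≤ ‖A - B‖ := by
  rw [← spec_eq]
  exact csInf_le (singVal_bdd A i) ⟨B, h, rfl⟩

lemma le_singVal {m n : ℕ} (A : Matrix (Fin m) (Fin n) ℝ) (i : ℕ) (hi : 0 < i) (c : ℝ)
    (h : ∀ B : Matrix (Fin m) (Fin n) ℝ, B.rank < i → c ≤ ‖A - B‖) : c ≤ singVal A i := by
  apply le_csInf
  · exact ⟨_, 0, by simpa using hi, rfl⟩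
  · rintro _ ⟨B, hB, rfl⟩
    rw [spec_eq]; exact h B hB

lemma singVal_nonneg {m n : ℕ} (A : Matrix (Fin m) (Fin n) ℝ) (i : ℕ) : 0 ≤ singVal A i := by
  apply Real.sInf_nonneg
  rintro c ⟨B, _, rfl⟩
  rw [spec_eq]; exact norm_nonneg _

lemma singVal_zero {m n : ℕ} (A : Matrix (Fin m) (Fin n) ℝ) : singVal A 0 = 0 := by
  simp [singVal]

lemma singVal_anti {m n : ℕ} (A : Matrix (Fin m) (Fin n) ℝ) (i j : ℕ) (hi : 0 < i)
    (hij : i ≤ j) : singVal A j ≤ singVal A i :=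
  le_singVal A i hi _ fun B hB => singVal_le A B j (by omega)

lemma weyl {m n : ℕ} (A B : Matrix (Fin m) (Fin n) ℝ) (i : ℕ) (hi : 0 < i) :
    singVal A i - ‖A - B‖ ≤ singVal B i := by
  apply le_singVal B i hi
  intro C hC
  have h1 := singVal_le A C i hC
  have h2 := norm_add_le (A - B) (B - C)
  rw [sub_add_sub_cancel] at h2
  linarith

/-- The data of a truncation. -/
structure IsTr {m n : ℕ} (S Sq : Matrix (Fin m) (Fin n) ℝ) (P : Matrix (Fin n) (Fin n) ℝ)
    (Q : Matrix (Fin m) (Fin m) ℝ) (W : Matrix (Fin n) (Fin m) ℝ) (s t : ℝ) : Prop where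
  hP : P * P = P
  hQ : Q * Q = Q
  PT : Pᵀ = P
  QT : Qᵀ = Q
  SP : S * P = Sq
  QS : Q * S = Sq
  WS : W * S = P
  SW : S * W = Q
  nP : ‖P‖ ≤ 1
  nQ : ‖Q‖ ≤ 1
  nP' : ‖1 - P‖ ≤ 1
  nQ' : ‖1 - Q‖ ≤ 1
  nW : s * ‖W‖ ≤ 1
  nR : ‖S - Sq‖ ≤ t

lemma mul3_le {a b c d : ℕ} (A : Matrix (Fin a) (Fin b) ℝ) (B : Matrix (Fin b) (Fin c) ℝ)
    (C : Matrix (Fin c) (Fin d) ℝ) (hA : ‖A‖ ≤ 1) (hC : ‖C‖ ≤ 1) : ‖A * B * C‖ ≤ ‖B‖ := by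
  have h1 := Matrix.l2_opNorm_mul (A * B) C
  have h2 := Matrix.l2_opNorm_mul A B
  have := norm_nonneg (A * B)
  have := norm_nonneg B
  nlinarith

lemma mul_le {a b c : ℕ} (A : Matrix (Fin a) (Fin b) ℝ) (B : Matrix (Fin b) (Fin c) ℝ)
    (x y : ℝ) (hA : ‖A‖ ≤ x) (hB : ‖B‖ ≤ y) : ‖A * B‖ ≤ x * y := by
  have h1 := Matrix.l2_opNorm_mul A B
  have := norm_nonneg A
  have := norm_nonneg B
  exact h1.trans (mul_le_mul hA hB (norm_nonneg _) (by linarith))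

lemma wedin {m n : ℕ} {S Sq M Mq : Matrix (Fin m) (Fin n) ℝ} {P P' : Matrix (Fin n) (Fin n) ℝ}
    {Q Q' : Matrix (Fin m) (Fin m) ℝ} {W W' : Matrix (Fin n) (Fin m) ℝ} {s t s' t' : ℝ}
    (h : IsTr S Sq P Q W s t) (h' : IsTr M Mq P' Q' W' s' t') (hs' : 0 ≤ s')
    (e : ℝ) (he : ‖M - S‖ ≤ e) (hd : 0 < s' - t) :
    ‖Q' * M * (1 - P)‖ ≤ t * (e / (s' - t)) + e ∧
    ‖(1 - Q) * M * P'‖ ≤ t * (e / (s' - t)) + e := by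
  have ht : 0 ≤ t := (norm_nonneg _).trans h.nR
  have e1 : Q' * M * (1 - P) = (Q' * (1 - Q)) * (S - Sq) + Q' * (M - S) * (1 - P) := by
    have : (1 - Q) * (S - Sq) = S * (1 - P) := by
      have hh : Q * Sq = Sq := by rw [← h.QS, ← Matrix.mul_assoc, h.hQ]
      simp only [Matrix.sub_mul, Matrix.mul_sub, Matrix.one_mul, Matrix.mul_one, h.QS, h.SP, hh]
      abel
    rw [Matrix.mul_assoc Q' (1 - Q), this, ← Matrix.mul_assoc]
    simp only [Matrix.mul_sub, Matrix.sub_mul]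
    abel
  have e2 : (1 - Q) * M * P' = (S - Sq) * ((1 - P) * P') + (1 - Q) * (M - S) * P' := by
    have : (S - Sq) * (1 - P) = (1 - Q) * S := by
      have hh : Sq * P = Sq := by rw [← h.SP, Matrix.mul_assoc, h.hP]
      simp only [Matrix.sub_mul, Matrix.mul_sub, Matrix.one_mul, Matrix.mul_one, h.QS, h.SP, hh]
      abel
    rw [← Matrix.mul_assoc, this]
    simp only [Matrix.mul_sub, Matrix.sub_mul]
    abel
  have a1 : ‖Q' * (1 - Q)‖ = ‖(1 - Q) * Q'‖ := by
    rw [← norm_T, Matrix.transpose_mul, Matrix.transpose_sub, h.QT, h'.QT, Matrix.transpose_one]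
  have b1 : ‖P' * (1 - P)‖ = ‖(1 - P) * P'‖ := by
    rw [← norm_T, Matrix.transpose_mul, Matrix.transpose_sub, h.PT, h'.PT, Matrix.transpose_one]
  have n1 : ‖Q' * M * (1 - P)‖ ≤ ‖(1 - Q) * Q'‖ * t + e := by
    rw [e1]
    refine (norm_add_le _ _).trans (add_le_add (mul_le _ _ _ _ a1.le h.nR) ?_)
    exact (mul3_le _ _ _ h'.nQ h.nP').trans he
  have n2 : ‖(1 - Q) * M * P'‖ ≤ t * ‖(1 - P) * P'‖ + e := by
    rw [e2]
    refine (norm_add_le _ _).trans (add_le_add (mul_le _ _ _ _ h.nR le_rfl) ?_)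
    exact (mul3_le _ _ _ h.nQ' h'.nP).trans he
  have QM : Q' * M = M * P' := h'.QS.trans h'.SP.symm
  have f1 : (1 - Q) * Q' = (1 - Q) * M * P' * W' := by
    rw [Matrix.mul_assoc (1 - Q), ← QM, Matrix.mul_assoc, Matrix.mul_assoc, h'.SW, h'.hQ]
  have f2 : P' * (1 - P) = W' * (Q' * M * (1 - P)) := by
    rw [QM, ← Matrix.mul_assoc, ← Matrix.mul_assoc, h'.WS, h'.hP]
  have g1 : s' * ‖(1 - Q) * Q'‖ ≤ ‖(1 - Q) * M * P'‖ := by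
    have := Matrix.l2_opNorm_mul ((1 - Q) * M * P') W'
    rw [← f1] at this
    have := h'.nW
    nlinarith [norm_nonneg ((1 - Q) * M * P')]
  have g2 : s' * ‖(1 - P) * P'‖ ≤ ‖Q' * M * (1 - P)‖ := by
    have := Matrix.l2_opNorm_mul W' (Q' * M * (1 - P))
    rw [← f2, b1] at this
    have := h'.nW
    nlinarith [norm_nonneg (Q' * M * (1 - P))]
  set a := ‖(1 - Q) * Q'‖
  set b := ‖(1 - P) * P'‖
  have hmax : a ≤ e / (s' - t) ∧ b ≤ e / (s' - t) := by
    rw [le_div_iff₀ hd, le_div_iff₀ hd]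
    rcases le_total a b with hab | hab
    · constructor <;> nlinarith
    · constructor <;> nlinarith
  constructor
  · nlinarith [mul_le_mul_of_nonneg_left hmax.1 ht]
  · nlinarith [mul_le_mul_of_nonneg_left hmax.2 ht]

lemma block {m n : ℕ} {S Sq M Mq : Matrix (Fin m) (Fin n) ℝ} {P P' : Matrix (Fin n) (Fin n) ℝ}
    {Q Q' : Matrix (Fin m) (Fin m) ℝ} {W W' : Matrix (Fin n) (Fin m) ℝ} {s t s' t' : ℝ}
    (h : IsTr S Sq P Q W s t) (h' : IsTr M Mq P' Q' W' s' t') (hs : 0 ≤ s) (hs' : 0 ≤ s')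
    (e : ℝ) (he : ‖M - S‖ ≤ e) (hd : 0 < s' - t) (hd' : 0 < s - t') :
    ‖Mq - Sq‖ ≤ e + (t * (e / (s' - t)) + e) + (t' * (e / (s - t')) + e) := by
  have w1 := (wedin h h' hs' e he hd).1
  have w2 := (wedin h' h hs e (by rwa [norm_sub_rev]) hd').2
  have QM : Q' * M = M * P' := h'.QS.trans h'.SP.symm
  have key : Mq - Sq = Q' * (M - S) * P + Q' * M * (1 - P) - (1 - Q') * S * P := by
    rw [← h'.QS, ← h.SP]
    simp only [Matrix.mul_sub, Matrix.sub_mul, Matrix.mul_one, Matrix.one_mul]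
    abel
  rw [key]
  refine (norm_sub_le _ _).trans (add_le_add ((norm_add_le _ _).trans (add_le_add ?_ w1)) w2)
  exact (mul3_le _ _ _ h'.nQ h.nP).trans he

lemma rank_diag (m n k : ℕ) (f : ℕ → ℝ) (h : ∀ i, k ≤ i → f i = 0) :
    (diagMat m n f).rank ≤ k := by
  have : diagMat m n f = diagMat m k f * diagMat k n (fun _ => 1) := by
    rw [diag_mul]
    apply diag_congr
    intro i _ _
    split_ifs with hi
    · simp
    · exact h i (by omega)
  rw [this]
  refine (Matrix.rank_mul_le_left _ _).trans ?_
  simpa using Matrix.rank_le_width (diagMat m k f)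

lemma sv_le {m n : ℕ} (U : Matrix (Fin m) (Fin m) ℝ) (V : Matrix (Fin n) (Fin n) ℝ) (f : ℕ → ℝ)
    (hU : Uᵀ * U = 1) (hV : Vᵀ * V = 1)
    (hmono : ∀ a b : ℕ, a ≤ b → f b ≤ f a) (hnn : ∀ a, 0 ≤ f a) (k : ℕ) :
    singVal (U * diagMat m n f * Vᵀ) (k + 1) ≤ f k := by
  refine (singVal_le _ (U * diagMat m n (fun i => if i < k then f i else 0) * Vᵀ) _ ?_).trans ?_
  · have h1 := Matrix.rank_mul_le_left (U * diagMat m n (fun i => if i < k then f i else 0)) Vᵀ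
    have h2 := Matrix.rank_mul_le_right U (diagMat m n (fun i => if i < k then f i else 0))
    have h3 := rank_diag m n k (fun i => if i < k then f i else 0) (by intro i hi; simp; omega)
    omega
  · rw [← Matrix.sub_mul, ← Matrix.mul_sub, diag_sub]
    apply sand_norm _ _ hU hV
    apply diag_norm _ _ _ _ (hnn k)
    intro i _ _
    split_ifs with hi
    · simpa using hnn k
    · rw [sub_zero, abs_of_nonneg (hnn i)]
      exact hmono _ _ (by omega)

lemma le_sv {m n : ℕ} (U : Matrix (Fin m) (Fin m) ℝ) (V : Matrix (Fin n) (Fin n) ℝ) (f : ℕ → ℝ)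
    (hU : Uᵀ * U = 1) (hV : Vᵀ * V = 1)
    (hmono : ∀ a b : ℕ, a ≤ b → f b ≤ f a) (hnn : ∀ a, 0 ≤ f a) (k : ℕ) (hm : k < m) (hn : k < n) :
    f k ≤ singVal (U * diagMat m n f * Vᵀ) (k + 1) := by
  rcases (hnn k).eq_or_lt with h0 | h0
  · rw [← h0]; exact singVal_nonneg _ _
  apply le_singVal _ _ (by omega)
  intro B hB
  set S := U * diagMat m n f * Vᵀ with hS
  set E := V * diagMat n (k + 1) (fun _ => 1) with hE
  have hker : ∃ y : Fin (k + 1) → ℝ, y ≠ 0 ∧ (B * E) *ᵥ y = 0 := by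
    by_contra hcon
    push Not at hcon
    have hinj : Function.Injective (B * E).mulVecLin := by
      rw [← LinearMap.ker_eq_bot, LinearMap.ker_eq_bot']
      intro y hy
      by_contra hy0
      exact hcon y hy0 hy
    have h1 := LinearMap.finrank_range_of_inj hinj
    have h2 := Matrix.rank_mul_le_left B E
    rw [Matrix.rank, h1] at h2
    simp at h2
    omega
  obtain ⟨y, hy0, hy⟩ := hker
  set W := diagMat (k + 1) m (fun i => (f i)⁻¹) * Uᵀ with hW
  have hid : W * (S * E) = 1 := by
    have : W * (S * E) = diagMat (k + 1) m (fun i => (f i)⁻¹) * ((Uᵀ * U) * (diagMat m n f *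
      ((Vᵀ * V) * diagMat n (k + 1) (fun _ => 1)))) := by
      simp only [hW, hS, hE, Matrix.mul_assoc]
    rw [this, hU, hV, Matrix.one_mul, Matrix.one_mul, diag_mul, diag_mul, ← diag_one]
    apply diag_congr
    intro i hi _
    have : f i ≠ 0 := (h0.trans_le (hmono i k (by omega))).ne'
    rw [if_pos (by omega), if_pos (by omega)]
    field_simp
  have nW : ‖W‖ ≤ (f k)⁻¹ := by
    have : ‖Uᵀ‖ ≤ 1 := by rw [norm_T]; exact orth_norm U hU
    have h2 := mul_le (diagMat (k + 1) m (fun i => (f i)⁻¹)) Uᵀ (f k)⁻¹ 1 ?_ this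
    · simpa using h2
    · apply diag_norm _ _ _ _ (by positivity)
      intro i hi _
      have h3 := hmono i k (by omega)
      rw [abs_of_nonneg (inv_nonneg.2 (hnn i))]
      exact inv_anti₀ h0 h3
  have nE : ‖E‖ ≤ 1 := by
    have h2 := mul_le V (diagMat n (k + 1) (fun _ => 1)) 1 1 (orth_norm V hV)
      (diag_norm _ _ _ _ zero_le_one (by simp))
    simpa using h2
  have e1 : y = (W * ((S - B) * E)) *ᵥ y := by
    rw [Matrix.sub_mul, Matrix.mul_sub, Matrix.sub_mulVec, hid, ← Matrix.mulVec_mulVec, hy]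
    simp
  have h4 := norm2_mulVec_le (W * ((S - B) * E)) y
  rw [← e1] at h4
  have h5 := norm2_pos y hy0
  have h6 := mul_le W ((S - B) * E) _ _ nW (mul_le (S - B) E _ _ le_rfl nE)
  have h7 : 1 ≤ (f k)⁻¹ * (‖S - B‖ * 1) := by
    by_contra hlt
    push Not at hlt
    nlinarith
  rw [mul_one, inv_mul_eq_div, le_div_iff₀ h0] at h7
  linarith

lemma exists_tr {m n : ℕ} (U : Matrix (Fin m) (Fin m) ℝ) (V : Matrix (Fin n) (Fin n) ℝ) (f : ℕ → ℝ)
    (hU : Uᵀ * U = 1) (hV : Vᵀ * V = 1)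
    (hmono : ∀ a b : ℕ, a ≤ b → f b ≤ f a) (hnn : ∀ a, 0 ≤ f a) (q : ℕ)
    (S : Matrix (Fin m) (Fin n) ℝ) (hS : S = U * diagMat m n f * Vᵀ)
    (hpos : 0 < singVal S q) :
    ∃ P Q W, IsTr S (U * diagTrunc m n q f * Vᵀ) P Q W (singVal S q) (singVal S (q + 1)) := by
  obtain _ | k := q
  · simp [singVal_zero] at hpos
  have hrk : k + 1 ≤ S.rank := by
    by_contra hlt
    have := singVal_le S S (k + 1) (by omega)
    simp at this
    linarith
  have hm : k + 1 ≤ m := by have := Matrix.rank_le_height S; omega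
  have hn : k + 1 ≤ n := by have := Matrix.rank_le_width S; omega
  have hsk : singVal S (k + 1) ≤ f k := by rw [hS]; exact sv_le U V f hU hV hmono hnn k
  have hfk : ∀ i, i < k + 1 → 0 < f i := fun i hi =>
    (hpos.trans_le hsk).trans_le (hmono i k (by omega))
  have oneU : (1 : Matrix (Fin m) (Fin m) ℝ) = U * diagMat m m (fun _ => 1) * Uᵀ := by
    rw [diag_one, Matrix.mul_one, mul_eq_one_comm.1 hU]
  have oneV : (1 : Matrix (Fin n) (Fin n) ℝ) = V * diagMat n n (fun _ => 1) * Vᵀ := by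
    rw [diag_one, Matrix.mul_one, mul_eq_one_comm.1 hV]
  set χ : ℕ → ℝ := fun i => if i < k + 1 then 1 else 0 with hχ
  refine ⟨V * diagMat n n χ * Vᵀ, U * diagMat m m χ * Uᵀ,
    V * diagMat n m (fun i => if i < k + 1 then (f i)⁻¹ else 0) * Uᵀ, ?_⟩
  rw [trunc_eq]
  constructor
  · rw [sand_mul _ _ _ hV, diag_mul]
    congr 2; apply diag_congr; intro i h1 h2; simp [hχ]; grind
  · rw [sand_mul _ _ _ hU, diag_mul]
    congr 2; apply diag_congr; intro i h1 h2; simp [hχ]; grind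
  · simp [Matrix.transpose_mul, diag_T, Matrix.mul_assoc]
  · simp [Matrix.transpose_mul, diag_T, Matrix.mul_assoc]
  · rw [hS, sand_mul _ _ _ hV, diag_mul]
    congr 2; apply diag_congr; intro i h1 h2; simp [hχ]; grind
  · rw [hS, sand_mul _ _ _ hU, diag_mul]
    congr 2; apply diag_congr; intro i h1 h2; simp [hχ]; grind
  · rw [hS, sand_mul _ _ _ hU, diag_mul]
    congr 2; apply diag_congr; intro i h1 h2
    by_cases hi : i < k + 1
    · have := (hfk i hi).ne'
      have : i < m := by omega
      simp only [hχ, if_pos hi, if_pos this]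
      field_simp
    · simp only [hχ, if_neg hi]; simp
  · rw [hS, sand_mul _ _ _ hV, diag_mul]
    congr 2; apply diag_congr; intro i h1 h2
    by_cases hi : i < k + 1
    · have := (hfk i hi).ne'
      have : i < n := by omega
      simp only [hχ, if_pos hi, if_pos this]
      field_simp
    · simp only [hχ, if_neg hi]; simp
  · apply sand_norm _ _ hV hV; apply diag_norm _ _ _ _ zero_le_one
    intro i _ _; simp only [hχ]; split_ifs <;> simp
  · apply sand_norm _ _ hU hU; apply diag_norm _ _ _ _ zero_le_one
    intro i _ _; simp only [hχ]; split_ifs <;> simp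
  · rw [oneV, ← Matrix.sub_mul, ← Matrix.mul_sub, diag_sub]
    apply sand_norm _ _ hV hV; apply diag_norm _ _ _ _ zero_le_one
    intro i _ _; simp only [hχ]; split_ifs <;> simp
  · rw [oneU, ← Matrix.sub_mul, ← Matrix.mul_sub, diag_sub]
    apply sand_norm _ _ hU hU; apply diag_norm _ _ _ _ zero_le_one
    intro i _ _; simp only [hχ]; split_ifs <;> simp
  · have : ‖V * diagMat n m (fun i => if i < k + 1 then (f i)⁻¹ else 0) * Uᵀ‖
        ≤ (singVal S (k + 1))⁻¹ := by
      apply sand_norm _ _ hV hU; apply diag_norm _ _ _ _ (by positivity)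
      intro i _ _
      split_ifs with hi
      · rw [abs_of_nonneg (inv_nonneg.2 (hnn i))]
        exact inv_anti₀ hpos (hsk.trans (hmono _ _ (by omega)))
      · simpa using hpos.le
    calc _ ≤ singVal S (k + 1) * (singVal S (k + 1))⁻¹ := by gcongr
      _ = 1 := mul_inv_cancel₀ hpos.ne'
  · conv_lhs => rw [hS]
    rw [← Matrix.sub_mul, ← Matrix.mul_sub, diag_sub]
    apply sand_norm _ _ hU hV; apply diag_norm _ _ _ _ (singVal_nonneg _ _)
    intro i h1 h2
    split_ifs with hi
    · simpa using singVal_nonneg S _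
    · rw [sub_zero, abs_of_nonneg (hnn i)]
      refine (hmono (k + 1) i (by omega)).trans ?_
      rw [hS]
      exact le_sv U V f hU hV hmono hnn (k + 1) (by omega) (by omega)

/-- Corollary 4.3, rectangular TVV bound: if
`(σ_q(S) − σ_{q+1}(S))/‖Z‖ ≥ r ≥ 4` then, for `M = S + Z` and SVD-truncations
`[M]_q`, `[S]_q`, one has
`‖[M]_q − [S]_q‖ ≤ (6r/(r−2))‖Z‖(σ_q(S)/(σ_q(S)−σ_{q+1}(S)) + log(6σ_1(S)/(σ_q(S)−σ_{q+1}(S))))`. -/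
theorem tvv_lowrank_perturbation
    (m n : ℕ) (S Z M : Matrix (Fin m) (Fin n) ℝ) (hM : M = S + Z)
    (q : ℕ) (r : ℝ) (hr : 4 ≤ r)
    (hgap : r ≤ (singVal S q - singVal S (q + 1)) / spec Z)
    -- an SVD of the signal matrix `S`
    (U : Matrix (Fin m) (Fin m) ℝ) (V : Matrix (Fin n) (Fin n) ℝ) (σs : ℕ → ℝ)
    (hU : Uᵀ * U = 1) (hV : Vᵀ * V = 1)
    (hmono : ∀ a b : ℕ, a ≤ b → σs b ≤ σs a) (hnn : ∀ a, 0 ≤ σs a)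
    (hSVD : S = U * diagMat m n σs * Vᵀ)
    -- an SVD of the perturbed matrix `M`
    (Uh : Matrix (Fin m) (Fin m) ℝ) (Vh : Matrix (Fin n) (Fin n) ℝ) (σsh : ℕ → ℝ)
    (hUh : Uhᵀ * Uh = 1) (hVh : Vhᵀ * Vh = 1)
    (hmonoh : ∀ a b : ℕ, a ≤ b → σsh b ≤ σsh a) (hnnh : ∀ a, 0 ≤ σsh a)
    (hSVDh : M = Uh * diagMat m n σsh * Vhᵀ) :
    spec (Uh * diagTrunc m n q σsh * Vhᵀ - U * diagTrunc m n q σs * Vᵀ) ≤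
      (6 * r / (r - 2)) * spec Z *
        (singVal S q / (singVal S q - singVal S (q + 1)) +
          Real.log (6 * singVal S 1 / (singVal S q - singVal S (q + 1)))) := by
  have hez : spec Z = ‖Z‖ := spec_eq Z
  rw [spec_eq (_ - _)]
  have hz0 : 0 < spec Z := by
    rcases (hez ▸ norm_nonneg Z : 0 ≤ spec Z).eq_or_lt with h | h
    · rw [← h, div_zero] at hgap; linarith
    · exact h
  rw [le_div_iff₀ hz0] at hgap
  have hMS : ‖M - S‖ = spec Z := by rw [hM, hez, add_sub_cancel_left]
  have ht0 := singVal_nonneg S (q + 1)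
  have ht0' := singVal_nonneg M (q + 1)
  have h4 : 4 * spec Z ≤ singVal S q - singVal S (q + 1) := by nlinarith
  have hq : 0 < q := by
    rcases Nat.eq_zero_or_pos q with h | h
    · subst h; rw [singVal_zero] at h4; linarith
    · exact h
  have w1 := weyl S M q hq
  have w2 := weyl M S (q + 1) (by omega)
  rw [norm_sub_rev, hMS] at w1
  rw [hMS] at w2
  have h1q := singVal_anti S 1 q one_pos hq
  obtain ⟨P, Q, W, h⟩ := exists_tr U V σs hU hV hmono hnn q S hSVD (by linarith)
  obtain ⟨P', Q', W', h'⟩ := exists_tr Uh Vh σsh hUh hVh hmonoh hnnh q M hSVDh (by linarith)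
  have hb := block h h' (by linarith) (by linarith) (spec Z) hMS.le (by linarith) (by linarith)
  refine hb.trans ?_
  clear hb h h'
  generalize singVal S q = s at *
  generalize singVal S (q + 1) = t at *
  generalize singVal S 1 = s1 at *
  generalize singVal M q = s' at *
  generalize singVal M (q + 1) = t' at *
  generalize spec Z = e at *
  have hd : 0 < s - t := by linarith
  have hlog : 0 ≤ Real.log (6 * s1 / (s - t)) := by
    apply Real.log_nonneg
    rw [le_div_iff₀ hd]; linarith
  have hc : 6 ≤ 6 * r / (r - 2) := by
    rw [le_div_iff₀ (by linarith)]; linarith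
  have hx : 1 ≤ s / (s - t) := by rw [le_div_iff₀ hd]; linarith
  have hR : 6 * e * (s / (s - t)) ≤ (6 * r / (r - 2)) * e *
      (s / (s - t) + Real.log (6 * s1 / (s - t))) := by
    gcongr
    linarith
  refine le_trans ?_ hR
  have b1 : e / (s' - t) ≤ 4 / 3 * (e / (s - t)) := by
    rw [mul_div_assoc', div_le_div_iff₀ (by linarith) hd]; nlinarith
  have b2 : e / (s - t') ≤ 4 / 3 * (e / (s - t)) := by
    rw [mul_div_assoc', div_le_div_iff₀ (by linarith) hd]; nlinarith
  set y := e / (s - t) with hy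
  have hy0 : 0 ≤ y := by positivity
  have hye : y * (s - t) = e := by rw [hy]; field_simp
  have hR2 : 6 * e * (s / (s - t)) = 6 * s * y := by rw [hy]; ring
  rw [hR2]
  have hy4 : y ≤ 1 / 4 := by rw [hy, div_le_iff₀ hd]; linarith
  have c1 : t * (e / (s' - t)) ≤ t * (4 / 3 * y) := by gcongr
  have c2 : t' * (e / (s - t')) ≤ (t + e) * (4 / 3 * y) := by
    apply mul_le_mul (by linarith) b2 _ (by linarith)
    apply div_nonneg <;> linarith
  have c3 : e * y ≤ e * (1 / 4) := by gcongr
  nlinarith [mul_nonneg ht0 hy0]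

end Stmt6
end
end

section
/- Let X ∈ R^{N×d} have i.i.d. rows drawn from N(0, Σ_x) with Σ_x ∈ R^{d×d} positive definite, d ≥ 2, and N > d + 1. Then there exists a universal constant C_3 > 0 such that E||X†||² ≤ (C_3/σ_min(Σ_x))·(1/(√N − (d+1)/√N))², where X† is the Moore–Penrose pseudoinverse, ||·|| is the spectral norm, and σ_min(Σ_x) is the smallest eigenvalue of Σ_x. (In fact one may take the bound (1/σ_min(Σ_x))·(e√N/(N−d−1))².) -/
open MeasureTheory ProbabilityTheory Matrix

noncomputable section

namespace Stmt9

/-- Euclidean norm of a vector in `ℝ^n`. -/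
def norm2 {n : ℕ} (v : Fin n → ℝ) : ℝ := Real.sqrt (∑ i, v i ^ 2)

/-- Spectral norm (`ℓ₂` operator norm) of a real matrix. -/
def spec {m n : ℕ} (A : Matrix (Fin m) (Fin n) ℝ) : ℝ :=
  sSup {c : ℝ | ∃ x : Fin n → ℝ, norm2 x = 1 ∧ c = norm2 (A *ᵥ x)}

/-- `s_min(A) = inf_{‖x‖=1} ‖Ax‖`, the smallest singular value of a tall matrix
(and the smallest eigenvalue of a positive-definite matrix). -/
def sMin {m n : ℕ} (A : Matrix (Fin m) (Fin n) ℝ) : ℝ :=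
  sInf {c : ℝ | ∃ x : Fin n → ℝ, norm2 x = 1 ∧ c = norm2 (A *ᵥ x)}

/-- `(XᵀX)⁻¹Xᵀ`, the Moore–Penrose pseudoinverse of a full-column-rank matrix. -/
def pinv {N d : ℕ} (X : Matrix (Fin N) (Fin d) ℝ) : Matrix (Fin d) (Fin N) ℝ :=
  (Xᵀ * X)⁻¹ * Xᵀ

/-- Law of a vector of `n` i.i.d. centered Gaussians with variance `v`. -/
def gaussianVec (n : ℕ) (v : ℝ) : Measure (Fin n → ℝ) :=
  Measure.pi fun _ => gaussianReal 0 (Real.toNNReal v)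

abbrev gam (n : ℕ) : Measure (Fin n → ℝ) := Measure.pi fun _ => gaussianReal 0 1

lemma gaussianVec_one (n : ℕ) : gaussianVec n 1 = gam n := by
  simp [gaussianVec, gam]

lemma gam_density (n : ℕ) : gam n =
    (volume : Measure (Fin n → ℝ)).withDensity
      (fun x => ENNReal.ofReal (∏ i, gaussianPDFReal 0 1 (x i))) := by
  refine Measure.pi_eq (fun s hs => ?_)
  rw [withDensity_apply _ (MeasurableSet.univ_pi hs), volume_pi, Measure.restrict_pi_pi]
  have hint : Integrable (fun x : Fin n → ℝ => ∏ i, gaussianPDFReal 0 1 (x i))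
      (Measure.pi fun i => (volume : Measure ℝ).restrict (s i)) :=
    Integrable.fintype_prod (fun i => (integrable_gaussianPDFReal 0 1).restrict)
  rw [← ofReal_integral_eq_lintegral_ofReal hint
    (ae_of_all _ fun x => Finset.prod_nonneg fun i _ => gaussianPDFReal_nonneg _ _ _)]
  rw [integral_fintype_prod_eq_prod, ENNReal.ofReal_prod_of_nonneg]
  · exact Finset.prod_congr rfl fun i _ => (gaussianReal_apply_eq_integral _ one_ne_zero _).symm
  · intro i _
    exact integral_nonneg fun x => gaussianPDFReal_nonneg _ _ _

lemma norm2_eq {n : ℕ} (v : Fin n → ℝ) : norm2 v = ‖(WithLp.toLp 2 v : EuclideanSpace ℝ (Fin n))‖ := by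
  simp [norm2, EuclideanSpace.norm_eq]

lemma norm2_sq {n : ℕ} (v : Fin n → ℝ) : norm2 v ^ 2 = v ⬝ᵥ v := by
  rw [norm2, Real.sq_sqrt (Finset.sum_nonneg fun i _ => sq_nonneg _)]
  simp [dotProduct, sq]

lemma norm2_nonneg {n : ℕ} (v : Fin n → ℝ) : 0 ≤ norm2 v := Real.sqrt_nonneg _

lemma measurable_norm2 {n : ℕ} : Measurable (norm2 (n := n)) := by
  unfold norm2; fun_prop

lemma prod_pdf {n : ℕ} (x : Fin n → ℝ) : ∏ i, gaussianPDFReal 0 1 (x i) =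
    ((Real.sqrt (2 * Real.pi))⁻¹) ^ n * Real.exp (-(norm2 x) ^ 2 / 2) := by
  simp only [gaussianPDFReal, Finset.prod_mul_distrib, NNReal.coe_one, mul_one, sub_zero,
    ← Real.exp_sum, norm2_sq, dotProduct]
  simp [← Finset.sum_div, sq]

lemma lintegral_polar {n : ℕ} (hn : 0 < n) {f : ℝ → ENNReal} (hf : Measurable f) :
    ∫⁻ x : EuclideanSpace ℝ (Fin n), f ‖x‖ =
      (volume : Measure (EuclideanSpace ℝ (Fin n))).toSphere Set.univ *
        ∫⁻ r in Set.Ioi (0:ℝ), ENNReal.ofReal (r ^ (n - 1)) * f r := by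
  have : Nonempty (Fin n) := ⟨⟨0, hn⟩⟩
  set μ := (volume : Measure (EuclideanSpace ℝ (Fin n)))
  calc ∫⁻ x, f ‖x‖ ∂μ
      = ∫⁻ x : ({(0)}ᶜ : Set (EuclideanSpace ℝ (Fin n))), f (‖x.1‖) ∂(μ.comap (↑)) := by
        rw [lintegral_subtype_comap (measurableSet_singleton _).compl (fun x => f ‖x‖),
          restrict_compl_singleton]
    _ = ∫⁻ x, f x.2 ∂μ.toSphere.prod (.volumeIoiPow (n - 1)) := by
      have := μ.measurePreserving_homeomorphUnitSphereProd.lintegral_comp_emb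
        (Homeomorph.measurableEmbedding _) (f ∘ Subtype.val ∘ Prod.snd)
      simpa using this
    _ = μ.toSphere Set.univ * ∫⁻ x : Set.Ioi (0 : ℝ), f x ∂.volumeIoiPow (n - 1) := by
      rw [lintegral_prod _ (by fun_prop)]
      simp [mul_comm]
    _ = _ := by
      congr 1
      rw [Measure.volumeIoiPow, lintegral_withDensity_eq_lintegral_mul _ (by fun_prop) (by fun_prop)]
      rw [← lintegral_subtype_comap measurableSet_Ioi]
      rfl

/-- Half-line Gaussian moments. -/
def J (k : ℕ) : ℝ := ∫ r in Set.Ioi (0:ℝ), r ^ k * Real.exp (-r ^ 2 / 2)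

lemma J_int (k : ℕ) : IntegrableOn (fun r : ℝ => r ^ k * Real.exp (-r ^ 2 / 2)) (Set.Ioi 0) := by
  have := integrableOn_rpow_mul_exp_neg_mul_sq (b := 1/2) (by norm_num) (s := k)
    (by linarith [(Nat.cast_nonneg k : (0:ℝ) ≤ k)])
  refine this.congr_fun (fun r hr => ?_) measurableSet_Ioi
  simp only [Real.rpow_natCast]
  congr 2; ring

lemma J_eq (k : ℕ) : J k = (1/2:ℝ) ^ (-((k:ℝ)+1)/2) * (1/2) * Real.Gamma (((k:ℝ)+1)/2) := by
  rw [← integral_rpow_mul_exp_neg_mul_rpow (by norm_num) (by linarith [(Nat.cast_nonneg k : (0:ℝ) ≤ k)]) (by norm_num), J]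
  refine setIntegral_congr_fun measurableSet_Ioi (fun r hr => ?_)
  simp only [Real.rpow_natCast, Real.rpow_two]
  congr 2; ring

lemma J_pos (k : ℕ) : 0 < J k := by
  rw [J_eq]
  have := Real.Gamma_pos_of_pos (s := ((k:ℝ)+1)/2) (by positivity)
  positivity

lemma J_rec (k : ℕ) : J (k+2) = (k+1) * J k := by
  rw [J_eq, J_eq]
  have h1 : (((k+2:ℕ):ℝ)+1)/2 = ((k:ℝ)+1)/2 + 1 := by push_cast; ring
  have h2 : -(((k+2:ℕ):ℝ)+1)/2 = -((k:ℝ)+1)/2 - 1 := by push_cast; ring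
  rw [h1, h2, Real.Gamma_add_one (by positivity), Real.rpow_sub_one (by norm_num)]
  ring

lemma J_zero : J 0 = Real.sqrt (Real.pi / 2) := by
  have := integral_gaussian_Ioi (1/2)
  rw [J]
  have h : ∀ r : ℝ, r ^ 0 * Real.exp (-r ^ 2 / 2) = Real.exp (-(1/2) * r ^ 2) := by
    intro r; rw [pow_zero, one_mul]; congr 1; ring
  simp_rw [h]
  rw [this, show Real.pi / (1/2) = (Real.pi/2) * 2^2 by ring, Real.sqrt_mul (by positivity),
    Real.sqrt_sq (by norm_num)]
  ring

lemma J_one : J 1 = 1 := by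
  rw [J_eq]
  norm_num [Real.rpow_neg]

lemma J_logconv (k : ℕ) : J (k+1) ^ 2 ≤ J k * J (k+2) := by
  have key : ∀ t : ℝ, 0 ≤ J k * (t * t) + (-2 * J (k+1)) * t + J (k+2) := by
    intro t
    have : J k * (t * t) + (-2 * J (k+1)) * t + J (k+2) =
        ∫ r in Set.Ioi (0:ℝ), (r - t)^2 * (r ^ k * Real.exp (-r ^ 2 / 2)) := by
      have e : ∀ r : ℝ, (r - t)^2 * (r ^ k * Real.exp (-r ^ 2 / 2)) =
        ((t * t) * (r ^ k * Real.exp (-r ^ 2 / 2)) + (-2*t) * (r ^ (k+1) * Real.exp (-r ^ 2 / 2)))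
         + (r ^ (k+2) * Real.exp (-r ^ 2 / 2)) := by intro r; ring
      simp_rw [e]
      have hA : IntegrableOn (fun r : ℝ => (t * t) * (r ^ k * Real.exp (-r ^ 2 / 2)) +
          (-2*t) * (r ^ (k+1) * Real.exp (-r ^ 2 / 2))) (Set.Ioi 0) :=
        ((J_int k).const_mul _).add ((J_int (k+1)).const_mul _)
      rw [integral_add hA (J_int (k+2)),
        integral_add ((J_int k).const_mul _) ((J_int (k+1)).const_mul _),
        integral_const_mul, integral_const_mul]
      simp only [J]; ring
    rw [this]
    refine setIntegral_nonneg measurableSet_Ioi (fun r hr => ?_)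
    have : (0:ℝ) < r := hr
    positivity
  have := discrim_le_zero key
  rw [discrim] at this
  nlinarith

lemma J_lint (k : ℕ) : ∫⁻ r in Set.Ioi (0:ℝ), ENNReal.ofReal (r ^ k * Real.exp (-r ^ 2 / 2))
    = ENNReal.ofReal (J k) := by
  rw [J, ofReal_integral_eq_lintegral_ofReal (J_int k)]
  filter_upwards [ae_restrict_mem measurableSet_Ioi] with r hr
  have : (0:ℝ) < r := hr
  simp only [Pi.zero_apply]; positivity

lemma lintegral_gam_norm {n : ℕ} (hn : 0 < n) : ∃ c : ENNReal, 
    ∀ f : ℝ → ENNReal, Measurable f → 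
    ∫⁻ x, f (norm2 x) ∂(gam n) = c *
      ∫⁻ r in Set.Ioi (0:ℝ), ENNReal.ofReal (r ^ (n - 1) * Real.exp (-r ^ 2 / 2)) * f r := by
  refine ⟨(volume : Measure (EuclideanSpace ℝ (Fin n))).toSphere Set.univ *
    ENNReal.ofReal (((Real.sqrt (2 * Real.pi))⁻¹) ^ n), fun f hf => ?_⟩
  rw [gam_density, lintegral_withDensity_eq_lintegral_mul _ (by fun_prop)
    (show Measurable (fun x => f (norm2 x)) from hf.comp measurable_norm2)]
  simp only [Pi.mul_apply, prod_pdf, norm2_eq]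
  have := (PiLp.volume_preserving_toLp (Fin n)).lintegral_comp_emb
    (MeasurableEquiv.toLp 2 _).measurableEmbedding
    (fun x : EuclideanSpace ℝ (Fin n) => ENNReal.ofReal
      (((Real.sqrt (2 * Real.pi))⁻¹) ^ n * Real.exp (-‖x‖ ^ 2 / 2)) * f ‖x‖)
  rw [this, lintegral_polar hn (f := fun r => ENNReal.ofReal
      (((Real.sqrt (2 * Real.pi))⁻¹) ^ n * Real.exp (-r ^ 2 / 2)) * f r) (by fun_prop)]
  rw [mul_assoc]
  refine congrArg _ ?_
  rw [← lintegral_const_mul _ (by fun_prop)]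
  refine setLIntegral_congr_fun measurableSet_Ioi (fun r hr => ?_)
  have : (0:ℝ) < r := hr
  rw [ENNReal.ofReal_mul (by positivity), ENNReal.ofReal_mul (by positivity)]
  ring

lemma lintegral_gam_norm' {n : ℕ} (hn : 0 < n) (f : ℝ → ENNReal) (hf : Measurable f) (k : ℕ)
    (hk : ∀ r : ℝ, 0 < r → ENNReal.ofReal (r ^ (n-1)) * f r = ENNReal.ofReal (r ^ k)) :
    ∫⁻ x, f (norm2 x) ∂(gam n) = ENNReal.ofReal (J k / J (n-1)) := by
  obtain ⟨c, hc⟩ := lintegral_gam_norm hn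
  have h1 := hc (fun _ => 1) measurable_const
  simp only [lintegral_const, measure_univ, mul_one, J_lint] at h1
  have hJ := J_pos (n-1)
  have hc' : c = ENNReal.ofReal (1 / J (n-1)) := by
    rw [ENNReal.ofReal_div_of_pos hJ, ENNReal.ofReal_one, ENNReal.eq_div_iff _ ENNReal.ofReal_ne_top]
    · rw [mul_comm]; exact h1.symm
    · simpa using hJ
  rw [hc f hf, hc', show J k / J (n-1) = 1 / J (n-1) * J k by ring, ENNReal.ofReal_mul (by positivity),
    ← J_lint k]
  congr 1
  refine setLIntegral_congr_fun measurableSet_Ioi (fun r hr => ?_)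
  have hr : (0:ℝ) < r := hr
  rw [ENNReal.ofReal_mul (by positivity), ENNReal.ofReal_mul (by positivity), ← hk r hr]
  ring

/-- `E‖x‖^p`. -/
lemma moment_pos {n : ℕ} (hn : 0 < n) (p : ℕ) :
    ∫⁻ x, ENNReal.ofReal (norm2 x) ^ p ∂(gam n) = ENNReal.ofReal (J (n-1+p) / J (n-1)) := by
  refine lintegral_gam_norm' hn (fun r => ENNReal.ofReal r ^ p) (by fun_prop) _ (fun r hr => ?_)
  rw [← ENNReal.ofReal_pow hr.le, ← ENNReal.ofReal_mul (by positivity), pow_add]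

/-- `E‖x‖^{-p}` in dimension `p+1`. -/
lemma moment_neg (p : ℕ) :
    ∫⁻ x, (ENNReal.ofReal (norm2 x))⁻¹ ^ p ∂(gam (p+1)) = ENNReal.ofReal (J 0 / J p) := by
  refine lintegral_gam_norm' (Nat.succ_pos p) (fun r => (ENNReal.ofReal r)⁻¹ ^ p) (by fun_prop) _ (fun r hr => ?_)
  rw [← ENNReal.ofReal_inv_of_pos hr, ← ENNReal.ofReal_pow (by positivity),
    ← ENNReal.ofReal_mul (by positivity)]
  congr 1
  simp [hr.ne']


lemma J_up (k p N : ℕ) (h : k + p ≤ N) : J (k+p) ^ 2 ≤ (N:ℝ)^p * J k ^ 2 := by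
  induction p with
  | zero => simp
  | succ p ih =>
    have ih := ih (by omega)
    have h1 := J_logconv (k+p)
    rw [J_rec] at h1
    have h2 : ((k+p:ℕ):ℝ)+1 ≤ N := by exact_mod_cast (by omega : k+p+1 ≤ N)
    calc J (k+(p+1))^2 ≤ J (k+p) * ((((k+p:ℕ):ℝ)+1) * J (k+p)) := h1
      _ = (((k+p:ℕ):ℝ)+1) * J (k+p)^2 := by ring
      _ ≤ N * ((N:ℝ)^p * J k ^ 2) := by gcongr
      _ = _ := by ring

lemma J_prod (n : ℕ) : J (n+1) * J n = n.factorial * J 0 := by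
  induction n with
  | zero => simp [J_one]
  | succ n ih =>
    rw [J_rec, Nat.factorial_succ]; push_cast
    linear_combination ((n:ℝ)+1) * ih

lemma J_low (n : ℕ) (hn : 1 ≤ n) : n.factorial * J 0 * Real.sqrt n ≤ J (n+1) ^ 2 := by
  obtain ⟨m, rfl⟩ : ∃ m, n = m + 1 := ⟨n-1, by omega⟩
  have h1 := J_logconv m
  have h0 := J_pos m
  have h2 := J_pos (m+1)
  have h3 := J_pos (m+2)
  have hr := J_rec m
  have h4 : Real.sqrt (m+1:ℕ) * J (m+1) ≤ J (m+2) := by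
    refine (pow_le_pow_iff_left₀ (by positivity) (by positivity) two_ne_zero).1 ?_
    rw [mul_pow, Real.sq_sqrt (by positivity)]
    have : J (m+2)^2 = ((m:ℝ)+1) * (J m * J (m+2)) := by rw [sq]; nth_rw 1 [hr]; ring
    rw [this]; push_cast; gcongr
  rw [← J_prod]
  calc J (m+1+1) * J (m+1) * Real.sqrt (m+1:ℕ) = J (m+2) * (Real.sqrt (m+1:ℕ) * J (m+1)) := by ring
    _ ≤ J (m+2) * J (m+2) := by gcongr
    _ = _ := by ring

lemma J_stir (n : ℕ) (hn : 1 ≤ n) : J 0 ^ 2 * ((n:ℝ) / Real.exp 1) ^ (n+1) ≤ J (n+1) ^ 2 := by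
  refine le_trans ?_ (J_low n hn)
  have hs := Stirling.le_factorial_stirling n
  have h0 := J_pos 0
  have hn' : (1:ℝ) ≤ n := by exact_mod_cast hn
  have he : (1:ℝ) ≤ Real.exp 1 := Real.one_le_exp (by norm_num)
  have key : J 0 * ((n:ℝ) / Real.exp 1) ≤ Real.sqrt (2 * Real.pi * n) * Real.sqrt n := by
    have e1 : Real.sqrt (2 * Real.pi * n) * Real.sqrt n = Real.sqrt (2*Real.pi) * n := by
      rw [Real.sqrt_mul (by positivity), mul_assoc, Real.mul_self_sqrt (by positivity)]
    rw [e1, J_zero]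
    have : Real.sqrt (Real.pi/2) ≤ Real.sqrt (2*Real.pi) := Real.sqrt_le_sqrt (by linarith [Real.pi_pos])
    gcongr
    exact div_le_self (by positivity) he
  calc J 0 ^ 2 * ((n:ℝ) / Real.exp 1) ^ (n+1) = (J 0 * ((n:ℝ) / Real.exp 1)) * (J 0 * ((n:ℝ) / Real.exp 1)^n) := by ring
    _ ≤ (Real.sqrt (2 * Real.pi * n) * Real.sqrt n) * (J 0 * ((n:ℝ) / Real.exp 1)^n) := by gcongr
    _ = (Real.sqrt (2 * Real.pi * n) * ((n:ℝ) / Real.exp 1)^n) * J 0 * Real.sqrt n := by ring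
    _ ≤ _ := by gcongr

/-- The numerical inequality. -/
lemma numeric (d p N : ℕ) (hd : 1 ≤ d) (hp : 2 ≤ p) (hN : d + p = N) :
    (J (d-1+p) / J (d-1)) * (J 0 / J p) ≤
      (Real.exp 1 * Real.sqrt N / ((p:ℝ) - 1)) ^ p * (J p / J 0) := by
  obtain ⟨n, rfl⟩ : ∃ n, p = n + 1 := ⟨p-1, by omega⟩
  have hu := J_up (d-1) (n+1) N (by omega)
  have hl := J_stir n (by omega)
  have h0 := J_pos 0
  have hp := J_pos (n+1)
  have hd := J_pos (d-1)
  have hn' : (0:ℝ) < n := by exact_mod_cast (by omega : 0 < n)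
  have a1 : J (d-1+(n+1)) / J (d-1) ≤ Real.sqrt N ^ (n+1) := by
    rw [div_le_iff₀ hd]
    have := J_pos (d-1+(n+1))
    refine (pow_le_pow_iff_left₀ (by positivity) (by positivity) two_ne_zero).1 ?_
    rw [mul_pow, ← pow_mul, mul_comm (n+1) 2, pow_mul, Real.sq_sqrt (by positivity)]
    exact hu
  have a2 : J 0 / J (n+1) ≤ (Real.exp 1 / n)^(n+1) * (J (n+1) / J 0) := by
    rw [div_le_iff₀ hp]
    have : (Real.exp 1 / n)^(n+1) * (J (n+1) / J 0) * J (n+1) = J (n+1)^2 / ((n / Real.exp 1)^(n+1) * J 0) := by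
      rw [← inv_div (n:ℝ) (Real.exp 1), inv_pow]; field_simp
    rw [this, le_div_iff₀ (by positivity)]
    nlinarith [hl]
  have e : ((n+1:ℕ):ℝ) - 1 = n := by push_cast; ring
  rw [e]
  calc _ ≤ Real.sqrt N ^ (n+1) * ((Real.exp 1 / n)^(n+1) * (J (n+1) / J 0)) := by
        gcongr
    _ = _ := by rw [← mul_assoc, ← mul_pow]; congr 2; ring


lemma gam_map {m n : ℕ} (U : Matrix (Fin m) (Fin n) ℝ) (hU : U * Uᵀ = 1) :
    MeasurePreserving (fun x => U *ᵥ x) (gam n) (gam m) := by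
  have hm : Measurable (fun x : Fin n → ℝ => U *ᵥ x) :=
    (Continuous.matrix_mulVec continuous_const continuous_id).measurable
  refine ⟨hm, ?_⟩
  have hinj : Function.Injective (fun μ : Measure (Fin m → ℝ) =>
      μ.map (MeasurableEquiv.toLp 2 (Fin m → ℝ))) :=
    (MeasurableEquiv.toLp 2 (Fin m → ℝ)).map_measurableEquiv_injective
  apply hinj
  have e1 : (gam m).map (MeasurableEquiv.toLp 2 (Fin m → ℝ)) = stdGaussian (EuclideanSpace ℝ (Fin m)) :=
    map_pi_eq_stdGaussian
  have e2 : (gam n).map (WithLp.toLp 2) = stdGaussian (EuclideanSpace ℝ (Fin n)) :=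
    map_pi_eq_stdGaussian
  simp only
  rw [e1, Measure.map_map (by fun_prop) hm]
  have : IsProbabilityMeasure (Measure.map (⇑(MeasurableEquiv.toLp 2 (Fin m → ℝ)) ∘ fun x => U *ᵥ x) (gam n)) :=
    Measure.isProbabilityMeasure_map (by fun_prop)
  apply Measure.ext_of_charFun
  ext t
  have h1 := charFun_stdGaussian (WithLp.toLp 2 (Uᵀ *ᵥ t.ofLp) : EuclideanSpace ℝ (Fin n))
  rw [← e2, charFun_apply, integral_map (by fun_prop) (by fun_prop)] at h1
  rw [charFun_stdGaussian, charFun_apply, integral_map (by fun_prop) (by fun_prop)]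
  have h2 : ‖(WithLp.toLp 2 (Uᵀ *ᵥ t.ofLp) : EuclideanSpace ℝ (Fin n))‖ ^ 2 = ‖t‖ ^ 2 := by
    rw [← norm2_eq, norm2_sq]
    have : ‖t‖ = norm2 t.ofLp := by rw [norm2_eq]
    rw [this, norm2_sq, dotProduct_mulVec, vecMul_transpose, mulVec_mulVec, hU, one_mulVec]
  rw [← Complex.ofReal_pow, h2] at h1
  rw [← Complex.ofReal_pow, ← h1]
  congr 1; ext x
  congr 3
  simp only [Function.comp, MeasurableEquiv.coe_toLp, EuclideanSpace.inner_eq_star_dotProduct, star_trivial]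
  rw [mulVec_transpose, ← dotProduct_mulVec]

lemma lin_moment {d : ℕ} (w : Fin d → ℝ) {p : ℕ} (hp : p ≠ 0) :
    ∫⁻ z, ENNReal.ofReal |z ⬝ᵥ w| ^ p ∂(gam d) =
      ENNReal.ofReal (norm2 w) ^ p * ENNReal.ofReal (J p / J 0) := by
  by_cases hw : w = 0
  · subst hw; simp [norm2, hp]
  have hpos : 0 < norm2 w := by
    rw [norm2_eq, norm_pos_iff]; simpa using hw
  set U : Matrix (Fin 1) (Fin d) ℝ := Matrix.of fun _ j => w j / norm2 w with hUd
  have hU : U * Uᵀ = 1 := by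
    ext i j
    have hi : i = 0 := Subsingleton.elim _ _
    have hj : j = 0 := Subsingleton.elim _ _
    subst hi; subst hj
    have h := norm2_sq w
    simp only [Matrix.mul_apply, hUd, Matrix.of_apply, Matrix.transpose_apply, Matrix.one_apply_eq]
    have : ∀ x, w x / norm2 w * (w x / norm2 w) = (w x * w x) / norm2 w ^ 2 := fun x => by
      field_simp
    simp_rw [this]
    rw [← Finset.sum_div, h]
    rw [dotProduct]
    exact div_self (by rw [dotProduct] at h; rw [← h]; positivity)
  have h1 := moment_pos (n := 1) one_pos p
  rw [← (gam_map U hU).lintegral_comp (by have := measurable_norm2 (n := 1); fun_prop)] at h1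
  simp only [Nat.sub_self, zero_add] at h1
  rw [← h1, ← lintegral_const_mul' _ _ (by simp)]
  congr 1; ext z
  rw [← mul_pow, ← ENNReal.ofReal_mul hpos.le]
  congr 2
  have : (U *ᵥ z) 0 = (z ⬝ᵥ w) / norm2 w := by
    simp only [mulVec, dotProduct, hUd, Matrix.of_apply, Finset.sum_div]
    exact Finset.sum_congr rfl fun i _ => by ring
  have hn : norm2 (U *ᵥ z) = |(U *ᵥ z) 0| := by
    rw [norm2, Fin.sum_univ_one, Real.sqrt_sq_eq_abs]
  rw [hn, this, abs_div, abs_of_pos hpos]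
  field_simp

lemma bessel {m n : ℕ} (V : Matrix (Fin m) (Fin n) ℝ) (hV : V * Vᵀ = 1) (y : Fin n → ℝ) :
    (V *ᵥ y) ⬝ᵥ (V *ᵥ y) ≤ y ⬝ᵥ y := by
  set u := Vᵀ *ᵥ (V *ᵥ y) with hu
  have h1 : y ⬝ᵥ u = (V *ᵥ y) ⬝ᵥ (V *ᵥ y) := by
    rw [hu, dotProduct_mulVec, vecMul_transpose]
  have h2 : u ⬝ᵥ u = (V *ᵥ y) ⬝ᵥ (V *ᵥ y) := by
    nth_rw 2 [hu]
    rw [dotProduct_mulVec, vecMul_transpose, hu, mulVec_mulVec, hV, one_mulVec]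
  have h3 : 0 ≤ (y - u) ⬝ᵥ (y - u) := by rw [← norm2_sq]; positivity
  have h4 := dotProduct_comm u y
  simp only [sub_dotProduct, dotProduct_sub] at h3
  linarith

lemma exists_frame {N d' p : ℕ} (hN : N = d' + 1 + p) (H : Fin d' → Fin N → ℝ) :
    ∃ V : Matrix (Fin (p+1)) (Fin N) ℝ, V * Vᵀ = 1 ∧ ∀ j, V *ᵥ H j = 0 := by
  let S : Submodule ℝ (EuclideanSpace ℝ (Fin N)) :=
    Submodule.span ℝ (Set.range fun j => (WithLp.toLp 2 (H j) : EuclideanSpace ℝ (Fin N)))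
  have h1 : Module.finrank ℝ S ≤ d' := by
    have := finrank_range_le_card (R := ℝ) (fun j => (WithLp.toLp 2 (H j) : EuclideanSpace ℝ (Fin N)))
    simpa [Set.finrank] using this
  have h2 := S.finrank_add_finrank_orthogonal
  rw [finrank_euclideanSpace_fin] at h2
  have h3 : p + 1 ≤ Module.finrank ℝ Sᗮ := by omega
  let b := stdOrthonormalBasis ℝ Sᗮ
  let v : Fin (p+1) → EuclideanSpace ℝ (Fin N) := fun i => (b (Fin.castLE h3 i) : EuclideanSpace ℝ (Fin N))
  have hv : ∀ i j, inner ℝ (v i) (v j) = if i = j then (1:ℝ) else 0 := by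
    intro i j
    have := (orthonormal_iff_ite.1 b.orthonormal) (Fin.castLE h3 i) (Fin.castLE h3 j)
    simpa [v] using this
  refine ⟨Matrix.of fun i j => v i j, ?_, ?_⟩
  · ext i j
    have := hv i j
    rw [Matrix.one_apply, ← this, Matrix.mul_apply]
    simp only [EuclideanSpace.inner_eq_star_dotProduct, star_trivial, dotProduct]
    exact Finset.sum_congr rfl fun k _ => mul_comm _ _
  · intro j
    ext i
    have hm : v i ∈ Sᗮ := (b (Fin.castLE h3 i)).2
    have := (Submodule.mem_orthogonal S (v i)).1 hm (WithLp.toLp 2 (H j)) (Submodule.subset_span ⟨j, rfl⟩)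
    simp only [EuclideanSpace.inner_eq_star_dotProduct, star_trivial] at this
    simpa [mulVec] using this

lemma gram_symm {N d : ℕ} (G : Matrix (Fin N) (Fin d) ℝ) : ((Gᵀ * G)⁻¹)ᵀ = (Gᵀ * G)⁻¹ := by
  rw [Matrix.transpose_nonsing_inv]; simp

lemma gram_quad {N d : ℕ} (G : Matrix (Fin N) (Fin d) ℝ) (w : Fin d → ℝ) :
    w ⬝ᵥ ((Gᵀ * G) *ᵥ w) = (G *ᵥ w) ⬝ᵥ (G *ᵥ w) := by
  rw [← mulVec_mulVec, dotProduct_mulVec, vecMul_transpose]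

lemma entry_bound {N d' p : ℕ} (G : Matrix (Fin N) (Fin (d'+1)) ℝ) (V : Matrix (Fin (p+1)) (Fin N) ℝ)
    (hV : V * Vᵀ = 1) (h0 : ∀ j : Fin d', V *ᵥ (fun i => G i j.succ) = 0) :
    ENNReal.ofReal (Real.sqrt ((Gᵀ * G)⁻¹ 0 0)) ≤ (ENNReal.ofReal (norm2 (V *ᵥ fun i => G i 0)))⁻¹ := by
  by_cases hdet : IsUnit (Gᵀ * G).det
  swap
  · rw [Matrix.nonsing_inv_apply_not_isUnit _ hdet]; simp
  set q := (Gᵀ * G)⁻¹ 0 0 with hq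
  set e : Fin (d'+1) → ℝ := Pi.single 0 1 with he
  set w := (Gᵀ * G)⁻¹ *ᵥ e with hw
  have hw0 : w 0 = q := by rw [hw, he, mulVec_single_one]; rfl
  have hWw : (Gᵀ * G) *ᵥ w = e := by
    rw [hw, mulVec_mulVec, Matrix.mul_nonsing_inv _ hdet, one_mulVec]
  have hy : (G *ᵥ w) ⬝ᵥ (G *ᵥ w) = q := by
    rw [← gram_quad, hWw, he, dotProduct_single_one, hw0]
  have hVy : V *ᵥ (G *ᵥ w) = q • (V *ᵥ fun i => G i 0) := by
    have : G *ᵥ w = w 0 • (fun i => G i 0) + ∑ j : Fin d', w j.succ • (fun i => G i j.succ) := by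
      ext i
      simp [mulVec, dotProduct, Fin.sum_univ_succ, mul_comm]
    rw [this, mulVec_add, mulVec_smul, mulVec_sum, hw0]
    simp [mulVec_smul, h0]
  have hb := bessel V hV (G *ᵥ w)
  rw [hVy, hy, smul_dotProduct, dotProduct_smul, ← norm2_sq] at hb
  simp only [smul_eq_mul] at hb
  set S := norm2 (V *ᵥ fun i => G i 0)
  have hS : 0 ≤ S := norm2_nonneg _
  have hq0 : 0 ≤ q := by rw [← hy, ← norm2_sq]; positivity
  rcases hS.eq_or_lt with h | h
  · rw [← h]; simp
  rw [← ENNReal.ofReal_inv_of_pos h]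
  apply ENNReal.ofReal_le_ofReal
  rw [← Real.sqrt_sq (inv_nonneg.2 hS)]
  apply Real.sqrt_le_sqrt
  rcases hq0.eq_or_lt with h' | h'
  · rw [← h']; positivity
  rw [inv_pow, le_inv_comm₀ h' (by positivity)]
  rw [← one_div, le_div_iff₀ h']
  nlinarith

lemma measurable_gram_inv {N d : ℕ} (i j : Fin d) :
    Measurable (fun G : Fin N → Fin d → ℝ => ((Matrix.of G)ᵀ * Matrix.of G)⁻¹ i j) := by
  have hc : Continuous (fun G : Fin N → Fin d → ℝ => (Matrix.of G)ᵀ * Matrix.of G) := by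
    refine Continuous.matrix_mul (Continuous.matrix_transpose ?_) ?_ <;> exact continuous_id
  simp only [Matrix.inv_def, Ring.inverse_eq_inv', Matrix.smul_apply, smul_eq_mul]
  exact (hc.matrix_det.measurable.inv).mul
    ((hc.matrix_adjugate.matrix_elem i j).measurable)

abbrev Gam (N d : ℕ) : Measure (Fin N → Fin d → ℝ) := Measure.pi fun _ => gam d

lemma entry_moment {N d' p : ℕ} (hN : N = d' + 1 + p) :
    ∫⁻ G, ENNReal.ofReal (Real.sqrt (((Matrix.of G)ᵀ * Matrix.of G)⁻¹ 0 0)) ^ p ∂(Gam N (d'+1)) ≤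
      ENNReal.ofReal (J 0 / J p) := by
  have e1 := measurePreserving_pi (fun _ : Fin N => gam (d'+1)) (fun _ => (gaussianReal 0 1).prod (gam d'))
    (fun _ => measurePreserving_piFinSuccAbove (fun _ => gaussianReal 0 1) 0)
  have e2 := measurePreserving_arrowProdEquivProdArrow ℝ (Fin d' → ℝ) (Fin N)
    (fun _ => gaussianReal 0 1) (fun _ => gam d')
  have e4 := (Measure.measurePreserving_swap (μ := gam N) (ν := Gam N d')).comp (e2.comp e1)
  set F : (Fin N → Fin d' → ℝ) × (Fin N → ℝ) → ENNReal := fun y =>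
    ENNReal.ofReal (Real.sqrt (((Matrix.of (fun i => Fin.cons (y.2 i) (y.1 i) : Fin N → Fin (d'+1) → ℝ))ᵀ * Matrix.of (fun i => Fin.cons (y.2 i) (y.1 i)))⁻¹ 0 0)) ^ p with hF
  have hcons : Measurable (fun y : (Fin N → Fin d' → ℝ) × (Fin N → ℝ) =>
      (fun i => Fin.cons (y.2 i) (y.1 i) : Fin N → Fin (d'+1) → ℝ)) := by
    refine measurable_pi_lambda _ fun i => measurable_pi_lambda _ fun j => ?_
    refine Fin.cases ?_ (fun j => ?_) j
    · simp only [Fin.cons_zero]; fun_prop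
    · simp only [Fin.cons_succ]; fun_prop
  have hFm : Measurable F := by
    have := ((measurable_gram_inv (N := N) (0 : Fin (d'+1)) 0).comp hcons)
    exact (ENNReal.measurable_ofReal.comp (Real.continuous_sqrt.measurable.comp this)).pow_const p
  have h := e4.lintegral_comp hFm
  calc _ = ∫⁻ y, F y ∂((Gam N d').prod (gam N)) := by
        rw [← h]
        congr 1; ext G
        have : (fun i => Fin.cons (G i 0) (fun j => G i (Fin.succ j)) : Fin N → Fin (d'+1) → ℝ) = G := by
          ext i j
          refine Fin.cases ?_ (fun j => ?_) j <;> simp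
        conv_lhs => rw [← this]
        rfl
    _ ≤ ∫⁻ H, ∫⁻ g, F (H, g) ∂(gam N) ∂(Gam N d') := lintegral_prod_le _
    _ ≤ ∫⁻ H, ENNReal.ofReal (J 0 / J p) ∂(Gam N d') := by
        refine lintegral_mono fun H => ?_
        obtain ⟨V, hV, h0⟩ := exists_frame hN (fun j i => H i j)
        rw [← moment_neg, ← (gam_map V hV).lintegral_comp (by have := measurable_norm2 (n := p+1); fun_prop)]
        refine lintegral_mono fun g => ?_
        simp only [hF]
        gcongr
        exact entry_bound _ V hV h0
    _ = _ := by simp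


lemma exists_rot {d' : ℕ} (z : Fin (d'+1) → ℝ) :
    ∃ Q : Matrix (Fin (d'+1)) (Fin (d'+1)) ℝ, Q * Qᵀ = 1 ∧ Q *ᵥ z = norm2 z • Pi.single 0 1 := by
  by_cases hz : z = 0
  · subst hz; exact ⟨1, by simp, by simp [norm2]⟩
  have hpos : 0 < norm2 z := by
    rw [norm2_eq, norm_pos_iff]; simpa using hz
  let u : EuclideanSpace ℝ (Fin (d'+1)) := (norm2 z)⁻¹ • WithLp.toLp 2 z
  have hu : ‖u‖ = 1 := by
    simp only [u]
    rw [norm_smul, ← norm2_eq, Real.norm_of_nonneg (by positivity), inv_mul_cancel₀ hpos.ne']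
  obtain ⟨b, hb⟩ := Orthonormal.exists_orthonormalBasis_extension_of_card_eq (𝕜 := ℝ)
    (E := EuclideanSpace ℝ (Fin (d'+1))) (ι := Fin (d'+1)) (by simp) (v := fun _ => u) (s := {0})
    (by
      rw [orthonormal_iff_ite]
      rintro ⟨i, hi⟩ ⟨j, hj⟩
      simp only [Set.mem_singleton_iff] at hi hj
      subst hi; subst hj
      simp [hu])
  have hb0 : b 0 = u := hb 0 rfl
  have hz' : (WithLp.toLp 2 z : EuclideanSpace ℝ (Fin (d'+1))) = norm2 z • b 0 := by
    rw [hb0]; simp only [u]; rw [smul_smul, mul_inv_cancel₀ hpos.ne', one_smul]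
  have hin := orthonormal_iff_ite.1 b.orthonormal
  refine ⟨Matrix.of fun i j => b i j, ?_, ?_⟩
  · ext i j
    rw [Matrix.one_apply, ← hin i j, Matrix.mul_apply]
    simp only [EuclideanSpace.inner_eq_star_dotProduct, star_trivial, dotProduct]
    exact Finset.sum_congr rfl fun k _ => mul_comm _ _
  · ext i
    have h1 : inner ℝ (b i) (WithLp.toLp 2 z : EuclideanSpace ℝ (Fin (d'+1))) =
        norm2 z * if i = 0 then 1 else 0 := by
      rw [hz', inner_smul_right, hin]
    simp only [EuclideanSpace.inner_eq_star_dotProduct, star_trivial] at h1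
    rw [dotProduct_comm] at h1
    refine Eq.trans h1 ?_
    simp [Pi.single_apply]

lemma measurable_quad {N d : ℕ} :
    Measurable (fun y : (Fin d → ℝ) × (Fin N → Fin d → ℝ) =>
      y.1 ⬝ᵥ (((Matrix.of y.2)ᵀ * Matrix.of y.2)⁻¹ *ᵥ y.1)) := by
  simp only [dotProduct, mulVec]
  refine Finset.measurable_sum _ fun i _ => Measurable.mul (by fun_prop) ?_
  refine Finset.measurable_sum _ fun j _ => Measurable.mul ?_ (by fun_prop)
  exact (measurable_gram_inv i j).comp measurable_snd

lemma quad_moment {N d' p : ℕ} (hN : N = d' + 1 + p) (z : Fin (d'+1) → ℝ) :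
    ∫⁻ G, ENNReal.ofReal (Real.sqrt (z ⬝ᵥ (((Matrix.of G)ᵀ * Matrix.of G)⁻¹ *ᵥ z))) ^ p
      ∂(Gam N (d'+1)) ≤ ENNReal.ofReal (norm2 z) ^ p * ENNReal.ofReal (J 0 / J p) := by
  obtain ⟨Q, hQ, hQz⟩ := exists_rot z
  have hQ' : Qᵀ * Q = 1 := mul_eq_one_comm.1 hQ
  have hT := measurePreserving_pi (fun _ : Fin N => gam (d'+1)) (fun _ => gam (d'+1))
    (fun _ => gam_map Qᵀ (by simpa using hQ'))
  have hm : Measurable (fun G : Fin N → Fin (d'+1) → ℝ =>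
      ENNReal.ofReal (Real.sqrt (z ⬝ᵥ (((Matrix.of G)ᵀ * Matrix.of G)⁻¹ *ᵥ z))) ^ p) := by
    have := measurable_quad (N := N) (d := d'+1) |>.comp (measurable_prodMk_left (x := z))
    exact (ENNReal.measurable_ofReal.comp (Real.continuous_sqrt.measurable.comp this)).pow_const p
  rw [← hT.lintegral_comp hm]
  calc _ = ∫⁻ G, ENNReal.ofReal (norm2 z) ^ p *
        ENNReal.ofReal (Real.sqrt (((Matrix.of G)ᵀ * Matrix.of G)⁻¹ 0 0)) ^ p ∂(Gam N (d'+1)) := by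
        congr 1; ext G
        rw [← mul_pow, ← ENNReal.ofReal_mul (norm2_nonneg _)]
        congr 2
        have h1 : (Matrix.of fun i => Qᵀ *ᵥ G i) = Matrix.of G * Q := by
          ext i j
          simp [Matrix.mul_apply, mulVec, dotProduct, mul_comm]
        have h2 : ((Matrix.of G * Q)ᵀ * (Matrix.of G * Q))⁻¹ =
            Qᵀ * (((Matrix.of G)ᵀ * Matrix.of G)⁻¹ * Q) := by
          have e : (Matrix.of G * Q)ᵀ * (Matrix.of G * Q) = Qᵀ * ((Matrix.of G)ᵀ * Matrix.of G) * Q := by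
            rw [transpose_mul]; simp only [Matrix.mul_assoc]
          rw [e, Matrix.mul_inv_rev, Matrix.mul_inv_rev, Matrix.inv_eq_left_inv hQ', Matrix.inv_eq_left_inv hQ]
        rw [h1, h2, ← mulVec_mulVec, ← mulVec_mulVec, dotProduct_mulVec, vecMul_transpose, hQz,
          mulVec_smul, smul_dotProduct, dotProduct_smul, mulVec_single_one, single_one_dotProduct]
        simp only [smul_eq_mul]
        rw [← mul_assoc, Real.sqrt_mul (mul_self_nonneg _), Real.sqrt_mul_self (norm2_nonneg _)]
        rfl
    _ = ENNReal.ofReal (norm2 z) ^ p * _ := lintegral_const_mul' _ _ (by simp)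
    _ ≤ _ := by gcongr; exact entry_moment hN

/-- Gaussian average of the inverse quadratic form. -/
def Phi {N d : ℕ} (p : ℕ) (G : Fin N → Fin d → ℝ) : ENNReal :=
  ∫⁻ z, ENNReal.ofReal (Real.sqrt (z ⬝ᵥ (((Matrix.of G)ᵀ * Matrix.of G)⁻¹ *ᵥ z))) ^ p ∂(gam d)

lemma Phi_int {N d p : ℕ} (hd : 1 ≤ d) (hp : 2 ≤ p) (hN : N = d + p) :
    ∫⁻ G, Phi p G ∂(Gam N d) ≤
      ENNReal.ofReal ((Real.exp 1 * Real.sqrt N / ((p:ℝ) - 1)) ^ p * (J p / J 0)) := by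
  obtain ⟨d', rfl⟩ : ∃ d', d = d' + 1 := ⟨d - 1, by omega⟩
  unfold Phi
  rw [lintegral_lintegral_swap]
  · calc _ ≤ ∫⁻ z, ENNReal.ofReal (norm2 z) ^ p * ENNReal.ofReal (J 0 / J p) ∂(gam (d'+1)) :=
        lintegral_mono fun z => quad_moment hN z
      _ = ENNReal.ofReal (J (d'+1-1+p) / J (d'+1-1)) * ENNReal.ofReal (J 0 / J p) := by
        rw [lintegral_mul_const' _ _ (by simp), moment_pos (by omega)]
      _ ≤ _ := by
        have h1 := J_pos (d'+1-1+p)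
        have h2 := J_pos (d'+1-1)
        rw [← ENNReal.ofReal_mul (by positivity)]
        exact ENNReal.ofReal_le_ofReal (numeric (d'+1) p N hd hp hN.symm)
  · have := measurable_quad (N := N) (d := d'+1) |>.comp measurable_swap
    exact ((ENNReal.measurable_ofReal.comp (Real.continuous_sqrt.measurable.comp this)).pow_const p).aemeasurable

lemma cs {n : ℕ} (x y : Fin n → ℝ) : |x ⬝ᵥ y| ≤ norm2 x * norm2 y := by
  have := abs_real_inner_le_norm (WithLp.toLp 2 y : EuclideanSpace ℝ (Fin n)) (WithLp.toLp 2 x)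
  rw [← norm2_eq, ← norm2_eq] at this
  simp only [EuclideanSpace.inner_eq_star_dotProduct, star_trivial] at this
  rw [mul_comm]; exact this

/-- Pointwise lower bound of `Phi`. -/
lemma Phi_lower {N d p : ℕ} (hp : p ≠ 0) (G : Fin N → Fin d → ℝ) (w : Fin d → ℝ)
    (hdet : IsUnit ((Matrix.of G)ᵀ * Matrix.of G).det) (hw : norm2 (Matrix.of G *ᵥ w) ≤ 1) :
    ENNReal.ofReal (norm2 w) ^ p * ENNReal.ofReal (J p / J 0) ≤ Phi p G := by
  rw [← lin_moment w hp]
  refine lintegral_mono fun z => ?_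
  dsimp only
  gcongr
  set X := Matrix.of G
  set u := (Xᵀ * X)⁻¹ *ᵥ z with hu
  have hz : (Xᵀ * X) *ᵥ u = z := by
    rw [hu, mulVec_mulVec, Matrix.mul_nonsing_inv _ hdet, one_mulVec]
  have h1 : z ⬝ᵥ w = (X *ᵥ u) ⬝ᵥ (X *ᵥ w) := by
    rw [← hz, ← mulVec_mulVec, mulVec_transpose, ← dotProduct_mulVec]
  have h2 : z ⬝ᵥ u = norm2 (X *ᵥ u) ^ 2 := by
    rw [norm2_sq, ← gram_quad, hz, dotProduct_comm]
  rw [h1, h2, Real.sqrt_sq (norm2_nonneg _)]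
  calc _ ≤ _ := cs _ _
    _ ≤ norm2 (X *ᵥ u) * 1 := by gcongr; exact norm2_nonneg _
    _ = _ := mul_one _

lemma norm2_smul {n : ℕ} (c : ℝ) (x : Fin n → ℝ) : norm2 (c • x) = |c| * norm2 x := by
  rw [norm2_eq, norm2_eq, WithLp.toLp_smul, norm_smul, Real.norm_eq_abs]

lemma norm2_zero {n : ℕ} : norm2 (0 : Fin n → ℝ) = 0 := by simp [norm2]

lemma norm2_pos {n : ℕ} {x : Fin n → ℝ} (hx : x ≠ 0) : 0 < norm2 x := by
  rw [norm2_eq, norm_pos_iff]; simpa using hx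

lemma sMin_mul_le {m n : ℕ} (A : Matrix (Fin m) (Fin n) ℝ) (x : Fin n → ℝ) :
    sMin A * norm2 x ≤ norm2 (A *ᵥ x) := by
  by_cases hx : x = 0
  · subst hx; simp [norm2]
  have hp := norm2_pos hx
  have : sMin A ≤ norm2 (A *ᵥ ((norm2 x)⁻¹ • x)) := by
    refine csInf_le ⟨0, ?_⟩ ⟨(norm2 x)⁻¹ • x, ?_, rfl⟩
    · rintro c ⟨y, -, rfl⟩; exact norm2_nonneg _
    · rw [norm2_smul, abs_of_pos (by positivity), inv_mul_cancel₀ hp.ne']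
  rw [mulVec_smul, norm2_smul, abs_of_pos (by positivity)] at this
  rw [← le_div_iff₀ hp, div_eq_inv_mul]; exact this

lemma exists_unit {n : ℕ} (hn : 0 < n) : ∃ x : Fin n → ℝ, norm2 x = 1 :=
  ⟨Pi.single ⟨0, hn⟩ 1, by
    have := norm2_sq (Pi.single (⟨0, hn⟩ : Fin n) (1:ℝ))
    rw [single_one_dotProduct, Pi.single_eq_same] at this
    nlinarith [norm2_nonneg (Pi.single (⟨0, hn⟩ : Fin n) (1:ℝ))]⟩

lemma sMin_pos {d : ℕ} (hd : 0 < d) (S : Matrix (Fin d) (Fin d) ℝ) (hS : IsUnit S.det) :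
    0 < sMin S := by
  let L := (Matrix.toEuclideanLin S⁻¹).toContinuousLinearMap
  have hL : ∀ x, norm2 (S⁻¹ *ᵥ x) ≤ ‖L‖ * norm2 x := by
    intro x
    rw [norm2_eq, norm2_eq]
    exact L.le_opNorm (WithLp.toLp 2 x)
  have hb : ∀ x, norm2 x = 1 → 1 ≤ (‖L‖ + 1) * norm2 (S *ᵥ x) := by
    intro x hx
    have := hL (S *ᵥ x)
    rw [mulVec_mulVec, Matrix.nonsing_inv_mul _ hS, one_mulVec, hx] at this
    nlinarith [norm2_nonneg (S *ᵥ x)]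
  have hK : 0 < ‖L‖ + 1 := by positivity
  refine lt_of_lt_of_le (inv_pos.2 hK) (le_csInf ?_ ?_)
  · obtain ⟨x, hx⟩ := exists_unit hd
    exact ⟨_, x, hx, rfl⟩
  · rintro c ⟨x, hx, rfl⟩
    rw [inv_le_iff_one_le_mul₀' hK]; exact hb x hx

/-- Smallest eigenvalue bound: `s‖v‖² ≤ ‖Aᵀv‖²`. -/
lemma sMin_quad {d : ℕ} (hd : 0 < d) (S A : Matrix (Fin d) (Fin d) ℝ) (hS : IsUnit S.det)
    (hA : A * Aᵀ = S) (v : Fin d → ℝ) : sMin S * norm2 v ^ 2 ≤ norm2 (Aᵀ *ᵥ v) ^ 2 := by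
  have hs := sMin_pos hd S hS
  by_cases hv : v = 0
  · subst hv; simp [norm2]
  have hv := norm2_pos hv
  set t := S⁻¹ *ᵥ v with ht
  have hSt : S *ᵥ t = v := by rw [ht, mulVec_mulVec, Matrix.mul_nonsing_inv _ hS, one_mulVec]
  have h1 : v ⬝ᵥ v = (Aᵀ *ᵥ v) ⬝ᵥ (Aᵀ *ᵥ t) := by
    nth_rw 2 [← hSt]
    rw [← hA, ← mulVec_mulVec, dotProduct_mulVec, ← mulVec_transpose]
  have h2 : norm2 (Aᵀ *ᵥ t) ^ 2 = t ⬝ᵥ v := by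
    rw [norm2_sq, ← gram_quad, transpose_transpose, hA, hSt]
  have h3 := sMin_mul_le S t
  rw [hSt] at h3
  have h4 : t ⬝ᵥ v ≤ norm2 t * norm2 v := (le_abs_self _).trans (cs _ _)
  have h5 : norm2 v ^ 2 ≤ norm2 (Aᵀ *ᵥ v) * norm2 (Aᵀ *ᵥ t) := by
    rw [norm2_sq, h1]; exact (le_abs_self _).trans (cs _ _)
  have h6 : norm2 v ^ 4 ≤ norm2 (Aᵀ *ᵥ v) ^ 2 * (norm2 t * norm2 v) := by
    calc norm2 v ^ 4 = (norm2 v ^ 2) ^ 2 := by ring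
      _ ≤ (norm2 (Aᵀ *ᵥ v) * norm2 (Aᵀ *ᵥ t)) ^ 2 := by gcongr
      _ = norm2 (Aᵀ *ᵥ v) ^ 2 * (t ⬝ᵥ v) := by rw [mul_pow, h2]
      _ ≤ _ := by gcongr
  have h7 : sMin S * norm2 v ^ 4 ≤ norm2 (Aᵀ *ᵥ v) ^ 2 * norm2 v ^ 2 := by
    calc sMin S * norm2 v ^ 4 ≤ sMin S * (norm2 (Aᵀ *ᵥ v) ^ 2 * (norm2 t * norm2 v)) := by gcongr
      _ = norm2 (Aᵀ *ᵥ v) ^ 2 * norm2 v * (sMin S * norm2 t) := by ring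
      _ ≤ norm2 (Aᵀ *ᵥ v) ^ 2 * norm2 v * norm2 v := by gcongr
      _ = _ := by ring
  have hv2 : 0 < norm2 v ^ 2 := by positivity
  refine le_of_mul_le_mul_right ?_ hv2
  calc sMin S * norm2 v ^ 2 * norm2 v ^ 2 = sMin S * norm2 v ^ 4 := by ring
    _ ≤ _ := h7


lemma pinv_bound {N d p : ℕ} (hp : p ≠ 0) (hd : 0 < d) (S A : Matrix (Fin d) (Fin d) ℝ)
    (hS : IsUnit S.det) (hA : A * Aᵀ = S) (G : Fin N → Fin d → ℝ) (y : Fin N → ℝ) (hy : norm2 y = 1) :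
    ENNReal.ofReal (Real.sqrt (sMin S) * norm2 (pinv (Matrix.of G * Aᵀ) *ᵥ y)) ^ p *
      ENNReal.ofReal (J p / J 0) ≤ Phi p G := by
  set X := Matrix.of G * Aᵀ with hX
  have hs := sMin_pos hd S hS
  by_cases hdet : IsUnit (Xᵀ * X).det
  swap
  · have : pinv X = 0 := by
      rw [pinv, Matrix.nonsing_inv_apply_not_isUnit _ hdet, Matrix.zero_mul]
    rw [this]; simp [norm2, hp]
  have hdetW : IsUnit ((Matrix.of G)ᵀ * Matrix.of G).det := by
    have e : Xᵀ * X = A * ((Matrix.of G)ᵀ * Matrix.of G) * Aᵀ := by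
      rw [hX, transpose_mul, transpose_transpose]; simp only [Matrix.mul_assoc]
    rw [e, det_mul, det_mul] at hdet
    exact isUnit_of_mul_isUnit_right (isUnit_of_mul_isUnit_left hdet)
  set v := pinv X *ᵥ y with hv
  have hXv : (Xᵀ * X) *ᵥ v = Xᵀ *ᵥ y := by
    rw [hv, pinv, mulVec_mulVec, ← Matrix.mul_assoc, Matrix.mul_nonsing_inv _ hdet, Matrix.one_mul]
  have h1 : norm2 (X *ᵥ v) ^ 2 = (X *ᵥ v) ⬝ᵥ y := by
    rw [norm2_sq, ← gram_quad, hXv, dotProduct_mulVec, vecMul_transpose]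
  have h2 : norm2 (X *ᵥ v) ≤ 1 := by
    have := (le_abs_self _).trans (cs (X *ᵥ v) y)
    rw [hy, mul_one, ← h1] at this
    nlinarith [norm2_nonneg (X *ᵥ v)]
  have h3 := Phi_lower hp G (Aᵀ *ᵥ v) hdetW (by rw [mulVec_mulVec]; exact h2)
  refine le_trans ?_ h3
  gcongr
  refine (pow_le_pow_iff_left₀ (mul_nonneg (Real.sqrt_nonneg _) (norm2_nonneg _)) (norm2_nonneg _) two_ne_zero).1 ?_
  rw [mul_pow, Real.sq_sqrt hs.le]
  exact sMin_quad hd S A hS hA v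

lemma spec_nonneg {m n : ℕ} (A : Matrix (Fin m) (Fin n) ℝ) : 0 ≤ spec A := by
  apply Real.sSup_nonneg
  rintro c ⟨x, -, rfl⟩; exact norm2_nonneg _

lemma spec_bound {N d p : ℕ} (hp : p ≠ 0) (hd : 0 < d) (S A : Matrix (Fin d) (Fin d) ℝ)
    (hS : IsUnit S.det) (hA : A * Aᵀ = S) (G : Fin N → Fin d → ℝ) :
    ENNReal.ofReal (Real.sqrt (sMin S) * spec (pinv (Matrix.of G * Aᵀ))) ^ p *
      ENNReal.ofReal (J p / J 0) ≤ Phi p G := by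
  have hs := sMin_pos hd S hS
  have hM : 0 < J p / J 0 := div_pos (J_pos _) (J_pos _)
  by_cases hPhi : Phi p G = ⊤
  · rw [hPhi]; exact le_top
  set K := (Phi p G).toReal with hK
  have hPK : Phi p G = ENNReal.ofReal K := (ENNReal.ofReal_toReal hPhi).symm
  have hK0 : 0 ≤ K := ENNReal.toReal_nonneg
  have hpp : (0:ℝ) < p := by positivity
  set B : ℝ := (K / (J p / J 0)) ^ ((p:ℝ)⁻¹) with hB
  have hB0 : 0 ≤ B := by positivity
  have hBp : B ^ p * (J p / J 0) = K := by
    rw [hB, Real.rpow_inv_natCast_pow (by positivity) hp, div_mul_cancel₀ _ hM.ne']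
  have hspec : spec (pinv (Matrix.of G * Aᵀ)) ≤ B / Real.sqrt (sMin S) := by
    apply Real.sSup_le _ (by positivity)
    rintro c ⟨y, hy, rfl⟩
    have h := pinv_bound hp hd S A hS hA G y hy
    have h0 : 0 ≤ Real.sqrt (sMin S) * norm2 (pinv (Matrix.of G * Aᵀ) *ᵥ y) :=
      mul_nonneg (Real.sqrt_nonneg _) (norm2_nonneg _)
    rw [hPK, ← ENNReal.ofReal_pow h0, ← ENNReal.ofReal_mul (by positivity),
      ENNReal.ofReal_le_ofReal_iff hK0, ← hBp] at h
    have h' := le_of_mul_le_mul_right h hM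
    rw [pow_le_pow_iff_left₀ h0 hB0 hp] at h'
    rw [le_div_iff₀ (by positivity), mul_comm]; exact h'
  have h1 : Real.sqrt (sMin S) * spec (pinv (Matrix.of G * Aᵀ)) ≤ B := by
    rw [le_div_iff₀ (by positivity)] at hspec; linarith
  have hr : ENNReal.ofReal (B ^ p * (J p / J 0)) = ENNReal.ofReal B ^ p * ENNReal.ofReal (J p / J 0) := by
    rw [ENNReal.ofReal_mul (by positivity), ENNReal.ofReal_pow hB0]
  rw [hPK, ← hBp, hr]
  gcongr

lemma bern (p : ℕ) (hp : 2 ≤ p) (a : ℝ) (ha : 0 ≤ a) :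
    a ^ 2 ≤ (1 - 2 / (p:ℝ)) + 2 / (p:ℝ) * a ^ p := by
  have hp' : (2:ℝ) ≤ p := by exact_mod_cast hp
  have h := one_add_mul_self_le_rpow_one_add (s := a^2 - 1) (by nlinarith [sq_nonneg a])
    (p := (p:ℝ)/2) (by linarith)
  have e : (1 + (a^2 - 1)) ^ ((p:ℝ)/2) = a ^ p := by
    rw [add_sub_cancel, ← Real.rpow_natCast a 2, ← Real.rpow_mul ha, ← Real.rpow_natCast]
    congr 1; push_cast; ring
  rw [e] at h
  have h2 : 2 / (p:ℝ) * (1 + (p:ℝ)/2 * (a^2-1)) ≤ 2 / (p:ℝ) * a ^ p := by gcongr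
  have h3 : 2 / (p:ℝ) * (1 + (p:ℝ)/2 * (a^2-1)) = 2 / (p:ℝ) + (a^2 - 1) := by field_simp
  linarith

lemma jensen {Ω : Type*} [MeasurableSpace Ω] (μ : Measure Ω) [IsProbabilityMeasure μ] (f : Ω → ℝ)
    (hf : ∀ x, 0 ≤ f x) (p : ℕ) (hp : 2 ≤ p) (τ : ℝ) (hτ : 0 < τ)
    (h : ∫⁻ x, ENNReal.ofReal (f x) ^ p ∂μ ≤ ENNReal.ofReal (τ ^ p)) : ∫ x, f x ^ 2 ∂μ ≤ τ ^ 2 := by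
  by_cases hi : Integrable (fun x => f x ^ 2) μ
  swap
  · rw [integral_undef hi]; positivity
  rw [integral_eq_lintegral_of_nonneg_ae (ae_of_all _ fun x => sq_nonneg _) hi.1]
  apply ENNReal.toReal_le_of_le_ofReal (by positivity)
  have hp' : (2:ℝ) ≤ p := by exact_mod_cast hp
  have hc1 : 0 ≤ (1 - 2 / (p:ℝ)) * τ ^ 2 := by
    have : 2 / (p:ℝ) ≤ 1 := by rw [div_le_one (by linarith)]; exact hp'
    exact mul_nonneg (by linarith) (by positivity)
  calc ∫⁻ x, ENNReal.ofReal (f x ^ 2) ∂μ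
      ≤ ∫⁻ x, (ENNReal.ofReal ((1 - 2 / (p:ℝ)) * τ ^ 2) +
          ENNReal.ofReal (2 / (p:ℝ) * τ ^ 2 / τ ^ p) * ENNReal.ofReal (f x) ^ p) ∂μ := by
        refine lintegral_mono fun x => ?_
        dsimp only
        have hx := hf x
        rw [← ENNReal.ofReal_pow hx, ← ENNReal.ofReal_mul (by positivity),
          ← ENNReal.ofReal_add hc1 (by positivity)]
        apply ENNReal.ofReal_le_ofReal
        have hb := bern p hp (f x / τ) (by positivity)
        calc f x ^ 2 = (f x / τ) ^ 2 * τ ^ 2 := by field_simp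
          _ ≤ ((1 - 2 / (p:ℝ)) + 2 / (p:ℝ) * (f x / τ) ^ p) * τ ^ 2 := by gcongr
          _ = _ := by rw [div_pow]; ring
    _ = ENNReal.ofReal ((1 - 2 / (p:ℝ)) * τ ^ 2) +
          ENNReal.ofReal (2 / (p:ℝ) * τ ^ 2 / τ ^ p) * ∫⁻ x, ENNReal.ofReal (f x) ^ p ∂μ := by
        rw [lintegral_add_left measurable_const, lintegral_const_mul' _ _ (by simp)]
        simp
    _ ≤ ENNReal.ofReal ((1 - 2 / (p:ℝ)) * τ ^ 2) +
          ENNReal.ofReal (2 / (p:ℝ) * τ ^ 2 / τ ^ p) * ENNReal.ofReal (τ ^ p) := by gcongr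
    _ = ENNReal.ofReal (τ ^ 2) := by
        rw [← ENNReal.ofReal_mul (by positivity), ← ENNReal.ofReal_add hc1 (by positivity)]
        congr 1
        have : (p:ℝ) ≠ 0 := by linarith
        field_simp
        ring

lemma main_bound (N d : ℕ) (hd : 2 ≤ d) (hN : d + 1 < N) (S A : Matrix (Fin d) (Fin d) ℝ)
    (hS : S.PosDef) (hA : A * Aᵀ = S) :
    (∫ g, spec (pinv (Matrix.of g * Aᵀ)) ^ 2
            ∂(Measure.pi fun _ : Fin N => gaussianVec d 1)) ≤
          (1 / sMin S) * (Real.exp 1 * Real.sqrt N / ((N : ℝ) - (d : ℝ) - 1)) ^ 2 := by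
  obtain ⟨p, rfl⟩ : ∃ p, N = d + p := ⟨N - d, by omega⟩
  have hp : 2 ≤ p := by omega
  have hp' : (2:ℝ) ≤ p := by exact_mod_cast hp
  have hdet : IsUnit S.det := hS.det_pos.ne'.isUnit
  have hs := sMin_pos (by omega) S hdet
  have hM : 0 < J p / J 0 := div_pos (J_pos _) (J_pos _)
  simp only [gaussianVec_one]
  have e : ((d + p : ℕ):ℝ) - d - 1 = p - 1 := by push_cast; ring
  rw [e]
  set τ := Real.exp 1 * Real.sqrt (d + p : ℕ) / ((p:ℝ) - 1) with hτ
  have hτ0 : 0 < τ := by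
    have : (0:ℝ) < (d + p : ℕ) := by exact_mod_cast (by omega)
    have : (0:ℝ) < (p:ℝ) - 1 := by linarith
    positivity
  have h1 := Phi_int (N := d + p) (d := d) (p := p) (by omega) hp rfl
  rw [← hτ, ENNReal.ofReal_mul (by positivity)] at h1
  have h2 := (lintegral_mono (μ := Gam (d+p) d)
    (fun G => spec_bound (p := p) (by omega) (by omega) S A hdet hA G)).trans h1
  rw [lintegral_mul_const' _ _ (by simp)] at h2
  have h3 := (ENNReal.mul_le_mul_iff_left (by simpa using hM) (by simp)).1 h2
  have h4 := jensen (Gam (d+p) d) _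
    (fun G => mul_nonneg (Real.sqrt_nonneg _) (spec_nonneg _)) p hp τ hτ0 h3
  simp only [mul_pow, Real.sq_sqrt hs.le] at h4
  rw [integral_const_mul] at h4
  rw [one_div, ← div_eq_inv_mul, le_div_iff₀ hs, mul_comm]
  exact h4


/-- Lemma 4.6, first half: for `X` with i.i.d. `N(0, Σ_x)` rows
(realized as `X = G Aᵀ` with `A Aᵀ = Σ_x` and `G` standard Gaussian), `d ≥ 2`, `N > d + 1`,
there is a universal constant `C₃ > 0` with
`E‖X†‖² ≤ (C₃/σ_min(Σ_x))·(1/(√N − (d+1)/√N))²`; in fact one may take the bound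
`(1/σ_min(Σ_x))·(e√N/(N−d−1))²`. -/
theorem expected_sq_pinv_norm :
    ∃ C₃ : ℝ, 0 < C₃ ∧
      ∀ (N d : ℕ), 2 ≤ d → d + 1 < N →
      ∀ (Sigx A : Matrix (Fin d) (Fin d) ℝ), Sigx.PosDef → A * Aᵀ = Sigx →
        (∫ g, spec (pinv (Matrix.of g * Aᵀ)) ^ 2
            ∂(Measure.pi fun _ : Fin N => gaussianVec d 1)) ≤
          (C₃ / sMin Sigx) * (1 / (Real.sqrt N - ((d : ℝ) + 1) / Real.sqrt N)) ^ 2 ∧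
        (∫ g, spec (pinv (Matrix.of g * Aᵀ)) ^ 2
            ∂(Measure.pi fun _ : Fin N => gaussianVec d 1)) ≤
          (1 / sMin Sigx) * (Real.exp 1 * Real.sqrt N / ((N : ℝ) - (d : ℝ) - 1)) ^ 2 := by
  refine ⟨Real.exp 1 ^ 2, by positivity, fun N d hd hN Sigx A hS hA => ?_⟩
  have h := main_bound N d hd hN Sigx A hS hA
  refine ⟨h.trans (le_of_eq ?_), h⟩
  have hN0 : (0:ℝ) < N := by exact_mod_cast (by omega)
  have hs : 0 < Real.sqrt N := Real.sqrt_pos.2 hN0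
  have h1 : (0:ℝ) < (N:ℝ) - d - 1 := by
    have : ((d:ℝ) + 1) < N := by exact_mod_cast hN
    linarith
  have e : Real.sqrt N - ((d:ℝ) + 1) / Real.sqrt N = ((N:ℝ) - d - 1) / Real.sqrt N := by
    rw [eq_div_iff hs.ne', sub_mul, Real.mul_self_sqrt hN0.le, div_mul_cancel₀ _ hs.ne']
    ring
  rw [e]
  field_simp


end Stmt9
end
end
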